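/- Let f(x) be a power series in K⦃x⦄ in the variables x = (x_1,…,x_n) converging on O_K^n. Suppose that for some multi-index α ∈ ℕ^n with |α| > 0 one has |∂^α_x f(x)| ≥ 1 for all x ∈ O_K^n, and suppose that the characteristic of K is zero or larger than |α|. Set k = |α|. Then for all nonzero y ∈ K one has |∫_{O_K^n} ψ(y·f(x)) |dx|| ≤ d_k · |y|^{-1/k}, where d_k depends only on K, n, k, and the Gauss norm ‖f − f(0)‖. -/

import Mathlib

open MeasureTheory Filter
open scoped NNReal ENNReal Classical

namespace VdC

variable {K : Type*} [NontriviallyNormedField K]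

/-! ### One-variable convergent power series over a non-archimedean local field -/

/-- Evaluation of a one-variable power series (given by its coefficients) at a point. -/
noncomputable def pseval (a : ℕ → K) (x : K) : K := ∑' i, a i * x ^ i

/-- Membership in `K⦃x⦄`: the coefficients tend to `0`, i.e. convergence on `O_K`. -/
def IsConvergent (a : ℕ → K) : Prop := Tendsto (fun i => ‖a i‖) atTop (nhds 0)

/-- Gauss norm of a power series. -/
noncomputable def gaussNorm (a : ℕ → K) : ℝ := ⨆ i, ‖a i‖

/-- Coefficients of `f - f(0)`. -/
def tail (a : ℕ → K) : ℕ → K := fun i => if i = 0 then 0 else a i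

/-- SP power series: `a 1 ≠ 0` and `a j ∈ a 1 • M_K` for all `j > 1`;
`‖a 1‖` is then the SP-norm `|f|_SP`. -/
def IsSP (a : ℕ → K) : Prop := a 1 ≠ 0 ∧ ∀ j, 1 < j → ‖a j‖ < ‖a 1‖

/-- Coefficients of `f_{b,c}(t) = (1/c) ⬝ f (b + c t)`. -/
noncomputable def shiftCoeff (a : ℕ → K) (b c : K) : ℕ → K :=
  fun j => c⁻¹ * c ^ j * ∑' m : ℕ, ((m + j).choose j : K) * a (m + j) * b ^ m

/-- `SPAt q a r` says: for all nonzero `c ∈ M_K ^ r` and all `b ∈ O_K`, the power series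
`f_{b,c}` is SP.  (Here `c ∈ M_K ^ r` iff `‖c‖ ≤ q⁻¹ ^ r`.)  The SP-number of `f` is the
least `r` with this property, i.e. `IsLeast {r | SPAt q a r} r`. -/
def SPAt (q : ℕ) (a : ℕ → K) (r : ℕ) : Prop :=
  ∀ b c : K, ‖b‖ ≤ 1 → c ≠ 0 → ‖c‖ ≤ (q : ℝ)⁻¹ ^ r → IsSP (shiftCoeff a b c)

/-- Coefficients of the derivative of a power series; `dcoeff^[k] a` gives `f^{(k)}`. -/
def dcoeff (a : ℕ → K) : ℕ → K := fun j => ((j + 1 : ℕ) : K) * a (j + 1)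

/-- `K` is a non-archimedean local field whose residue field has `q` elements, the norm
being normalized so that a uniformizer `π_K` has norm `q⁻¹`. -/
structure IsLocalField (K : Type*) [NontriviallyNormedField K] (q : ℕ) : Prop where
  nonarch : IsNonarchimedean (norm : K → ℝ)
  one_lt : 1 < q
  complete : CompleteSpace K
  exists_unif : ∃ π : K, ‖π‖ = (q : ℝ)⁻¹
  discrete : ∀ x : K, x ≠ 0 → ∃ m : ℤ, ‖x‖ = (q : ℝ) ^ m
  residue : ∃ T : Finset K, T.card = q ∧ (∀ t ∈ T, ‖t‖ ≤ 1) ∧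
      ∀ x : K, ‖x‖ ≤ 1 → ∃! t, t ∈ T ∧ ‖x - t‖ < 1

/-- `ψ` is an additive character on `K`, trivial on `M_K` and nontrivial on `O_K`. -/
structure IsAddChar (ψ : K → ℂ) : Prop where
  cont : Continuous ψ
  map_add : ∀ x y, ψ (x + y) = ψ x * ψ y
  norm_eq : ∀ x, ‖ψ x‖ = 1
  triv : ∀ x : K, ‖x‖ < 1 → ψ x = 1
  nontriv : ∃ x : K, ‖x‖ ≤ 1 ∧ ψ x ≠ 1

/-- The characteristic of `K` is zero or larger than `k`. -/
def CharCond (K : Type*) [NontriviallyNormedField K] (k : ℕ) : Prop :=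
  ∀ m : ℕ, m ≤ k → (m : K) = 0 → m = 0

/-- `p` is the residue characteristic of `K` (so `q = p ^ f` is the residue cardinality)
and `e = ord (p_K)` is the ramification degree of `K`, i.e. `‖p‖ = q ^ (-e)`. -/
def IsResidueData (K : Type*) [NontriviallyNormedField K] (q p e : ℕ) : Prop :=
  p.Prime ∧ (∃ f : ℕ, 0 < f ∧ q = p ^ f) ∧ 0 < e ∧ ‖(p : K)‖ = (q : ℝ)⁻¹ ^ e

/-- `f` is (Weierstrass) regular of degree `d`: it lies in `O_K⦃x⦄` and is congruent to
a monic polynomial of degree `d` modulo `π_K ⬝ O_K⦃x⦄`. -/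
def IsRegularOfDeg (a : ℕ → K) (d : ℕ) : Prop :=
  (∀ i, ‖a i‖ ≤ 1) ∧ ‖a d - 1‖ < 1 ∧ ∀ i, d < i → ‖a i‖ < 1

/-! ### Several variables -/

/-- Evaluation of a power series in `n` variables at a point. -/
noncomputable def mpseval {n : ℕ} (a : (Fin n → ℕ) → K) (x : Fin n → K) : K :=
  ∑' i : Fin n → ℕ, a i * ∏ j, x j ^ i j

/-- Membership in `K⦃x_1,…,x_n⦄`: `‖a i‖ → 0` as `|i| → ∞`. -/
def MIsConvergent {n : ℕ} (a : (Fin n → ℕ) → K) : Prop :=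
  Tendsto (fun i => ‖a i‖) cofinite (nhds 0)

/-- Gauss norm of a multivariate power series. -/
noncomputable def mgauss {n : ℕ} (a : (Fin n → ℕ) → K) : ℝ := ⨆ i, ‖a i‖

/-- Coefficients of `f - f(0)`. -/
def mtail {n : ℕ} (a : (Fin n → ℕ) → K) : (Fin n → ℕ) → K :=
  fun i => if i = 0 then 0 else a i

/-- Coefficients of the partial derivative `∂^α f` of a multivariate power series `f`. -/
noncomputable def mpderiv {n : ℕ} (a : (Fin n → ℕ) → K) (α : Fin n → ℕ) :
    (Fin n → ℕ) → K :=
  fun i => ((∏ j, (i j + α j).descFactorial (α j) : ℕ) : K) * a (fun j => i j + α j)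

/-- The unit polydisc `O_K ^ n`. -/
def polydisc (K : Type*) [NontriviallyNormedField K] (n : ℕ) : Set (Fin n → K) :=
  {x | ∀ i, ‖x i‖ ≤ 1}

/-! ### `K`-analytic manifolds with isometric charts, type conditions, induced measures -/

/-- An isometric analytic chart of the `d`-dimensional manifold `M ⊆ K^n` centered at
`x0 ∈ M`: `ι` selects the `d` coordinates of the coordinate projection `p : x ↦ x ∘ ι`,
and the inverse of `p` is given by the `n` convergent power series `F i`, parametrizing
`M ∩ {x : ‖x - x0‖ ≤ ‖c‖}` isometrically by the polydisc `x0 + (c O_K)^d`. -/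
def IsChartAt {n : ℕ} (d : ℕ) (M : Set (Fin n → K)) (x0 : Fin n → K)
    (ι : Fin d → Fin n) (c : K) (F : Fin n → (Fin d → ℕ) → K) : Prop :=
  Function.Injective ι ∧ c ≠ 0 ∧ (∀ i, MIsConvergent (F i)) ∧
  (∀ i, mpseval (F i) 0 = x0 i) ∧
  (∀ z : Fin d → K, z ∈ polydisc K d → ∀ j, mpseval (F (ι j)) z = x0 (ι j) + c * z j) ∧
  (∀ z z' : Fin d → K, z ∈ polydisc K d → z' ∈ polydisc K d →
      ∀ i, ‖mpseval (F i) z - mpseval (F i) z'‖ ≤ ‖c‖ * (⨆ j, ‖z j - z' j‖)) ∧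
  ((fun z : Fin d → K => fun i => mpseval (F i) z) '' polydisc K d
      = M ∩ {x | ∀ i, ‖x i - x0 i‖ ≤ ‖c‖})

/-- `M ⊆ K^n` is a `d`-dimensional `K`-analytic manifold (with isometric charts). -/
def IsManifold {n : ℕ} (d : ℕ) (M : Set (Fin n → K)) : Prop :=
  ∀ x0 ∈ M, ∃ ι c F, IsChartAt d M x0 ι c F

/-- `M` is of type at most `k` at the point `x0`: for some analytic chart `f = (F i)_i`
centered at `x0` and each nonzero `v ∈ K^n` there is a multi-index `α` with
`0 < |α| ≤ k` and `v ⬝ (∂^α f)(x0) ≠ 0`. -/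
def TypeAtMost {n : ℕ} (d : ℕ) (M : Set (Fin n → K)) (x0 : Fin n → K) (k : ℕ) : Prop :=
  ∃ ι c F, IsChartAt d M x0 ι c F ∧
    ∀ v : Fin n → K, v ≠ 0 → ∃ α : Fin d → ℕ, 0 < (∑ j, α j) ∧ (∑ j, α j) ≤ k ∧
      (∑ i, v i * mpseval (mpderiv (F i) α) 0) ≠ 0

/-- `M` is of type `k`: of type at most `k` at each of its points, `k` least such. -/
def IsOfType {n : ℕ} (d : ℕ) (M : Set (Fin n → K)) (k : ℕ) : Prop :=
  0 < k ∧ (∀ x ∈ M, TypeAtMost d M x k) ∧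
    ∀ k', (∀ x ∈ M, TypeAtMost d M x k') → k ≤ k'

/-- `μS` is the measure on the manifold `S ⊆ K^n` induced, via the isometric charts
of `S` (namely the coordinate projections `x ↦ x ∘ ι`), from the Haar measure `lamd` on
`K^d` normalized so that `O_K^d` has measure `1`. -/
def IsInducedMeasure [MeasurableSpace K] {n : ℕ} (d : ℕ) (S : Set (Fin n → K))
    (μS : Measure (Fin n → K)) (lamd : Measure (Fin d → K)) : Prop :=
  μS {x | x ∉ S} = 0 ∧
  ∀ x0 ∈ S, ∀ ι c F, IsChartAt d S x0 ι c F →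
    ∀ A : Set (Fin n → K), MeasurableSet A → A ⊆ S ∩ {x | ∀ i, ‖x i - x0 i‖ ≤ ‖c‖} →
      μS A = lamd ((fun x : Fin n → K => x ∘ ι) '' A)

/-! ### Maximal function and Riesz kernel on `K^n` -/

/-- The Hardy–Littlewood maximal function on `K^n`, where the balls are the sets
`a + b ⬝ O_K^n` with `b ≠ 0`. -/
noncomputable def maximalFn [MeasurableSpace K] {n : ℕ} (μ : Measure (Fin n → K))
    (f : (Fin n → K) → ℂ) (x : Fin n → K) : ℝ :=
  sSup {r : ℝ | ∃ (a : Fin n → K) (b : K), b ≠ 0 ∧ (∀ i, ‖x i - a i‖ ≤ ‖b‖) ∧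
    r = (μ {y | ∀ i, ‖y i - a i‖ ≤ ‖b‖}).toReal⁻¹ *
      ∫ y in {y : Fin n → K | ∀ i, ‖y i - a i‖ ≤ ‖b‖}, ‖f y‖ ∂μ}

/-- The kernel `y ↦ |y|^{-γ}` on `K^n`, extended by `0` at `0`. -/
noncomputable def rieszKernel {n : ℕ} (γ : ℝ) (y : Fin n → K) : ℂ :=
  if y = 0 then 0 else ((‖y‖ ^ (-γ) : ℝ) : ℂ)

end VdC

section
open MeasureTheory Filter VdC
open scoped NNReal ENNReal Classical
namespace VdC9
variable {K : Type} [NontriviallyNormedField K] {q : ℕ}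

theorem lf_ultra (hK : IsLocalField K q) : IsUltrametricDist K :=
  IsUltrametricDist.isUltrametricDist_of_isNonarchimedean_norm hK.nonarch

theorem lf_q1 (hK : IsLocalField K q) : (1 : ℝ) < q := by exact_mod_cast hK.one_lt

/-- strict inequality of norms improves by a factor `q` -/
theorem lf_step (hK : IsLocalField K q) {x y : K} (h : ‖x‖ < ‖y‖) : q * ‖x‖ ≤ ‖y‖ := by
  have hq := lf_q1 hK
  by_cases hx : x = 0
  · simp [hx]
  have hy : y ≠ 0 := by
    rintro rfl
    simp at h
    exact absurd h (not_lt.2 (norm_nonneg _))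
  obtain ⟨a, ha⟩ := hK.discrete x hx
  obtain ⟨b, hb⟩ := hK.discrete y hy
  rw [ha, hb] at h ⊢
  have hab : a < b := (zpow_lt_zpow_iff_right₀ hq).1 h
  have : (q : ℝ) * q ^ a = q ^ (a + 1) := by
    rw [zpow_add₀ (by positivity), zpow_one, mul_comm]
  rw [this]
  exact zpow_le_zpow_right₀ hq.le (by omega)

theorem lf_lt_one (hK : IsLocalField K q) {x : K} (h : ‖x‖ < 1) : ‖x‖ ≤ (q : ℝ)⁻¹ := by
  have := lf_step hK (x := x) (y := 1) (by simpa using h)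
  have hq := lf_q1 hK
  rw [norm_one] at this
  rw [← one_div, le_div_iff₀ (by positivity)]
  linarith

theorem exists_reps (hK : IsLocalField K q) (N : ℕ) : ∃ S : Finset K, S.card = q ^ N ∧
    (∀ s ∈ S, ‖s‖ ≤ 1) ∧
    ∀ x : K, ‖x‖ ≤ 1 → ∃! s, s ∈ S ∧ ‖x - s‖ ≤ (q : ℝ)⁻¹ ^ N := by
  have := lf_ultra hK
  have hq := lf_q1 hK
  obtain ⟨π, hπ⟩ := hK.exists_unif
  obtain ⟨T, hTc, hT1, hT⟩ := hK.residue
  have hπ0 : π ≠ 0 := by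
    rintro rfl
    simp at hπ
    linarith
  induction N with
  | zero =>
    refine ⟨{0}, by simp, by simp, fun x hx => ⟨0, by simpa using hx, by simp⟩⟩
  | succ N ih =>
    obtain ⟨S, hSc, hS1, hS⟩ := ih
    have key : ∀ x : K, ‖x‖ ≤ (q : ℝ)⁻¹ ^ N → ∃! t, t ∈ T ∧ ‖x - π ^ N * t‖ ≤ (q : ℝ)⁻¹ ^ (N + 1) := by
      intro x hx
      have h1 : ‖x / π ^ N‖ ≤ 1 := by
        rw [norm_div, norm_pow, hπ]
        exact div_le_one_of_le₀ hx (by positivity)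
      obtain ⟨t, ⟨ht, ht2⟩, htu⟩ := hT _ h1
      have e : ∀ t, ‖x - π ^ N * t‖ = (q : ℝ)⁻¹ ^ N * ‖x / π ^ N - t‖ := by
        intro t
        rw [← hπ, ← norm_pow, ← norm_mul]
        congr 1
        field_simp
      refine ⟨t, ⟨ht, ?_⟩, ?_⟩
      · rw [e, pow_succ]
        exact mul_le_mul_of_nonneg_left (lf_lt_one hK ht2) (by positivity)
      · rintro t' ⟨h2, h3⟩
        refine htu t' ⟨h2, ?_⟩
        rw [e, pow_succ] at h3
        have := le_of_mul_le_mul_left h3 (by positivity)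
        exact this.trans_lt (inv_lt_one_of_one_lt₀ hq)
    have hpN : ∀ t : K, ‖t‖ ≤ 1 → ‖π ^ N * t‖ ≤ (q : ℝ)⁻¹ ^ N := by
      intro t ht
      rw [norm_mul, norm_pow, hπ]
      exact mul_le_of_le_one_right (by positivity) ht
    have hmono : (q : ℝ)⁻¹ ^ (N + 1) ≤ (q : ℝ)⁻¹ ^ N :=
      pow_le_pow_of_le_one (by positivity) (inv_le_one_of_one_le₀ hq.le) (by omega)
    have hle1 : (q : ℝ)⁻¹ ^ N ≤ 1 := pow_le_one₀ (by positivity) (inv_le_one_of_one_le₀ hq.le)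
    have uniq : ∀ s ∈ S, ∀ t ∈ T, ∀ s' ∈ S, ∀ t' ∈ T, ∀ x : K, ‖x‖ ≤ 1 →
        ‖x - (s + π ^ N * t)‖ ≤ (q : ℝ)⁻¹ ^ (N + 1) → ‖x - (s' + π ^ N * t')‖ ≤ (q : ℝ)⁻¹ ^ (N + 1) →
        s = s' ∧ t = t' := by
      intro s hs t ht s' hs' t' ht' x hx h1 h2
      have g : ∀ s t, ‖t‖ ≤ 1 → ‖x - (s + π ^ N * t)‖ ≤ (q : ℝ)⁻¹ ^ (N + 1) → ‖x - s‖ ≤ (q : ℝ)⁻¹ ^ N := by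
        intro s t ht h
        have : x - s = (x - (s + π ^ N * t)) + π ^ N * t := by ring
        rw [this]
        exact (IsUltrametricDist.norm_add_le_max _ _).trans (max_le (h.trans hmono) (hpN t ht))
      have hss : s = s' := (hS x hx).unique ⟨hs, g s t (hT1 t ht) h1⟩ ⟨hs', g s' t' (hT1 t' ht') h2⟩
      subst hss
      refine ⟨rfl, ?_⟩
      refine (key (x - s) (g s t (hT1 t ht) h1)).unique ⟨ht, ?_⟩ ⟨ht', ?_⟩
      · rwa [sub_sub]
      · rwa [sub_sub]
    have norm1 : ∀ s ∈ S, ∀ t ∈ T, ‖s + π ^ N * t‖ ≤ 1 := fun s hs t ht =>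
      (IsUltrametricDist.norm_add_le_max _ _).trans (max_le (hS1 s hs) ((hpN t (hT1 t ht)).trans hle1))
    refine ⟨(S ×ˢ T).image (fun p => p.1 + π ^ N * p.2), ?_, ?_, ?_⟩
    · rw [Finset.card_image_of_injOn, Finset.card_product, hSc, hTc, pow_succ]
      rintro ⟨s, t⟩ h1 ⟨s', t'⟩ h2 h
      simp only [Finset.coe_product, Set.mem_prod, Finset.mem_coe] at h1 h2
      have h : s + π ^ N * t = s' + π ^ N * t' := h
      obtain ⟨a, b⟩ := uniq s h1.1 t h1.2 s' h2.1 t' h2.2 _ (norm1 s h1.1 t h1.2)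
        (by simp) (by rw [h]; simp)
      simp [a, b]
    · intro s hs
      simp only [Finset.mem_image, Finset.mem_product, Prod.exists] at hs
      obtain ⟨s, t, ⟨h1, h2⟩, rfl⟩ := hs
      exact norm1 s h1 t h2
    · intro x hx
      obtain ⟨s, ⟨hs, hs2⟩, -⟩ := hS x hx
      obtain ⟨t, ⟨ht, ht2⟩, -⟩ := key _ hs2
      refine ⟨s + π ^ N * t, ⟨?_, by rwa [sub_sub] at ht2⟩, ?_⟩
      · simp only [Finset.mem_image, Finset.mem_product, Prod.exists]
        exact ⟨s, t, ⟨hs, ht⟩, rfl⟩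
      · rintro z ⟨hz, hz2⟩
        simp only [Finset.mem_image, Finset.mem_product, Prod.exists] at hz
        obtain ⟨s', t', ⟨h1, h2⟩, rfl⟩ := hz
        rw [sub_sub] at ht2
        obtain ⟨a, b⟩ := uniq s hs t ht s' h1 t' h2 x hx ht2 hz2
        simp [a, b]

theorem lf_compact (hK : IsLocalField K q) : IsCompact (Metric.closedBall (0 : K) 1) := by
  have := hK.complete
  have hq := lf_q1 hK
  rw [isCompact_iff_totallyBounded_isComplete]
  refine ⟨?_, Metric.isClosed_closedBall.isComplete⟩
  rw [Metric.totallyBounded_iff]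
  intro ε hε
  obtain ⟨N, hN⟩ := exists_pow_lt_of_lt_one hε (inv_lt_one_of_one_lt₀ hq)
  obtain ⟨S, -, -, hS⟩ := exists_reps hK N
  refine ⟨S, S.finite_toSet, fun x hx => ?_⟩
  obtain ⟨s, ⟨hs, hs2⟩, -⟩ := hS x (by simpa using hx)
  simp only [Set.mem_iUnion, Metric.mem_ball, dist_eq_norm]
  exact ⟨s, hs, hs2.trans_lt hN⟩

theorem lf_proper (hK : IsLocalField K q) : ProperSpace K := by
  have : LocallyCompactSpace K :=
    (lf_compact hK).locallyCompactSpace_of_mem_nhds_of_addGroup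
      (Metric.closedBall_mem_nhds (0 : K) one_pos)
  exact ProperSpace.of_locallyCompactSpace K

/-- the uniform probability measure on the unit ball -/
structure IsUnif [MeasurableSpace K] (q : ℕ) (P : Measure K) : Prop where
  prob : IsProbabilityMeasure P
  supp : ∀ᵐ x ∂P, ‖x‖ ≤ 1
  inv : ∀ u : K, ‖u‖ ≤ 1 → MeasurePreserving (fun x => u + x) P P

theorem exists_unifP (hK : IsLocalField K q) [MeasurableSpace K] [BorelSpace K] :
    ∃ P : Measure K, IsUnif q P := by
  have := lf_proper hK
  have := lf_ultra hK
  let O : TopologicalSpace.PositiveCompacts K :=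
    ⟨⟨Metric.closedBall 0 1, lf_compact hK⟩, by
      refine ⟨0, ?_⟩
      exact mem_interior_iff_mem_nhds.2 (Metric.closedBall_mem_nhds (0 : K) one_pos)⟩
  let ν := Measure.addHaarMeasure O
  have hm : MeasurableSet (Metric.closedBall (0 : K) 1) := measurableSet_closedBall
  refine ⟨ν.restrict (Metric.closedBall 0 1), ⟨?_⟩, ?_, ?_⟩
  · rw [Measure.restrict_apply_univ]
    exact Measure.addHaarMeasure_self
  · rw [ae_restrict_iff' hm]
    exact Eventually.of_forall fun x hx => by simpa using hx
  · intro u hu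
    have h := (measurePreserving_add_left ν u).restrict_preimage hm
    have e : (fun x => u + x) ⁻¹' (Metric.closedBall (0 : K) 1) = Metric.closedBall 0 1 := by
      ext x
      simp only [Set.mem_preimage, Metric.mem_closedBall, dist_zero_right]
      constructor
      · intro h
        have : x = (u + x) - u := by ring
        rw [this, sub_eq_add_neg]
        exact (IsUltrametricDist.norm_add_le_max _ _).trans (max_le h (by rwa [norm_neg]))
      · intro h
        exact (IsUltrametricDist.norm_add_le_max _ _).trans (max_le hu h)
    rwa [e] at h

theorem unif_ball (hK : IsLocalField K q) [MeasurableSpace K] [BorelSpace K] {P : Measure K}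
    (hP : IsUnif q P) (N : ℕ) (x : K) (hx : ‖x‖ ≤ 1) :
    P (Metric.closedBall x ((q : ℝ)⁻¹ ^ N)) = (q : ℝ≥0∞)⁻¹ ^ N := by
  have := lf_ultra hK
  have hq := lf_q1 hK
  have := hP.prob
  obtain ⟨S, hSc, hS1, hS⟩ := exists_reps hK N
  have tr : ∀ x : K, ‖x‖ ≤ 1 → P (Metric.closedBall x ((q : ℝ)⁻¹ ^ N)) =
      P (Metric.closedBall 0 ((q : ℝ)⁻¹ ^ N)) := by
    intro x hx
    rw [← (hP.inv x hx).measure_preimage measurableSet_closedBall.nullMeasurableSet]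
    congr 1
    ext z
    simp [dist_eq_norm]
  have hone : P (Metric.closedBall 0 1) = 1 := by
    rw [prob_compl_eq_zero_iff measurableSet_closedBall |>.symm]
    have := hP.supp
    rw [ae_iff] at this
    convert this using 2
    ext x; simp
  have hU : P (⋃ s ∈ S, Metric.closedBall s ((q : ℝ)⁻¹ ^ N)) = 1 := by
    refine le_antisymm prob_le_one ?_
    rw [← hone]
    refine measure_mono fun x hx => ?_
    obtain ⟨s, ⟨hs, hs2⟩, -⟩ := hS x (by simpa using hx)
    simp only [Set.mem_iUnion, Metric.mem_closedBall, dist_eq_norm]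
    exact ⟨s, hs, hs2⟩
  rw [measure_biUnion_finset _ (fun s _ => measurableSet_closedBall)] at hU
  · rw [tr x hx]
    rw [Finset.sum_congr rfl (fun s hs => tr s (hS1 s hs)), Finset.sum_const, hSc, nsmul_eq_mul] at hU
    rw [← ENNReal.inv_pow]
    refine ENNReal.eq_inv_of_mul_eq_one_left ?_
    rw [mul_comm, ← hU]
    push_cast
    rfl
  · intro s hs s' hs' hne
    rw [Function.onFun, Set.disjoint_left]
    intro z hz hz'
    rw [Metric.mem_closedBall, dist_eq_norm] at hz hz'
    have hz1 : ‖z‖ ≤ 1 := by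
      have : z = (z - s) + s := by ring
      rw [this]
      exact (IsUltrametricDist.norm_add_le_max _ _).trans (max_le (hz.trans
        (pow_le_one₀ (by positivity) (inv_le_one_of_one_le₀ hq.le))) (hS1 s hs))
    exact hne ((hS z hz1).unique ⟨hs, hz⟩ ⟨hs', hz'⟩)

end VdC9
end

section
open MeasureTheory Filter VdC
open scoped NNReal ENNReal Classical
namespace VdC9
variable {K : Type} [NontriviallyNormedField K] {q : ℕ}

/-- product measure -/
noncomputable def PP [MeasurableSpace K] (P : Measure K) (n : ℕ) : Measure (Fin n → K) :=
  Measure.pi (fun _ : Fin n => P)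

section
variable [MeasurableSpace K] {P : Measure K}

theorem PP_prob (hP : IsUnif q P) (n : ℕ) : IsProbabilityMeasure (PP P n) := by
  have := hP.prob
  unfold PP
  infer_instance

theorem PP_supp (hP : IsUnif q P) (n : ℕ) : ∀ᵐ x ∂(PP P n), ‖x‖ ≤ 1 := by
  have := hP.prob
  have h : ∀ i : Fin n, ∀ᵐ x ∂(PP P n), ‖x i‖ ≤ 1 := fun i =>
    (Measure.tendsto_eval_ae_ae (μ := fun _ : Fin n => P) (i := i)).eventually hP.supp
  filter_upwards [ae_all_iff.2 h] with x hx
  exact (pi_norm_le_iff_of_nonneg zero_le_one).2 hx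

theorem PP_inv (hP : IsUnif q P) (n : ℕ) (u : Fin n → K) (hu : ‖u‖ ≤ 1) :
    MeasurePreserving (fun x => u + x) (PP P n) (PP P n) := by
  have := hP.prob
  exact measurePreserving_pi (fun _ : Fin n => P) (fun _ : Fin n => P)
    (f := fun i x => u i + x) (fun i => hP.inv (u i) ((norm_le_pi_norm u i).trans hu))

theorem PP_ball (hP : IsUnif q P) (hK : IsLocalField K q) [BorelSpace K] (n N : ℕ) (x : Fin n → K) (hx : ‖x‖ ≤ 1) :
    PP P n (Metric.closedBall x ((q : ℝ)⁻¹ ^ N)) = ((q : ℝ≥0∞)⁻¹ ^ N) ^ n := by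
  have := hP.prob
  rw [closedBall_pi _ (by positivity), PP, Measure.pi_pi]
  rw [Finset.prod_congr rfl (fun i _ => unif_ball hK hP N (x i) ((norm_le_pi_norm x i).trans hx))]
  simp

variable [BorelSpace K] [SecondCountableTopology K]

theorem PP_slice (hP : IsUnif q P) {n m : ℕ} (φ : (Fin m → K) → (Fin n → K)) (hφ : Measurable φ)
    (hφ1 : ∀ u, ‖u‖ ≤ 1 → ‖φ u‖ ≤ 1) {A : Set (Fin n → K)} (hA : MeasurableSet A) :
    PP P n A = ∫⁻ x, PP P m {u | x + φ u ∈ A} ∂(PP P n) := by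
  have := PP_prob hP n
  have := PP_prob hP m
  have hmeas : Measurable (fun p : (Fin n → K) × (Fin m → K) => p.1 + φ p.2) :=
    measurable_fst.add (hφ.comp measurable_snd)
  have h1 : ∀ x, PP P m {u | x + φ u ∈ A} =
      ∫⁻ u, A.indicator 1 (x + φ u) ∂(PP P m) := by
    intro x
    have hm : MeasurableSet {u | x + φ u ∈ A} := hmeas.comp measurable_prodMk_left hA
    rw [← lintegral_indicator_one hm]
    rfl
  simp_rw [h1]
  rw [lintegral_lintegral_swap]
  · have h2 : ∀ᵐ u ∂(PP P m), ∫⁻ x, A.indicator 1 (x + φ u) ∂(PP P n) = PP P n A := by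
      filter_upwards [PP_supp hP m] with u hu
      have := (PP_inv hP n (φ u) (hφ1 u hu)).lintegral_comp
        (f := A.indicator (1 : (Fin n → K) → ℝ≥0∞)) (measurable_one.indicator hA)
      rw [lintegral_indicator_one hA] at this
      rw [← this]
      simp_rw [add_comm]
    rw [lintegral_congr_ae h2]
    simp
  · exact ((measurable_one.indicator hA).comp hmeas).aemeasurable

theorem PP_slice_le (hP : IsUnif q P) {n m : ℕ} (φ : (Fin m → K) → (Fin n → K)) (hφ : Measurable φ)
    (hφ1 : ∀ u, ‖u‖ ≤ 1 → ‖φ u‖ ≤ 1) {A E : Set (Fin n → K)} (hA : MeasurableSet A)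
    (hE : MeasurableSet E)
    (hAE : ∀ x u, ‖x‖ ≤ 1 → ‖u‖ ≤ 1 → x + φ u ∈ A → x ∈ E) (B : ℝ≥0∞)
    (hB : ∀ x ∈ E, ‖x‖ ≤ 1 → PP P m {u | ‖u‖ ≤ 1 ∧ x + φ u ∈ A} ≤ B) :
    PP P n A ≤ B * PP P n E := by
  have := PP_prob hP n
  rw [PP_slice hP φ hφ hφ1 hA]
  have h0 : ∀ x, PP P m {u | x + φ u ∈ A} = PP P m {u | ‖u‖ ≤ 1 ∧ x + φ u ∈ A} := by
    intro x
    apply measure_congr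
    rw [Filter.eventuallyEq_set]
    filter_upwards [PP_supp hP m] with u hu
    simp [hu]
  calc ∫⁻ x, PP P m {u | x + φ u ∈ A} ∂(PP P n)
      ≤ ∫⁻ x, E.indicator (fun _ => B) x ∂(PP P n) := by
        apply lintegral_mono_ae
        filter_upwards [PP_supp hP n] with x hx
        rw [h0]
        by_cases hxE : x ∈ E
        · rw [Set.indicator_of_mem hxE]
          exact hB x hxE hx
        · have : {u | ‖u‖ ≤ 1 ∧ x + φ u ∈ A} = ∅ := by
            ext u
            simp only [Set.mem_ofPred_eq, Set.mem_empty_iff_false, iff_false]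
            exact fun h => hxE (hAE x u hx h.1 h.2)
          simp [this]
    _ = B * PP P n E := by
        rw [lintegral_indicator_const hE]

/-- real version -/
theorem PP_slice_le' (hP : IsUnif q P) {n m : ℕ} (φ : (Fin m → K) → (Fin n → K)) (hφ : Measurable φ)
    (hφ1 : ∀ u, ‖u‖ ≤ 1 → ‖φ u‖ ≤ 1) {A E : Set (Fin n → K)} (hA : MeasurableSet A)
    (hE : MeasurableSet E)
    (hAE : ∀ x u, ‖x‖ ≤ 1 → ‖u‖ ≤ 1 → x + φ u ∈ A → x ∈ E) (B : ℝ) (hB0 : 0 ≤ B)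
    (hB : ∀ x ∈ E, ‖x‖ ≤ 1 → (PP P m).real {u | ‖u‖ ≤ 1 ∧ x + φ u ∈ A} ≤ B) :
    (PP P n).real A ≤ B * (PP P n).real E := by
  have := PP_prob hP n
  have := PP_prob hP m
  have h := PP_slice_le hP φ hφ hφ1 hA hE hAE (ENNReal.ofReal B) (by
    intro x hx hx1
    rw [ENNReal.le_ofReal_iff_toReal_le (measure_ne_top _ _) hB0]
    exact hB x hx hx1)
  have h2 := ENNReal.toReal_mono (ENNReal.mul_ne_top ENNReal.ofReal_ne_top (measure_ne_top _ _)) h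
  rwa [ENNReal.toReal_mul, ENNReal.toReal_ofReal hB0] at h2

theorem PP_ball_real (hP : IsUnif q P) (hK : IsLocalField K q) (n N : ℕ) (x : Fin n → K) (hx : ‖x‖ ≤ 1) :
    (PP P n).real (Metric.closedBall x ((q : ℝ)⁻¹ ^ N)) = ((q : ℝ)⁻¹ ^ N) ^ n := by
  rw [Measure.real, PP_ball hP hK n N x hx]
  simp

/-- a set of diameter at most `r ≤ 1`, where `r` is a value of the norm, has measure at most `r^n` -/
theorem PP_diam (hP : IsUnif q P) (hK : IsLocalField K q) (n : ℕ) (A : Set (Fin n → K)) (c : K) (hc : ‖c‖ ≤ 1)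
    (hc0 : c ≠ 0) (hA1 : ∀ x ∈ A, ‖x‖ ≤ 1) (hA : ∀ x ∈ A, ∀ z ∈ A, ‖x - z‖ ≤ ‖c‖) :
    (PP P n).real A ≤ ‖c‖ ^ n := by
  have := PP_prob hP n
  have hq := lf_q1 hK
  rcases A.eq_empty_or_nonempty with rfl | ⟨z, hz⟩
  · simp
  obtain ⟨m, hm⟩ := hK.discrete c hc0
  have hm0 : m ≤ 0 := by
    by_contra h
    push Not at h
    rw [hm] at hc
    exact absurd hc (not_le.2 (one_lt_zpow₀ hq h))
  obtain ⟨N, rfl⟩ : ∃ N : ℕ, m = -(N : ℤ) := ⟨m.natAbs, by omega⟩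
  have hcN : ‖c‖ = (q : ℝ)⁻¹ ^ N := by rw [hm]; simp
  rw [hcN, ← PP_ball_real hP hK n N z (hA1 z hz)]
  refine measureReal_mono (fun x hx => ?_) (measure_ne_top _ _)
  rw [Metric.mem_closedBall, dist_eq_norm, ← hcN]
  exact hA x hx z hz

end
end VdC9
end

section
open MeasureTheory Filter VdC
open scoped NNReal ENNReal Classical
namespace VdC9
variable {K : Type} [NontriviallyNormedField K] {q n : ℕ}

def Box (n D : ℕ) : Finset (Fin n → ℕ) := Fintype.piFinset (fun _ => Finset.range (D + 1))
def chs (δ γ : Fin n → ℕ) : ℕ := ∏ i, (δ i + γ i).choose (γ i)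
def fac (γ : Fin n → ℕ) : ℕ := ∏ i, (γ i).factorial
def deg (γ : Fin n → ℕ) : ℕ := ∑ i, γ i
def mon (x : Fin n → K) (δ : Fin n → ℕ) : K := ∏ i, x i ^ δ i
def ee (i : Fin n) : Fin n → ℕ := Pi.single i 1

theorem mem_Box {D : ℕ} {γ : Fin n → ℕ} : γ ∈ Box n D ↔ ∀ i, γ i ≤ D := by
  simp [Box]

theorem deg_add (δ γ : Fin n → ℕ) : deg (δ + γ) = deg δ + deg γ := by
  simp [deg, Finset.sum_add_distrib]

theorem deg_ee (i : Fin n) : deg (ee i) = 1 := by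
  simp [deg, ee]

theorem deg_zero : deg (0 : Fin n → ℕ) = 0 := by simp [deg]

theorem deg_eq_zero {γ : Fin n → ℕ} (h : deg γ = 0) : γ = 0 := by
  ext i
  exact (Finset.sum_eq_zero_iff.1 h) i (Finset.mem_univ i)

theorem deg_eq_one {γ : Fin n → ℕ} (h : deg γ = 1) : ∃ i, γ = ee i := by
  have : ∃ i, γ i ≠ 0 := by
    by_contra hh
    push Not at hh
    simp [deg, hh] at h
  obtain ⟨i, hi⟩ := this
  refine ⟨i, ?_⟩
  have hs : γ i + ∑ j ∈ Finset.univ.erase i, γ j = 1 := by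
    rw [Finset.add_sum_erase _ _ (Finset.mem_univ i)]; exact h
  have h0 : ∑ j ∈ Finset.univ.erase i, γ j = 0 := by omega
  ext j
  by_cases hj : j = i
  · subst hj
    simp [ee]; omega
  · simp [ee, hj]
    exact (Finset.sum_eq_zero_iff.1 h0) j (by simp [hj])

theorem mon_zero (x : Fin n → K) : mon x 0 = 1 := by simp [mon]

theorem mon_ee (x : Fin n → K) (i : Fin n) : mon x (ee i) = x i := by
  rw [mon, Finset.prod_eq_single i]
  · simp [ee]
  · intro j _ hj
    simp [ee, hj]
  · simp

theorem mon_smul (c : K) (x : Fin n → K) (δ : Fin n → ℕ) : mon (c • x) δ = c ^ deg δ * mon x δ := by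
  simp [mon, mul_pow, Finset.prod_mul_distrib, Finset.prod_pow_eq_pow_sum, deg]

theorem mon_norm_le (x : Fin n → K) (δ : Fin n → ℕ) : ‖mon x δ‖ ≤ ‖x‖ ^ deg δ := by
  rw [mon, norm_prod, deg, ← Finset.prod_pow_eq_pow_sum]
  refine Finset.prod_le_prod (fun i _ => norm_nonneg _) fun i _ => ?_
  rw [norm_pow]
  exact pow_le_pow_left₀ (norm_nonneg _) (norm_le_pi_norm x i) _

theorem chs_zero_left (γ : Fin n → ℕ) : chs 0 γ = 1 := by simp [chs]

theorem fac_chs (δ γ : Fin n → ℕ) : chs δ γ * fac γ * fac δ = fac (δ + γ) := by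
  simp only [chs, fac, ← Finset.prod_mul_distrib]
  refine Finset.prod_congr rfl fun i _ => ?_
  have := Nat.add_choose_mul_factorial_mul_factorial (δ i) (γ i)
  rw [Pi.add_apply, ← this]
  ring

theorem fac_ee (i : Fin n) : fac (ee i) = 1 := by
  rw [fac]
  refine Finset.prod_eq_one fun j _ => ?_
  by_cases hj : j = i
  · subst hj; simp [ee]
  · simp [ee, hj]

/-- A Taylor system: `h γ` is the divided partial derivative of order `γ` of the polynomial `h 0`. -/
structure TS (D : ℕ) (h : (Fin n → ℕ) → (Fin n → K) → K) : Prop where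
  one_le : 1 ≤ D
  vanish : ∀ γ, γ ∉ Box n D → ∀ x, h γ x = 0
  taylor : ∀ γ x t, h γ (x + t) = ∑ δ ∈ Box n D, (chs δ γ : K) * h (δ + γ) x * mon t δ

theorem mon_add (D : ℕ) (x t : Fin n → K) (δ : Fin n → ℕ) (hδ : δ ∈ Box n D) :
    mon (x + t) δ = ∑ e ∈ Box n D, ((∏ i, (δ i).choose (e i) : ℕ) : K) * mon t e * mon x (δ - e) := by
  have h1 : ∀ i, (x i + t i) ^ δ i = ∑ e ∈ Finset.range (D + 1),
      ((δ i).choose e : K) * t i ^ e * x i ^ (δ i - e) := by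
    intro i
    rw [add_comm, add_pow]
    have hsub : Finset.range (δ i + 1) ⊆ Finset.range (D + 1) := by
      intro a; simp; have := mem_Box.1 hδ i; omega
    rw [Finset.sum_subset hsub]
    · refine Finset.sum_congr rfl fun e _ => by ring
    · intro e _ he
      simp at he
      rw [Nat.choose_eq_zero_of_lt (by omega)]
      simp
  simp only [mon, Pi.add_apply]
  rw [Finset.prod_congr rfl (fun i _ => h1 i), Finset.prod_univ_sum]
  refine Finset.sum_congr rfl fun e _ => ?_
  simp [Finset.prod_mul_distrib]

/-- the Taylor system of a polynomial -/
noncomputable def hsys (D : ℕ) (a : (Fin n → ℕ) → K) (γ : Fin n → ℕ) (x : Fin n → K) : K :=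
  ∑ δ ∈ Box n D, (chs δ γ : K) * a (δ + γ) * mon x δ

theorem chs_assoc (μ e γ : Fin n → ℕ) :
    chs (μ + e) γ * (∏ i, (μ i + e i).choose (e i)) = chs e γ * chs μ (e + γ) := by
  simp only [chs, ← Finset.prod_mul_distrib]
  refine Finset.prod_congr rfl fun i _ => ?_
  have := Nat.choose_mul (n := μ i + e i + γ i) (k := e i + γ i) (s := γ i) (by omega)
  simp only [Pi.add_apply]
  rw [show μ i + e i + γ i - γ i = μ i + e i by omega, show e i + γ i - γ i = e i by omega] at this
  rw [← this, mul_comm, add_assoc]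

theorem TS_hsys {D : ℕ} (hD : 1 ≤ D) (a : (Fin n → ℕ) → K) (ha : ∀ γ, γ ∉ Box n D → a γ = 0) :
    TS D (hsys D a) := by
  refine ⟨hD, ?_, ?_⟩
  · intro γ hγ x
    refine Finset.sum_eq_zero fun δ _ => ?_
    rw [ha, mul_zero, zero_mul]
    intro h
    refine hγ (mem_Box.2 fun i => ?_)
    have := mem_Box.1 h i
    simp at this
    omega
  · intro γ x t
    have h1 : hsys D a γ (x + t) = ∑ e ∈ Box n D, ∑ δ ∈ Box n D,
        (chs δ γ : K) * a (δ + γ) * (((∏ i, (δ i).choose (e i) : ℕ) : K) * mon t e * mon x (δ - e)) := by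
      rw [Finset.sum_comm]
      refine Finset.sum_congr rfl fun δ hδ => ?_
      rw [mon_add D x t δ hδ, Finset.mul_sum]
    rw [h1]
    refine Finset.sum_congr rfl fun e he => ?_
    rw [hsys, Finset.mul_sum, Finset.sum_mul]
    symm
    refine Finset.sum_bij_ne_zero (fun μ _ _ => μ + e) ?_ ?_ ?_ ?_
    · intro μ hμ h0
      by_contra hc
      apply h0
      rw [ha]
      · simp
      · intro h2
        refine hc (mem_Box.2 fun i => ?_)
        have := mem_Box.1 h2 i
        simp at this ⊢
        omega
    · intro μ _ _ μ' _ _ h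
      exact add_right_cancel h
    · intro δ hδ h0
      have hle : e ≤ δ := by
        intro i
        by_contra hc
        push Not at hc
        apply h0
        rw [Finset.prod_eq_zero (Finset.mem_univ i) (Nat.choose_eq_zero_of_lt hc)]
        simp
      have hde : δ - e + e = δ := tsub_add_cancel_of_le hle
      refine ⟨δ - e, mem_Box.2 fun i => ?_, ?_, hde⟩
      · have := mem_Box.1 hδ i
        simp
        omega
      · intro h2
        apply h0
        have h3 := chs_assoc (δ - e) e γ
        rw [hde] at h3
        have h4 : ∀ i, (δ - e) i + e i = δ i := fun i => congrFun hde i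
        simp only [h4] at h3
        have h5 : (chs δ γ : K) * ((∏ i, (δ i).choose (e i) : ℕ) : K) = chs e γ * chs (δ - e) (e + γ) := by
          exact_mod_cast congrArg (Nat.cast : ℕ → K) h3
        calc _ = ((chs δ γ : K) * ((∏ i, (δ i).choose (e i) : ℕ) : K)) * a (δ + γ) * mon t e * mon x (δ - e) := by
                ring
          _ = 0 := by
                rw [h5, ← h2, ← add_assoc, hde]; ring
    · intro μ _ _
      have h5 : (chs (μ + e) γ : K) * ((∏ i, (μ i + e i).choose (e i) : ℕ) : K) = chs e γ * chs μ (e + γ) := by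
        exact_mod_cast congrArg (Nat.cast : ℕ → K) (chs_assoc μ e γ)
      have h6 : μ + e - e = μ := by ext i; simp
      rw [h6]
      simp only [Pi.add_apply]
      calc _ = ((chs e γ : K) * chs μ (e + γ)) * a (μ + (e + γ)) * mon t e * mon x μ := by ring
        _ = _ := by rw [← h5, ← add_assoc]; ring

theorem TS_scale {D : ℕ} {h : (Fin n → ℕ) → (Fin n → K) → K} (H : TS D h) (b : Fin n → K) (ρ c : K) :
    TS D (fun γ t => c * ρ ^ deg γ * h γ (b + ρ • t)) := by
  refine ⟨H.one_le, fun γ hγ x => by rw [H.vanish γ hγ, mul_zero], fun γ x t => ?_⟩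
  rw [smul_add, ← add_assoc, H.taylor, Finset.mul_sum]
  refine Finset.sum_congr rfl fun δ _ => ?_
  rw [mon_smul, deg_add, pow_add]
  ring

theorem TS_cont {D : ℕ} {h : (Fin n → ℕ) → (Fin n → K) → K} (H : TS D h) (γ : Fin n → ℕ) :
    Continuous (h γ) := by
  have : h γ = fun t => ∑ δ ∈ Box n D, (chs δ γ : K) * h (δ + γ) 0 * mon t δ := by
    ext t
    rw [← H.taylor, zero_add]
  rw [this]
  unfold mon
  fun_prop

/-- the undivided derivatives -/
def Tf (h : (Fin n → ℕ) → (Fin n → K) → K) (γ : Fin n → ℕ) (x : Fin n → K) : K := (fac γ : K) * h γ x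

theorem Tf_taylor {D : ℕ} {h : (Fin n → ℕ) → (Fin n → K) → K} (H : TS D h) (γ : Fin n → ℕ) (x t : Fin n → K) :
    Tf h γ (x + t) = ∑ δ ∈ Box n D, (fac γ : K) * (chs δ γ : K) * h (δ + γ) x * mon t δ := by
  rw [Tf, H.taylor, Finset.mul_sum]
  exact Finset.sum_congr rfl fun δ _ => by ring

theorem Tf_cont {D : ℕ} {h : (Fin n → ℕ) → (Fin n → K) → K} (H : TS D h) (γ : Fin n → ℕ) :
    Continuous (Tf h γ) := continuous_const.mul (TS_cont H γ)

theorem Box_split {M : Type*} [AddCommMonoid M] {D : ℕ} (hD : 1 ≤ D) (F : (Fin n → ℕ) → M) :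
    ∑ δ ∈ Box n D, F δ = F 0 + ∑ i, F (ee i) + ∑ δ ∈ (Box n D).filter (fun δ => 2 ≤ deg δ), F δ := by
  have hinj : Function.Injective (fun i : Fin n => ee i) := by
    intro i j hij
    by_contra hne
    have := congrFun hij i
    simp [ee, hne] at this
  have e1 : ∑ i, F (ee i) = ∑ δ ∈ (Box n D).filter (fun δ => deg δ = 1), F δ := by
    rw [← Finset.sum_image (f := F) (s := Finset.univ) (g := ee) (fun i _ j _ h => hinj h)]
    refine Finset.sum_congr ?_ fun _ _ => rfl
    ext δ
    simp only [Finset.mem_image, Finset.mem_univ, true_and, Finset.mem_filter]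
    constructor
    · rintro ⟨i, rfl⟩
      refine ⟨mem_Box.2 fun j => ?_, deg_ee i⟩
      by_cases hj : j = i
      · subst hj; simpa [ee] using hD
      · simp [ee, hj]
    · rintro ⟨-, h⟩
      obtain ⟨i, rfl⟩ := deg_eq_one h
      exact ⟨i, rfl⟩
  have e0 : F 0 = ∑ δ ∈ (Box n D).filter (fun δ => deg δ = 0), F δ := by
    rw [Finset.sum_eq_single 0]
    · intro b hb hb0
      exact absurd (deg_eq_zero (Finset.mem_filter.1 hb).2) hb0
    · intro h
      exfalso
      apply h
      simp [mem_Box, deg]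
  rw [e1, e0, ← Finset.sum_filter_add_sum_filter_not (Box n D) (fun δ => 2 ≤ deg δ), add_comm]
  congr 1
  rw [← Finset.sum_filter_add_sum_filter_not ((Box n D).filter (fun δ => ¬ 2 ≤ deg δ)) (fun δ => deg δ = 0)]
  simp only [Finset.filter_filter]
  congr 1
  · refine Finset.sum_congr (Finset.filter_congr fun δ _ => ?_) fun _ _ => rfl
    omega
  · refine Finset.sum_congr (Finset.filter_congr fun δ _ => ?_) fun _ _ => rfl
    omega

section est
variable [IsUltrametricDist K]

theorem nat_norm_le (m : ℕ) : ‖(m : K)‖ ≤ 1 := IsUltrametricDist.norm_natCast_le_one K m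

theorem nat2_norm_le (m l : ℕ) (z : K) : ‖(m : K) * (l : K) * z‖ ≤ ‖z‖ := by
  rw [norm_mul, norm_mul]
  calc ‖(m : K)‖ * ‖(l : K)‖ * ‖z‖ ≤ 1 * 1 * ‖z‖ := by
        gcongr
        · exact nat_norm_le m
        · exact nat_norm_le l
    _ = ‖z‖ := by ring

theorem Tf_le (h : (Fin n → ℕ) → (Fin n → K) → K) (γ : Fin n → ℕ) (x : Fin n → K) : ‖Tf h γ x‖ ≤ ‖h γ x‖ := by
  rw [Tf, norm_mul]
  exact mul_le_of_le_one_left (norm_nonneg _) (nat_norm_le _)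

/-- zeroth order estimate -/
theorem Tf_lip {D : ℕ} {h : (Fin n → ℕ) → (Fin n → K) → K} (H : TS D h) (γ : Fin n → ℕ) (x t : Fin n → K)
    (G : ℝ) (hG0 : 0 ≤ G) (hG : ∀ γ', deg γ + 1 ≤ deg γ' → ‖h γ' x‖ ≤ G) (ht : ‖t‖ ≤ 1) :
    ‖Tf h γ (x + t) - Tf h γ x‖ ≤ G * ‖t‖ := by
  have h0 : (0 : Fin n → ℕ) ∈ Box n D := by simp [mem_Box]
  rw [Tf_taylor H, ← Finset.add_sum_erase _ _ h0]
  rw [chs_zero_left, mon_zero, zero_add, Nat.cast_one, mul_one, mul_one]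
  rw [Tf, add_sub_cancel_left]
  refine IsUltrametricDist.norm_sum_le_of_forall_le_of_nonneg (by positivity) fun δ hδ => ?_
  have hδ0 : 1 ≤ deg δ := by
    by_contra hc
    exact (Finset.mem_erase.1 hδ).1 (deg_eq_zero (by omega))
  rw [norm_mul]
  refine mul_le_mul ((nat2_norm_le _ _ _).trans (hG _ ?_)) ((mon_norm_le t δ).trans ?_) (norm_nonneg _) hG0
  · rw [deg_add]; omega
  · calc ‖t‖ ^ deg δ ≤ ‖t‖ ^ 1 := pow_le_pow_of_le_one (norm_nonneg _) ht hδ0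
      _ = ‖t‖ := pow_one _

/-- first order estimate -/
theorem Tf_lip2 {D : ℕ} {h : (Fin n → ℕ) → (Fin n → K) → K} (H : TS D h) (γ : Fin n → ℕ) (x t : Fin n → K)
    (G : ℝ) (hG0 : 0 ≤ G) (hG : ∀ γ', deg γ + 2 ≤ deg γ' → ‖h γ' x‖ ≤ G) (ht : ‖t‖ ≤ 1) :
    ‖Tf h γ (x + t) - Tf h γ x - ∑ i, Tf h (γ + ee i) x * t i‖ ≤ G * ‖t‖ ^ 2 := by
  rw [Tf_taylor H, Box_split H.one_le]
  rw [chs_zero_left, mon_zero, zero_add, Nat.cast_one, mul_one, mul_one]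
  have e1 : ∑ i, (fac γ : K) * (chs (ee i) γ : K) * h (ee i + γ) x * mon t (ee i) =
      ∑ i, Tf h (γ + ee i) x * t i := by
    refine Finset.sum_congr rfl fun i _ => ?_
    rw [mon_ee, Tf, add_comm γ, ← fac_chs, fac_ee]
    push_cast
    ring
  rw [e1, Tf, add_assoc, add_sub_cancel_left, add_sub_cancel_left]
  refine IsUltrametricDist.norm_sum_le_of_forall_le_of_nonneg (by positivity) fun δ hδ => ?_
  have hδ0 : 2 ≤ deg δ := (Finset.mem_filter.1 hδ).2
  rw [norm_mul]
  refine mul_le_mul ((nat2_norm_le _ _ _).trans (hG _ ?_)) ((mon_norm_le t δ).trans ?_) (norm_nonneg _) hG0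
  · rw [deg_add]; omega
  · exact pow_le_pow_of_le_one (norm_nonneg _) ht hδ0

end est

/-- maximum of the order-`M` undivided derivatives -/
noncomputable def TM (h : (Fin n → ℕ) → (Fin n → K) → K) (M : ℕ) (x : Fin n → K) : ℝ :=
  (((Finset.univ : Finset (Fin n)).piAntidiag M).sup (fun γ => ‖Tf h γ x‖₊) : ℝ≥0)

/-- maximum of the order-`M` divided derivatives -/
noncomputable def NM (h : (Fin n → ℕ) → (Fin n → K) → K) (M : ℕ) (x : Fin n → K) : ℝ :=
  (((Finset.univ : Finset (Fin n)).piAntidiag M).sup (fun γ => ‖h γ x‖₊) : ℝ≥0)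

theorem mem_anti {γ : Fin n → ℕ} {M : ℕ} : γ ∈ (Finset.univ : Finset (Fin n)).piAntidiag M ↔ deg γ = M := by
  simp [Finset.mem_piAntidiag, deg]

variable (h : (Fin n → ℕ) → (Fin n → K) → K)

theorem TM_nonneg (M : ℕ) (x : Fin n → K) : 0 ≤ TM h M x := NNReal.coe_nonneg _
theorem NM_nonneg (M : ℕ) (x : Fin n → K) : 0 ≤ NM h M x := NNReal.coe_nonneg _

theorem TM_le {M : ℕ} {x : Fin n → K} {B : ℝ} (hB : 0 ≤ B) :
    TM h M x ≤ B ↔ ∀ γ, deg γ = M → ‖Tf h γ x‖ ≤ B := by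
  lift B to ℝ≥0 using hB
  rw [TM, NNReal.coe_le_coe, Finset.sup_le_iff]
  simp only [mem_anti]
  rfl

theorem NM_le {M : ℕ} {x : Fin n → K} {B : ℝ} (hB : 0 ≤ B) :
    NM h M x ≤ B ↔ ∀ γ, deg γ = M → ‖h γ x‖ ≤ B := by
  lift B to ℝ≥0 using hB
  rw [NM, NNReal.coe_le_coe, Finset.sup_le_iff]
  simp only [mem_anti]
  rfl

theorem le_TM {γ : Fin n → ℕ} {M : ℕ} (hγ : deg γ = M) (x : Fin n → K) : ‖Tf h γ x‖ ≤ TM h M x :=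
  (TM_le h (TM_nonneg h M x)).1 le_rfl γ hγ

theorem le_NM {γ : Fin n → ℕ} {M : ℕ} (hγ : deg γ = M) (x : Fin n → K) : ‖h γ x‖ ≤ NM h M x :=
  (NM_le h (NM_nonneg h M x)).1 le_rfl γ hγ

theorem exists_TM {M : ℕ} {x : Fin n → K} (hpos : 0 < TM h M x) :
    ∃ γ, deg γ = M ∧ ‖Tf h γ x‖ = TM h M x := by
  have hne : ((Finset.univ : Finset (Fin n)).piAntidiag M).Nonempty := by
    by_contra hc
    rw [Finset.not_nonempty_iff_eq_empty] at hc
    simp [TM, hc] at hpos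
  obtain ⟨γ, hγ, e⟩ := Finset.exists_mem_eq_sup _ hne (fun γ => ‖Tf h γ x‖₊)
  refine ⟨γ, mem_anti.1 hγ, ?_⟩
  rw [TM, e]
  rfl

theorem exists_NM {M : ℕ} {x : Fin n → K} (hpos : 0 < NM h M x) :
    ∃ γ, deg γ = M ∧ ‖h γ x‖ = NM h M x := by
  have hne : ((Finset.univ : Finset (Fin n)).piAntidiag M).Nonempty := by
    by_contra hc
    rw [Finset.not_nonempty_iff_eq_empty] at hc
    simp [NM, hc] at hpos
  obtain ⟨γ, hγ, e⟩ := Finset.exists_mem_eq_sup _ hne (fun γ => ‖h γ x‖₊)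
  refine ⟨γ, mem_anti.1 hγ, ?_⟩
  rw [NM, e]
  rfl

theorem TM_le_NM [IsUltrametricDist K] (M : ℕ) (x : Fin n → K) : TM h M x ≤ NM h M x :=
  (TM_le h (NM_nonneg h M x)).2 fun γ hγ => (Tf_le h γ x).trans (le_NM h hγ x)

variable {h}

theorem TM_cont {D : ℕ} (H : TS D h) (M : ℕ) : Continuous (TM h M) := by
  unfold TM
  refine NNReal.continuous_coe.comp ?_
  exact Continuous.finset_sup_apply (fun γ _ => (Tf_cont H γ).nnnorm)

theorem NM_cont {D : ℕ} (H : TS D h) (M : ℕ) : Continuous (NM h M) := by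
  unfold NM
  refine NNReal.continuous_coe.comp ?_
  exact Continuous.finset_sup_apply (fun γ _ => (TS_cont H γ).nnnorm)

end VdC9
end

section
open MeasureTheory Filter VdC
open scoped NNReal ENNReal Classical
namespace VdC9
variable {K : Type} [NontriviallyNormedField K] {q n : ℕ}

theorem um_sum_lt [IsUltrametricDist K] {ι : Type*} (s : Finset ι) (f : ι → K) {B : ℝ} (hB : 0 < B)
    (h : ∀ i ∈ s, ‖f i‖ < B) : ‖∑ i ∈ s, f i‖ < B := by
  induction s using Finset.induction_on with
  | empty => simpa using hB
  | insert a s ha ih =>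
    rw [Finset.sum_insert ha]
    refine (IsUltrametricDist.norm_add_le_max _ _).trans_lt (max_lt (h a (by simp)) (ih fun i hi => h i (by simp [hi])))

/-- points where the phase is not locally linear at the natural scale -/
def Bad (h : (Fin n → ℕ) → (Fin n → K) → K) (y : K) : Set (Fin n → K) :=
  {x | ‖y‖ * TM h 1 x < 1 ∨ ∃ m, 2 ≤ m ∧ ‖y‖ ^ (m - 1) * TM h 1 x ^ m ≤ NM h m x}

theorem fac_deg_one {γ : Fin n → ℕ} (hγ : deg γ = 1) : fac γ = 1 := by
  obtain ⟨i, rfl⟩ := deg_eq_one hγ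
  exact fac_ee i

theorem Tf_deg_one (h : (Fin n → ℕ) → (Fin n → K) → K) {γ : Fin n → ℕ} (hγ : deg γ = 1) (x : Fin n → K) :
    Tf h γ x = h γ x := by
  rw [Tf, fac_deg_one hγ, Nat.cast_one, one_mul]

theorem good_shift [IsUltrametricDist K] {D : ℕ} {h : (Fin n → ℕ) → (Fin n → K) → K} (H : TS D h)
    (y ρ : K) (x : Fin n → K) (hx : x ∉ Bad h y) (hρ : ‖ρ‖ * (‖y‖ * TM h 1 x) = 1)
    (t : Fin n → K) (ht : ‖t‖ ≤ 1) :
    TM h 1 (x + ρ • t) = TM h 1 x ∧ x + ρ • t ∉ Bad h y ∧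
      ‖y * (h 0 (x + ρ • t) - h 0 x - ∑ i, h (ee i) x * (ρ * t i))‖ < 1 := by
  simp only [Bad, Set.mem_ofPred_eq, not_or, not_lt, not_exists, not_and, not_le] at hx
  obtain ⟨h1, h2⟩ := hx
  set L := TM h 1 x with hL
  have hL0 : 0 ≤ L := TM_nonneg h 1 x
  have hy0 : 0 < ‖y‖ := by
    rcases (norm_nonneg y).eq_or_lt with h | h
    · rw [← h] at h1; simp at h1; linarith
    · exact h
  have hLp : 0 < L := by
    rcases hL0.eq_or_lt with h | h
    · rw [← h] at h1; simp at h1; linarith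
    · exact h
  have hρ' : ‖ρ‖ = (‖y‖ * L)⁻¹ := eq_inv_of_mul_eq_one_left hρ
  -- basic bound
  have key : ∀ (γ δ : Fin n → ℕ) (m : ℕ), deg γ = m → 1 ≤ m → 2 ≤ m + deg δ →
      ‖(chs δ γ : K) * h (δ + γ) x * mon (ρ • t) δ‖ < ‖y‖ ^ (m - 1) * L ^ m := by
    intro γ δ m hm hm1 hm2
    have hb := h2 (m + deg δ) hm2
    have hd : deg (δ + γ) = m + deg δ := by rw [deg_add, hm]; omega
    calc ‖(chs δ γ : K) * h (δ + γ) x * mon (ρ • t) δ‖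
        = ‖(chs δ γ : K)‖ * ‖h (δ + γ) x‖ * ‖mon (ρ • t) δ‖ := by rw [norm_mul, norm_mul]
      _ ≤ 1 * NM h (m + deg δ) x * ‖ρ‖ ^ deg δ := by
          gcongr
          · simpa using NM_nonneg h _ x
          · exact nat_norm_le _
          · exact le_NM h hd x
          · rw [mon_smul, norm_mul, norm_pow]
            refine mul_le_of_le_one_right (by positivity) ((mon_norm_le t δ).trans (pow_le_one₀ (norm_nonneg _) ht))
      _ < 1 * (‖y‖ ^ (m + deg δ - 1) * L ^ (m + deg δ)) * ‖ρ‖ ^ deg δ := by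
          have : 0 < ‖ρ‖ := by rw [hρ']; positivity
          gcongr
      _ = ‖y‖ ^ (m - 1) * L ^ m := by
          rw [hρ', show m + deg δ - 1 = (m - 1) + deg δ by omega, pow_add, pow_add, inv_pow, mul_pow]
          field_simp
  have key0 : ∀ (γ : Fin n → ℕ) (m : ℕ), deg γ = m → 2 ≤ m → ‖h γ (x + ρ • t)‖ < ‖y‖ ^ (m - 1) * L ^ m := by
    intro γ m hm hm2
    rw [H.taylor]
    exact um_sum_lt _ _ (by positivity) fun δ _ => key γ δ m hm (by omega) (by omega)
  have key1 : ∀ γ : Fin n → ℕ, deg γ = 1 → ‖h γ (x + ρ • t) - h γ x‖ < L := by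
    intro γ hγ
    have h0 : (0 : Fin n → ℕ) ∈ Box n D := by simp [mem_Box]
    rw [H.taylor, ← Finset.add_sum_erase _ _ h0, chs_zero_left, mon_zero, zero_add, Nat.cast_one, one_mul,
      mul_one, add_sub_cancel_left]
    refine um_sum_lt _ _ hLp fun δ hδ => ?_
    have hδ0 : 1 ≤ deg δ := by
      by_contra hc
      exact (Finset.mem_erase.1 hδ).1 (deg_eq_zero (by omega))
    have := key γ δ 1 hγ le_rfl (by omega)
    simpa using this
  have hTM : TM h 1 (x + ρ • t) = L := by
    apply le_antisymm
    · rw [TM_le h hL0]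
      intro γ hγ
      rw [Tf_deg_one h hγ, show h γ (x + ρ • t) = (h γ (x + ρ • t) - h γ x) + h γ x by ring]
      refine (IsUltrametricDist.norm_add_le_max _ _).trans (max_le (key1 γ hγ).le ?_)
      rw [← Tf_deg_one h hγ]
      exact le_TM h hγ x
    · obtain ⟨γ, hγ, e⟩ := exists_TM h (M := 1) (x := x) hLp
      refine le_trans ?_ (le_TM h hγ _)
      rw [Tf_deg_one h hγ] at e ⊢
      rw [← hL] at e
      by_contra hc
      push Not at hc
      have : ‖h γ x‖ < L := by
        rw [show h γ x = h γ (x + ρ • t) + -(h γ (x + ρ • t) - h γ x) by ring]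
        refine (IsUltrametricDist.norm_add_le_max _ _).trans_lt (max_lt hc ?_)
        rw [norm_neg]
        exact key1 γ hγ
      linarith
  refine ⟨hTM, ?_, ?_⟩
  · simp only [Bad, Set.mem_ofPred_eq, not_or, not_lt, not_exists, not_and, not_le]
    rw [hTM]
    refine ⟨h1, fun m hm => ?_⟩
    by_contra hc
    push Not at hc
    obtain ⟨γ, hγ, e⟩ := exists_NM h (M := m) (x := x + ρ • t) (lt_of_lt_of_le (by positivity) hc)
    have := key0 γ m hγ hm
    linarith
  · rw [H.taylor, Box_split H.one_le]
    simp only [chs_zero_left, mon_zero, Nat.cast_one, mul_one, one_mul, add_zero]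
    have e1 : ∑ i, (chs (ee i) (0 : Fin n → ℕ) : K) * h (ee i) x * mon (ρ • t) (ee i) =
        ∑ i, h (ee i) x * (ρ * t i) := by
      refine Finset.sum_congr rfl fun i _ => ?_
      simp [mon_ee, chs]
    rw [e1, add_assoc, add_sub_cancel_left, add_sub_cancel_left, Finset.mul_sum]
    refine um_sum_lt _ _ one_pos fun δ hδ => ?_
    have hδ0 : 2 ≤ deg δ := (Finset.mem_filter.1 hδ).2
    have hb := h2 _ hδ0
    rw [norm_mul]
    calc ‖y‖ * ‖(chs δ (0 : Fin n → ℕ) : K) * h δ x * mon (ρ • t) δ‖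
        ≤ ‖y‖ * (1 * NM h (deg δ) x * ‖ρ‖ ^ deg δ) := by
          rw [norm_mul, norm_mul]
          gcongr
          · simpa using NM_nonneg h _ x
          · exact nat_norm_le _
          · exact le_NM h rfl x
          · rw [mon_smul, norm_mul, norm_pow]
            refine mul_le_of_le_one_right (by positivity) ((mon_norm_le t δ).trans (pow_le_one₀ (norm_nonneg _) ht))
      _ < ‖y‖ * (1 * (‖y‖ ^ (deg δ - 1) * L ^ (deg δ)) * ‖ρ‖ ^ deg δ) := by
          have : 0 < ‖ρ‖ := by rw [hρ']; positivity
          gcongr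
      _ = 1 := by
          obtain ⟨d, hd⟩ : ∃ d, deg δ = d + 1 := ⟨deg δ - 1, by omega⟩
          rw [hρ', hd, Nat.add_sub_cancel, inv_pow, mul_pow]
          field_simp
          ring

theorem reps_sum {E : Type*} [SeminormedAddCommGroup E] [IsUltrametricDist E] (S : Finset E) {r : ℝ}
    (hS1 : ∀ s ∈ S, ‖s‖ ≤ 1) (hS : ∀ x : E, ‖x‖ ≤ 1 → ∃! s, s ∈ S ∧ ‖x - s‖ ≤ r) (f : E → ℂ)
    (hf : ∀ x x', ‖x‖ ≤ 1 → ‖x'‖ ≤ 1 → ‖x - x'‖ ≤ r → f x = f x') (w : E) (hw : ‖w‖ ≤ 1) :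
    ∑ s ∈ S, f (w + s) = ∑ s ∈ S, f s := by
  choose! rep hrep hrepu using fun (x : E) (hx : ‖x‖ ≤ 1) => (hS x hx)
  have hws : ∀ s ∈ S, ‖w + s‖ ≤ 1 := fun s hs =>
    (IsUltrametricDist.norm_add_le_max _ _).trans (max_le hw (hS1 s hs))
  have hws' : ∀ s ∈ S, ‖s - w‖ ≤ 1 := fun s hs => by
    rw [sub_eq_add_neg]
    exact (IsUltrametricDist.norm_add_le_max _ _).trans (max_le (hS1 s hs) (by rwa [norm_neg]))
  refine Finset.sum_bij' (fun s _ => rep (w + s)) (fun s _ => rep (s - w)) ?_ ?_ ?_ ?_ ?_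
  · exact fun s hs => (hrep _ (hws s hs)).1
  · exact fun s hs => (hrep _ (hws' s hs)).1
  · intro s hs
    obtain ⟨a1, a2⟩ := hrep _ (hws s hs)
    refine (hrepu _ (hws' _ a1) s ⟨hs, ?_⟩).symm
    rw [norm_sub_rev] at a2
    rwa [sub_sub]
  · intro s hs
    obtain ⟨a1, a2⟩ := hrep _ (hws' s hs)
    refine (hrepu _ (hws _ a1) s ⟨hs, ?_⟩).symm
    rw [norm_sub_rev] at a2
    rwa [show w + rep (s - w) - s = rep (s - w) - (s - w) by abel]
  · intro s hs
    obtain ⟨a1, a2⟩ := hrep _ (hws s hs)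
    exact hf _ _ (hws s hs) (hS1 _ a1) a2

theorem ac_zero {ψ : K → ℂ} (hψ : IsAddChar ψ) : ψ 0 = 1 := hψ.triv 0 (by simp)

theorem ac_sub {ψ : K → ℂ} (hψ : IsAddChar ψ) {a b : K} (h : ‖a - b‖ < 1) : ψ a = ψ b := by
  rw [show a = (a - b) + b by ring, hψ.map_add, hψ.triv _ h, one_mul]

theorem ac_sum {ψ : K → ℂ} (hψ : IsAddChar ψ) {ι : Type*} (s : Finset ι) (f : ι → K) :
    ψ (∑ i ∈ s, f i) = ∏ i ∈ s, ψ (f i) := by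
  induction s using Finset.induction_on with
  | empty => simp [ac_zero hψ]
  | insert a s ha ih => rw [Finset.sum_insert ha, Finset.prod_insert ha, hψ.map_add, ih]

theorem ac_reps_zero (hK : IsLocalField K q) {ψ : K → ℂ} (hψ : IsAddChar ψ) (T : Finset K)
    (hT1 : ∀ t ∈ T, ‖t‖ ≤ 1) (hT : ∀ x : K, ‖x‖ ≤ 1 → ∃! t, t ∈ T ∧ ‖x - t‖ ≤ (q : ℝ)⁻¹ ^ 1) (c : K) (hc : ‖c‖ = 1) :
    ∑ t ∈ T, ψ (c * t) = 0 := by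
  have := lf_ultra hK
  have hq := lf_q1 hK
  have hq1 : (q : ℝ)⁻¹ ^ 1 < 1 := by simpa using inv_lt_one_of_one_lt₀ hq
  obtain ⟨x0, hx0, hx1⟩ := hψ.nontriv
  have hc0 : c ≠ 0 := by rintro rfl; simp at hc
  have h := reps_sum T hT1 hT (fun t => ψ (c * t)) (by
    intro x x' _ _ h
    refine ac_sub hψ ?_
    rw [← mul_sub, norm_mul, hc, one_mul]
    exact h.trans_lt hq1) (x0 / c) (by rw [norm_div, hc, div_one]; exact hx0)
  have e : ∀ t, ψ (c * (x0 / c + t)) = ψ x0 * ψ (c * t) := by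
    intro t
    rw [← hψ.map_add]
    congr 1
    field_simp
  simp only [e] at h
  rw [← Finset.mul_sum] at h
  have : (ψ x0 - 1) * ∑ t ∈ T, ψ (c * t) = 0 := by rw [sub_mul, h]; ring
  rcases mul_eq_zero.1 this with h | h
  · exact absurd (sub_eq_zero.1 h) hx1
  · exact h

end VdC9
end

section
open MeasureTheory Filter VdC
open scoped NNReal ENNReal Classical
namespace VdC9
variable {K : Type} [NontriviallyNormedField K] {q n : ℕ}
variable [MeasurableSpace K] {P : Measure K} [BorelSpace K] [SecondCountableTopology K]

theorem Bad_meas {D : ℕ} {h : (Fin n → ℕ) → (Fin n → K) → K} (H : TS D h) (y : K) :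
    MeasurableSet (Bad h y) := by
  have hT := (TM_cont H 1).measurable
  have e : Bad h y = {x | ‖y‖ * TM h 1 x < 1} ∪ ⋃ m : ℕ, ⋃ _ : 2 ≤ m,
      {x | ‖y‖ ^ (m - 1) * TM h 1 x ^ m ≤ NM h m x} := by
    ext x
    simp [Bad]
  rw [e]
  refine (measurableSet_lt (hT.const_mul _) measurable_const).union ?_
  refine MeasurableSet.iUnion fun m => MeasurableSet.iUnion fun _ => ?_
  exact measurableSet_le ((hT.pow_const m).const_mul _) (NM_cont H m).measurable

theorem osc_bound (hK : IsLocalField K q) (hP : IsUnif q P) {ψ : K → ℂ} (hψ : IsAddChar ψ)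
    {D : ℕ} {h : (Fin n → ℕ) → (Fin n → K) → K} (H : TS D h) (y : K) (hy : y ≠ 0) :
    ‖∫ x, ψ (y * h 0 x) ∂(PP P n)‖ ≤ (PP P n).real (Bad h y) := by
  have := PP_prob hP n
  have := lf_ultra hK
  have hq := lf_q1 hK
  obtain ⟨π, hπ⟩ := hK.exists_unif
  have hπ0 : π ≠ 0 := by
    rintro rfl
    simp at hπ
    linarith
  obtain ⟨T, hTc, hT1, hT⟩ := exists_reps hK 1
  set F : (Fin n → K) → ℂ := fun x => ψ (y * h 0 x) with hF
  have hFc : Continuous F := hψ.cont.comp (continuous_const.mul (TS_cont H 0))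
  have hFint : Integrable F (PP P n) :=
    Integrable.of_bound hFc.aestronglyMeasurable 1 (Eventually.of_forall fun x => by simp [hF, hψ.norm_eq])
  set E : ℕ → Set (Fin n → K) := fun j => {x | x ∉ Bad h y ∧ ‖y‖ * TM h 1 x = (q : ℝ) ^ j} with hE
  have hBm := Bad_meas H y
  have hEm : ∀ j, MeasurableSet (E j) := fun j =>
    hBm.compl.inter (measurableSet_eq_fun ((TM_cont H 1).measurable.const_mul _) measurable_const)
  have hcover : (Bad h y)ᶜ = ⋃ j, E j := by
    ext x
    simp only [Set.mem_compl_iff, Set.mem_iUnion, hE, Set.mem_ofPred_eq]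
    constructor
    · intro hx
      have hx' := hx
      simp only [Bad, Set.mem_ofPred_eq, not_or, not_lt] at hx'
      have h1 := hx'.1
      have hp : 0 < TM h 1 x := by
        rcases (TM_nonneg h 1 x).eq_or_lt with h | h
        · rw [← h] at h1; simp at h1; linarith
        · exact h
      obtain ⟨γ, hγ, e⟩ := exists_TM h hp
      have hne : y * Tf h γ x ≠ 0 := by
        refine mul_ne_zero hy ?_
        rw [← norm_pos_iff, e]
        exact hp
      obtain ⟨m, hm⟩ := hK.discrete _ hne
      rw [norm_mul, e] at hm
      have hm0 : 0 ≤ m := by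
        by_contra hc
        push Not at hc
        rw [hm] at h1
        exact absurd h1 (not_le.2 (zpow_lt_one_of_neg₀ hq hc))
      lift m to ℕ using hm0
      exact ⟨m, hx, by rw [hm, zpow_natCast]⟩
    · rintro ⟨j, hx, -⟩
      exact hx
  have hzero : ∀ j, ∫ x in E j, F x ∂(PP P n) = 0 := by
    intro j
    have hρ : ‖π ^ j‖ * (q : ℝ) ^ j = 1 := by
      rw [norm_pow, hπ, ← mul_pow, inv_mul_cancel₀ (by positivity), one_pow]
    have hρ1 : ‖π ^ j‖ ≤ 1 := by
      rw [norm_pow, hπ]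
      exact pow_le_one₀ (by positivity) (inv_le_one_of_one_le₀ hq.le)
    have hsh : ∀ x ∈ E j, ∀ t : Fin n → K, ‖t‖ ≤ 1 → x + π ^ j • t ∈ E j ∧
        F (x + π ^ j • t) = F x * ∏ i, ψ (y * h (ee i) x * π ^ j * t i) := by
      intro x hx t ht
      obtain ⟨a, b, c⟩ := good_shift H y (π ^ j) x hx.1 (by rw [hx.2, hρ]) t ht
      refine ⟨⟨b, by rw [a]; exact hx.2⟩, ?_⟩
      rw [← ac_sum hψ, hF]
      simp only
      rw [← hψ.map_add]
      refine ac_sub hψ ?_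
      convert c using 2
      rw [mul_sub, mul_sub, Finset.mul_sum, sub_sub]
      congr 2
      exact Finset.sum_congr rfl fun i _ => by ring
    have hmem : ∀ x, ∀ t : Fin n → K, ‖t‖ ≤ 1 → (π ^ j • t + x ∈ E j ↔ x ∈ E j) := by
      intro x t ht
      rw [add_comm]
      constructor
      · intro hx
        have := (hsh _ hx (-t) (by rwa [norm_neg])).1
        simpa using this
      · intro hx
        exact (hsh _ hx t ht).1
    have htr : ∀ t : Fin n → K, ‖t‖ ≤ 1 → ∫ x in E j, F x ∂(PP P n) =
        ∫ x in E j, F x * ∏ i, ψ (y * h (ee i) x * π ^ j * t i) ∂(PP P n) := by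
      intro t ht
      have hv : ‖π ^ j • t‖ ≤ 1 := by
        rw [norm_smul]
        exact mul_le_one₀ hρ1 (norm_nonneg _) ht
      have hmp := PP_inv hP n (π ^ j • t) hv
      have h1 := hmp.setIntegral_preimage_emb (MeasurableEquiv.addLeft (π ^ j • t)).measurableEmbedding F (E j)
      rw [← h1]
      have h2 : (fun x => π ^ j • t + x) ⁻¹' (E j) = E j := by
        ext x
        exact hmem x t ht
      rw [h2]
      refine setIntegral_congr_fun (hEm j) fun x hx => ?_
      rw [add_comm, (hsh x hx t ht).2]
    -- average
    have hS1 : ∀ t ∈ Fintype.piFinset (fun _ : Fin n => T), ‖t‖ ≤ 1 := by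
      intro t ht
      rw [pi_norm_le_iff_of_nonneg zero_le_one]
      exact fun i => hT1 _ (Fintype.mem_piFinset.1 ht i)
    have hsum : ∑ _t ∈ Fintype.piFinset (fun _ : Fin n => T), ∫ x in E j, F x ∂(PP P n) =
        ∫ x in E j, F x * ∑ t ∈ Fintype.piFinset (fun _ : Fin n => T),
          ∏ i, ψ (y * h (ee i) x * π ^ j * t i) ∂(PP P n) := by
      rw [Finset.sum_congr rfl (fun t ht => htr t (hS1 t ht))]
      rw [← integral_finsetSum]
      · simp only [Finset.mul_sum]
      · intro t _
        refine Integrable.integrableOn ?_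
        refine Integrable.of_bound (Continuous.aestronglyMeasurable ?_) 1 (Eventually.of_forall fun x => ?_)
        · refine hFc.mul (continuous_finsetProd _ fun i _ => hψ.cont.comp ?_)
          exact ((continuous_const.mul (TS_cont H _)).mul continuous_const).mul continuous_const
        · simp [hF, hψ.norm_eq]
    have hz : ∀ x ∈ E j, F x * ∑ t ∈ Fintype.piFinset (fun _ : Fin n => T),
          ∏ i, ψ (y * h (ee i) x * π ^ j * t i) = 0 := by
      intro x hx
      rw [← Finset.prod_univ_sum (fun _ : Fin n => T) (fun i t => ψ (y * h (ee i) x * π ^ j * t))]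
      have hp : 0 < TM h 1 x := by
        have := hx.2
        rcases (TM_nonneg h 1 x).eq_or_lt with h | h
        · rw [← h] at this
          have h3 : (0 : ℝ) < q ^ j := by positivity
          simp at this
          linarith
        · exact h
      obtain ⟨γ, hγ, e⟩ := exists_TM h hp
      obtain ⟨i, rfl⟩ := deg_eq_one hγ
      rw [Finset.prod_eq_zero (Finset.mem_univ i), mul_zero]
      refine ac_reps_zero hK hψ T hT1 hT _ ?_
      rw [Tf_deg_one h hγ] at e
      rw [norm_mul, norm_mul, e, hx.2, mul_comm, hρ]
    rw [setIntegral_congr_fun (hEm j) hz] at hsum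
    simp only [Finset.sum_const, integral_zero, nsmul_eq_mul] at hsum
    rcases mul_eq_zero.1 hsum with h0 | h0
    · exfalso
      simp only [Fintype.card_piFinset, hTc, Finset.prod_const, Nat.cast_pow, pow_one] at h0
      have h4 : (q : ℂ) ≠ 0 := by
        have : q ≠ 0 := by have := hK.one_lt; omega
        exact_mod_cast this
      exact (pow_ne_zero _ h4) h0
    · exact h0
  have hdis : Pairwise (Function.onFun Disjoint E) := by
    intro i j hij
    rw [Function.onFun, Set.disjoint_left]
    intro x hx hx'
    have := hx.2.symm.trans hx'.2
    exact hij (pow_right_injective₀ (by linarith) hq.ne' this)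
  have hcomp : ∫ x in (Bad h y)ᶜ, F x ∂(PP P n) = 0 := by
    rw [hcover]
    have := hasSum_integral_iUnion hEm hdis (hFint.integrableOn (s := ⋃ j, E j))
    simp only [hzero] at this
    exact this.unique hasSum_zero
  rw [← integral_add_compl hBm hFint, hcomp, add_zero]
  have := norm_setIntegral_le_of_norm_le_const (μ := PP P n) (s := Bad h y) (f := F) (C := 1)
    (measure_lt_top _ _) (fun x _ => by simp [hF, hψ.norm_eq])
  simpa using this

end VdC9
end

section
open MeasureTheory Filter VdC
open scoped NNReal ENNReal Classical
namespace VdC9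

section
variable {K : Type} [NontriviallyNormedField K] {q n : ℕ}

theorem exists_norm_zpow (hK : IsLocalField K q) (z : ℤ) : ∃ c : K, c ≠ 0 ∧ ‖c‖ = (q : ℝ) ^ z := by
  have hq := lf_q1 hK
  obtain ⟨π, hπ⟩ := hK.exists_unif
  have hπ0 : π ≠ 0 := by
    rintro rfl
    simp at hπ
    linarith
  exact ⟨π ^ (-z), zpow_ne_zero _ hπ0, by rw [norm_zpow, hπ]; simp⟩

theorem exists_norm_between (hK : IsLocalField K q) {r : ℝ} (hr : 0 < r) :
    ∃ c : K, c ≠ 0 ∧ r ≤ ‖c‖ ∧ ‖c‖ ≤ q * r := by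
  have hq := lf_q1 hK
  obtain ⟨z, h1, h2⟩ := exists_mem_Ioc_zpow hr hq
  obtain ⟨c, hc, e⟩ := exists_norm_zpow hK (z + 1)
  refine ⟨c, hc, by rw [e]; exact h2, ?_⟩
  rw [e, zpow_add_one₀ (by positivity), mul_comm]
  gcongr

theorem PP_diam' [MeasurableSpace K] {P : Measure K} [BorelSpace K] [SecondCountableTopology K]
    (hK : IsLocalField K q) (hP : IsUnif q P) (n : ℕ) (A : Set (Fin n → K)) {r : ℝ} (hr : 0 < r)
    (hA1 : ∀ x ∈ A, ‖x‖ ≤ 1) (hA : ∀ x ∈ A, ∀ z ∈ A, ‖x - z‖ ≤ r) :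
    (PP P n).real A ≤ (q * r) ^ n := by
  have := PP_prob hP n
  obtain ⟨c, hc0, hc1, hc2⟩ := exists_norm_between hK hr
  by_cases h1 : ‖c‖ ≤ 1
  · refine (PP_diam hP hK n A c h1 hc0 hA1 fun x hx z hz => (hA x hx z hz).trans hc1).trans ?_
    exact pow_le_pow_left₀ (norm_nonneg _) hc2 _
  · push Not at h1
    refine measureReal_le_one.trans (one_le_pow₀ (by linarith))

theorem norm_dvd [IsUltrametricDist K] {a b : ℕ} (hab : a ∣ b) : ‖(b : K)‖ ≤ ‖(a : K)‖ := by
  obtain ⟨c, rfl⟩ := hab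
  rw [Nat.cast_mul, norm_mul]
  exact mul_le_of_le_one_right (norm_nonneg _) (nat_norm_le c)

theorem fac_dvd {γ : Fin n → ℕ} {k : ℕ} (hγ : deg γ = k) : fac γ ∣ k.factorial := by
  rw [← hγ]
  exact Nat.prod_factorial_dvd_factorial_sum _ _

theorem NM_le_TM [IsUltrametricDist K] (h : (Fin n → ℕ) → (Fin n → K) → K) (k : ℕ) (x : Fin n → K) {G : ℝ}
    (hG : 1 ≤ G * ‖(k.factorial : K)‖) : NM h k x ≤ G * TM h k x := by
  have hG0 : 0 < G := by
    by_contra hc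
    push Not at hc
    have := mul_nonpos_of_nonpos_of_nonneg hc (norm_nonneg (k.factorial : K))
    linarith
  rw [NM_le h (mul_nonneg hG0.le (TM_nonneg _ _ _))]
  intro γ hγ
  have h1 := le_TM h hγ x
  rw [Tf, norm_mul] at h1
  have h2 := norm_dvd (K := K) (fac_dvd hγ)
  calc ‖h γ x‖ = 1 * ‖h γ x‖ := (one_mul _).symm
    _ ≤ (G * ‖(fac γ : K)‖) * ‖h γ x‖ := by
        gcongr
        exact hG.trans (by gcongr)
    _ = G * (‖(fac γ : K)‖ * ‖h γ x‖) := by ring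
    _ ≤ _ := by gcongr

/-- rescaled system -/
def resc (h : (Fin n → ℕ) → (Fin n → K) → K) (b : Fin n → K) (ρ c : K) :
    (Fin n → ℕ) → (Fin n → K) → K := fun γ t => c * ρ ^ deg γ * h γ (b + ρ • t)

theorem TM_resc (h : (Fin n → ℕ) → (Fin n → K) → K) (b : Fin n → K) (ρ c : K) (M : ℕ) (t : Fin n → K) :
    TM (resc h b ρ c) M t = ‖c‖ * ‖ρ‖ ^ M * TM h M (b + ρ • t) := by
  have : ‖c‖ * ‖ρ‖ ^ M = ((‖c‖₊ * ‖ρ‖₊ ^ M : ℝ≥0) : ℝ) := by push_cast; rfl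
  rw [TM, TM, this, ← NNReal.coe_mul, NNReal.mul_finset_sup]
  congr 1
  refine Finset.sup_congr rfl fun γ hγ => ?_
  rw [mem_anti] at hγ
  rw [Tf, resc, Tf, hγ, ← nnnorm_pow, ← nnnorm_mul, ← nnnorm_mul]
  congr 1
  ring

theorem NM_resc (h : (Fin n → ℕ) → (Fin n → K) → K) (b : Fin n → K) (ρ c : K) (M : ℕ) (t : Fin n → K) :
    NM (resc h b ρ c) M t = ‖c‖ * ‖ρ‖ ^ M * NM h M (b + ρ • t) := by
  have : ‖c‖ * ‖ρ‖ ^ M = ((‖c‖₊ * ‖ρ‖₊ ^ M : ℝ≥0) : ℝ) := by push_cast; rfl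
  rw [NM, NM, this, ← NNReal.coe_mul, NNReal.mul_finset_sup]
  congr 1
  refine Finset.sup_congr rfl fun γ hγ => ?_
  rw [mem_anti] at hγ
  rw [resc, hγ, ← nnnorm_pow, ← nnnorm_mul, ← nnnorm_mul]

theorem Bad_resc (h : (Fin n → ℕ) → (Fin n → K) → K) (b : Fin n → K) (ρ c y : K) (hρ : ‖ρ‖ ≤ 1) (hc : c ≠ 0)
    (t : Fin n → K) (hb : b + ρ • t ∈ Bad h y) : t ∈ Bad (resc h b ρ c) (y / c) := by
  have hc' : 0 < ‖c‖ := norm_pos_iff.2 hc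
  rcases hb with hb | ⟨m, hm, hb⟩
  · left
    rw [TM_resc, norm_div]
    calc ‖y‖ / ‖c‖ * (‖c‖ * ‖ρ‖ ^ 1 * TM h 1 (b + ρ • t)) = ‖ρ‖ * (‖y‖ * TM h 1 (b + ρ • t)) := by
          field_simp
      _ ≤ 1 * (‖y‖ * TM h 1 (b + ρ • t)) := by
          gcongr
          exact mul_nonneg (norm_nonneg _) (TM_nonneg _ _ _)
      _ < 1 := by rwa [one_mul]
  · right
    refine ⟨m, hm, ?_⟩
    rw [TM_resc, NM_resc, norm_div]
    obtain ⟨d, rfl⟩ : ∃ d, m = d + 1 := ⟨m - 1, by omega⟩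
    rw [Nat.add_sub_cancel] at hb ⊢
    calc (‖y‖ / ‖c‖) ^ d * (‖c‖ * ‖ρ‖ ^ 1 * TM h 1 (b + ρ • t)) ^ (d + 1)
        = ‖c‖ * ‖ρ‖ ^ (d + 1) * (‖y‖ ^ d * TM h 1 (b + ρ • t) ^ (d + 1)) := by
          rw [div_pow, mul_pow, mul_pow, pow_one, pow_succ ‖c‖]
          field_simp
      _ ≤ _ := by gcongr

theorem TM_shift [IsUltrametricDist K] {D : ℕ} {h : (Fin n → ℕ) → (Fin n → K) → K} (H : TS D h) (k : ℕ)
    (x t : Fin n → K) (G : ℝ) (hG0 : 0 ≤ G) (hG : ∀ m, k + 1 ≤ m → NM h m x ≤ G) (ht : ‖t‖ ≤ 1)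
    (hlt : G * ‖t‖ < TM h k x) : TM h k (x + t) = TM h k x := by
  have hp : 0 < TM h k x := lt_of_le_of_lt (by positivity) hlt
  have hd : ∀ γ, deg γ = k → ‖Tf h γ (x + t) - Tf h γ x‖ < TM h k x := fun γ hγ =>
    (Tf_lip H γ x t G hG0 (fun γ' h' => (le_NM h rfl x).trans (hG _ (by omega))) ht).trans_lt hlt
  apply le_antisymm
  · rw [TM_le h hp.le]
    intro γ hγ
    rw [show Tf h γ (x + t) = (Tf h γ (x + t) - Tf h γ x) + Tf h γ x by ring]
    exact (IsUltrametricDist.norm_add_le_max _ _).trans (max_le (hd γ hγ).le (le_TM h hγ x))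
  · obtain ⟨γ, hγ, e⟩ := exists_TM h hp
    refine le_trans ?_ (le_TM h hγ _)
    by_contra hc
    push Not at hc
    have : ‖Tf h γ x‖ < TM h k x := by
      rw [show Tf h γ x = Tf h γ (x + t) + -(Tf h γ (x + t) - Tf h γ x) by ring]
      refine (IsUltrametricDist.norm_add_le_max _ _).trans_lt (max_lt hc ?_)
      rw [norm_neg]
      exact hd γ hγ
    linarith

theorem exists_supp {γ : Fin n → ℕ} {k : ℕ} (hγ : deg γ = k + 1) : ∃ i, ∃ γ', γ = γ' + ee i ∧ deg γ' = k := by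
  have : ∃ i, γ i ≠ 0 := by
    by_contra hh
    push Not at hh
    simp [deg, hh] at hγ
  obtain ⟨i, hi⟩ := this
  have hle : ee i ≤ γ := by
    intro j
    by_cases hj : j = i
    · subst hj
      simp [ee]
      omega
    · simp [ee, hj]
  have e : γ = (γ - ee i) + ee i := (tsub_add_cancel_of_le hle).symm
  refine ⟨i, γ - ee i, e, ?_⟩
  have := hγ
  rw [e, deg_add, deg_ee] at this
  omega

end
end VdC9
end

section
open MeasureTheory Filter VdC
open scoped NNReal ENNReal Classical
namespace VdC9

section
variable {K : Type} [NontriviallyNormedField K] {q n : ℕ}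

theorem norm_eq_of_sub_lt [IsUltrametricDist K] {a b : K} (h : ‖a - b‖ < ‖b‖) : ‖a‖ = ‖b‖ := by
  have e : a = (a - b) + b := by ring
  rw [e, IsUltrametricDist.norm_add_eq_max_of_norm_ne_norm h.ne, max_eq_right h.le]

/-- coordinate vector -/
def sg (i : Fin n) (w : K) : Fin n → K := Pi.single i w

theorem norm_sg (i : Fin n) (w : K) : ‖sg i w‖ = ‖w‖ := Pi.norm_single _

theorem sg_cont (i : Fin n) : Continuous (sg i : K → Fin n → K) :=
  continuous_single (A := fun _ : Fin n => K) i

theorem sg_add (i : Fin n) (w w' : K) : sg i (w + w') = sg i w + sg i w' := Pi.single_add _ _ _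

theorem sum_single_mul (T : Fin n → K) (i : Fin n) (w : K) :
    ∑ j, T j * sg i w j = T i * w := by
  rw [Finset.sum_eq_single i]
  · simp [sg]
  · intro j _ hj
    simp [sg, hj]
  · simp

/-- one-dimensional expansion -/
theorem exp1 [IsUltrametricDist K] {D : ℕ} {h : (Fin n → ℕ) → (Fin n → K) → K} (H : TS D h)
    (γ : Fin n → ℕ) (i : Fin n) (z : Fin n → K) (w : K) (hw : ‖w‖ ≤ 1) (G : ℝ) (hG0 : 0 ≤ G)
    (hG : ∀ γ', deg γ + 2 ≤ deg γ' → ‖h γ' z‖ ≤ G) (hlt : G * ‖w‖ < ‖Tf h (γ + ee i) z‖) :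
    ‖Tf h γ (z + sg i w) - Tf h γ z‖ = ‖Tf h (γ + ee i) z‖ * ‖w‖ := by
  rcases eq_or_ne w 0 with rfl | hw0
  · simp [sg]
  have hw1 : 0 < ‖w‖ := norm_pos_iff.2 hw0
  have h1 := Tf_lip2 H γ z (sg i w) G hG0 hG (by rw [norm_sg]; exact hw)
  rw [sum_single_mul (fun j => Tf h (γ + ee j) z), norm_sg] at h1
  rw [← norm_mul]
  apply norm_eq_of_sub_lt
  refine h1.trans_lt ?_
  rw [norm_mul, pow_two, ← mul_assoc]
  exact mul_lt_mul_of_pos_right hlt hw1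

theorem norm_fin1 (u : Fin 1 → K) : ‖u‖ = ‖u 0‖ := by
  apply le_antisymm _ (norm_le_pi_norm u 0)
  rw [pi_norm_le_iff_of_nonneg (norm_nonneg _)]
  intro j
  rw [Subsingleton.elim j 0]

/-- density of the sublevel sets of the derivatives of order `k` -/
theorem tame_dens [MeasurableSpace K] {P : Measure K} [BorelSpace K] [SecondCountableTopology K]
    (hK : IsLocalField K q) (hP : IsUnif q P) {D : ℕ} {h : (Fin n → ℕ) → (Fin n → K) → K} (H : TS D h) (k : ℕ)
    (N0 : ℕ) (hT : ∀ x, ‖x‖ ≤ 1 → 1 ≤ TM h (k + 1) x)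
    (hN : ∀ x, ‖x‖ ≤ 1 → ∀ m, k + 1 ≤ m → NM h m x < (q : ℝ) ^ N0) {lam : ℝ} (hlam : 0 < lam) :
    (PP P n).real {x | TM h k x ≤ lam} ≤
      (((Finset.univ : Finset (Fin n)).piAntidiag (k + 1)).card * (q : ℝ) ^ (N0 + 2)) * lam := by
  have := PP_prob hP n
  have := lf_ultra hK
  have hq := lf_q1 hK
  set S := (Finset.univ : Finset (Fin n)).piAntidiag (k + 1)
  have hone : (PP P n).real {x | TM h k x ≤ lam} ≤
      (PP P n).real (⋃ γ ∈ S, {x | ‖x‖ ≤ 1 ∧ TM h k x ≤ lam ∧ 1 ≤ ‖Tf h γ x‖}) := by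
    refine ENNReal.toReal_mono (measure_ne_top _ _) (measure_mono_ae ?_)
    filter_upwards [PP_supp hP n] with x hx hxl
    have h1 := hT x hx
    obtain ⟨γ, hγ, e⟩ := exists_TM h (lt_of_lt_of_le one_pos h1)
    exact Set.mem_iUnion₂.2 ⟨γ, mem_anti.2 hγ, hx, hxl, by rw [e]; exact h1⟩
  refine hone.trans ((measureReal_biUnion_finset_le _ _).trans ?_)
  rw [mul_assoc, ← nsmul_eq_mul]
  refine Finset.sum_le_card_nsmul _ _ _ fun γ hγ => ?_
  obtain ⟨i, γ', rfl, hγ'⟩ := exists_supp (mem_anti.1 hγ)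
  obtain ⟨ρ, hρ0, hρ⟩ := exists_norm_zpow hK (-((N0 + 1 : ℕ) : ℤ))
  rw [zpow_neg, zpow_natCast] at hρ
  have hρ1 : ‖ρ‖ ≤ 1 := by
    rw [hρ]
    exact inv_le_one_of_one_le₀ (one_le_pow₀ hq.le)
  have hρp : 0 < ‖ρ‖ := norm_pos_iff.2 hρ0
  have hρG : (q : ℝ) ^ N0 * ‖ρ‖ < 1 := by
    rw [hρ, ← div_eq_mul_inv, div_lt_one (by positivity)]
    exact pow_lt_pow_right₀ hq (by omega)
  have hφ1 : ∀ u : Fin 1 → K, ‖u‖ ≤ 1 → ‖sg i (ρ * u 0)‖ ≤ 1 := by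
    intro u hu
    rw [norm_sg, norm_mul, ← norm_fin1 u]
    exact mul_le_one₀ hρ1 (norm_nonneg _) hu
  have hmeasA : MeasurableSet {x | ‖x‖ ≤ 1 ∧ TM h k x ≤ lam ∧ 1 ≤ ‖Tf h (γ' + ee i) x‖} :=
    (measurableSet_le measurable_norm measurable_const).inter
      ((measurableSet_le (TM_cont H k).measurable measurable_const).inter
        (measurableSet_le measurable_const (Tf_cont H _).measurable.norm))
  have hφm : Measurable (fun u : Fin 1 → K => sg i (ρ * u 0)) := by
    have hc : Continuous (fun u : Fin 1 → K => sg i (ρ * u 0)) :=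
      (sg_cont i).comp (continuous_const.mul (continuous_apply 0))
    exact hc.measurable
  have hmain : ∀ x : Fin n → K, ‖x‖ ≤ 1 → (PP P 1).real {u : Fin 1 → K | ‖u‖ ≤ 1 ∧ x + sg i (ρ * u 0) ∈
      {x | ‖x‖ ≤ 1 ∧ TM h k x ≤ lam ∧ 1 ≤ ‖Tf h (γ' + ee i) x‖}} ≤ q ^ (N0 + 2) * lam := by
    intro x hx
    have hdm : ∀ u v : Fin 1 → K, ‖u‖ ≤ 1 → ‖v‖ ≤ 1 →
        TM h k (x + sg i (ρ * u 0)) ≤ lam → ‖x + sg i (ρ * v 0)‖ ≤ 1 →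
        TM h k (x + sg i (ρ * v 0)) ≤ lam → 1 ≤ ‖Tf h (γ' + ee i) (x + sg i (ρ * v 0))‖ →
        ‖u - v‖ ≤ lam / ‖ρ‖ := by
      intro u v hu1 hv1 hu3 hv2 hv3 hv4
      rw [le_div_iff₀ hρp]
      have ht : x + sg i (ρ * u 0) = (x + sg i (ρ * v 0)) + sg i (ρ * (u - v) 0) := by
        rw [add_assoc, ← sg_add]
        congr 2
        simp
        ring
      have huv : ‖u - v‖ ≤ 1 := by
        rw [sub_eq_add_neg]
        exact (IsUltrametricDist.norm_add_le_max _ _).trans (max_le hu1 (by rwa [norm_neg]))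
      have hw : ‖ρ * (u - v) 0‖ ≤ ‖ρ‖ := by
        rw [norm_mul, ← norm_fin1 (u - v)]
        exact mul_le_of_le_one_right hρp.le huv
      have hNz : ∀ γ'', deg γ' + 2 ≤ deg γ'' → ‖h γ'' (x + sg i (ρ * v 0))‖ ≤ (q : ℝ) ^ N0 := by
        intro γ'' h''
        have e1 := le_NM h (M := deg γ'') rfl (x + sg i (ρ * v 0))
        have e3 : k + 1 ≤ deg γ'' := by rw [hγ'] at h''; exact (Nat.le_succ _).trans h''
        have e2 := hN (x + sg i (ρ * v 0)) hv2 (deg γ'') e3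
        exact e1.trans e2.le
      have hlt : (q : ℝ) ^ N0 * ‖ρ * (u - v) 0‖ < ‖Tf h (γ' + ee i) (x + sg i (ρ * v 0))‖ :=
        lt_of_le_of_lt (mul_le_mul_of_nonneg_left hw (by positivity)) (hρG.trans_le hv4)
      have hz := exp1 H γ' i (x + sg i (ρ * v 0)) (ρ * (u - v) 0) (hw.trans hρ1) ((q : ℝ) ^ N0) (by positivity)
        hNz hlt
      rw [← ht, norm_mul, ← norm_fin1 (u - v)] at hz
      have hu3' := (le_TM h hγ' (x + sg i (ρ * u 0))).trans hu3
      have hv3' := (le_TM h hγ' (x + sg i (ρ * v 0))).trans hv3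
      rw [mul_comm]
      calc ‖ρ‖ * ‖u - v‖ ≤ ‖Tf h (γ' + ee i) (x + sg i (ρ * v 0))‖ * (‖ρ‖ * ‖u - v‖) :=
            le_mul_of_one_le_left (by positivity) hv4
        _ = _ := hz.symm
        _ ≤ lam := by
            rw [sub_eq_add_neg]
            exact (IsUltrametricDist.norm_add_le_max _ _).trans (max_le hu3' (by rwa [norm_neg]))
    have hr : 0 < lam / ‖ρ‖ := by positivity
    have hd := PP_diam' hK hP 1 {u | ‖u‖ ≤ 1 ∧ x + sg i (ρ * u 0) ∈
      {x | ‖x‖ ≤ 1 ∧ TM h k x ≤ lam ∧ 1 ≤ ‖Tf h (γ' + ee i) x‖}} hr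
      (fun u hu => hu.1) (fun u hu v hv => hdm u v hu.1 hv.1 hu.2.2.1 hv.2.1 hv.2.2.1 hv.2.2.2)
    rw [pow_one] at hd
    refine hd.trans (le_of_eq ?_)
    rw [hρ]
    field_simp
    ring
  have := PP_slice_le' hP (fun u : Fin 1 → K => sg i (ρ * u 0)) hφm hφ1 hmeasA
    MeasurableSet.univ (fun x u _ _ _ => Set.mem_univ _) (q ^ (N0 + 2) * lam) (by positivity)
    (fun x _ hx => hmain x hx)
  refine this.trans ?_
  simp

end
end VdC9
end

section
open MeasureTheory Filter VdC
open scoped NNReal ENNReal Classical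
namespace VdC9

/-- the tame estimate at level `k` with constants -/
def TameAt (n q k : ℕ) (G G' C : ℝ) : Prop :=
  ∀ (K : Type) [NontriviallyNormedField K] [MeasurableSpace K] [BorelSpace K] [SecondCountableTopology K]
    (_ : IsLocalField K q) (P : Measure K) (_ : IsUnif q P) (D : ℕ) (h : (Fin n → ℕ) → (Fin n → K) → K)
    (_ : TS D h) (_ : ∀ x, ‖x‖ ≤ 1 → 1 ≤ TM h k x)
    (_ : ∀ x, ‖x‖ ≤ 1 → ∀ m, k ≤ m → NM h m x ≤ G) (_ : 1 ≤ G' * ‖(k.factorial : K)‖) (y : K) (_ : y ≠ 0),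
    (PP P n).real (Bad h y) ≤ C * ‖y‖ ^ (-(1 : ℝ) / k)

section
variable {K : Type} [NontriviallyNormedField K] {q n : ℕ}

theorem real_le_of_ae [MeasurableSpace K] {P : Measure K} (hP : IsUnif q P) {A B : Set (Fin n → K)}
    (hAB : ∀ x, ‖x‖ ≤ 1 → x ∈ A → x ∈ B) : (PP P n).real A ≤ (PP P n).real B := by
  have := PP_prob hP n
  refine ENNReal.toReal_mono (measure_ne_top _ _) (measure_mono_ae ?_)
  filter_upwards [PP_supp hP n] with x hx hxl
  exact hAB x hx hxl

theorem tame_piece [MeasurableSpace K] {P : Measure K} [BorelSpace K] [SecondCountableTopology K]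
    (hK : IsLocalField K q) (hP : IsUnif q P) {D : ℕ} {h : (Fin n → ℕ) → (Fin n → K) → K} (H : TS D h) (k : ℕ)
    {G G' C0 : ℝ} (hC0 : 0 ≤ C0) (hG0 : 0 < G) (IH : TameAt n q k (max 1 G') G' C0)
    (hN : ∀ x, ‖x‖ ≤ 1 → ∀ m, k + 1 ≤ m → NM h m x ≤ G) (hG' : 1 ≤ G' * ‖(k.factorial : K)‖)
    (y ρ l : K) (hy : y ≠ 0) (hρ0 : ρ ≠ 0) (hρ1 : ‖ρ‖ ≤ 1) (hl : l ≠ 0) (hρl : G * ‖ρ‖ < ‖l‖) :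
    (PP P n).real (Bad h y ∩ {x | TM h k x = ‖l‖}) ≤
      (C0 * (‖y‖ * ‖l‖ * ‖ρ‖ ^ k) ^ (-(1 : ℝ) / k)) * (PP P n).real {x | TM h k x = ‖l‖} := by
  have := PP_prob hP n
  have := lf_ultra hK
  have hlp : 0 < ‖l‖ := norm_pos_iff.2 hl
  have hρp : 0 < ‖ρ‖ := norm_pos_iff.2 hρ0
  have hyp : 0 < ‖y‖ := norm_pos_iff.2 hy
  have hE : MeasurableSet {x | TM h k x = ‖l‖} :=
    measurableSet_eq_fun (TM_cont H k).measurable measurable_const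
  have hmul : ∀ u : Fin n → K, ‖u‖ ≤ 1 → ‖ρ • u‖ ≤ ‖ρ‖ := fun u hu => by
    rw [norm_smul]
    exact mul_le_of_le_one_right hρp.le hu
  have hsh : ∀ x u : Fin n → K, ‖x‖ ≤ 1 → ‖u‖ ≤ 1 → TM h k x = ‖l‖ → TM h k (x + ρ • u) = ‖l‖ := by
    intro x u hx hu hxl
    rw [TM_shift H k x (ρ • u) G hG0.le (hN x hx) ((hmul u hu).trans hρ1), hxl]
    rw [hxl]
    exact lt_of_le_of_lt (mul_le_mul_of_nonneg_left (hmul u hu) hG0.le) hρl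
  have hadd : ∀ x u : Fin n → K, ‖x‖ ≤ 1 → ‖u‖ ≤ 1 → ‖x + ρ • u‖ ≤ 1 := fun x u hx hu =>
    (IsUltrametricDist.norm_add_le_max _ _).trans (max_le hx ((hmul u hu).trans hρ1))
  refine PP_slice_le' hP (fun u : Fin n → K => ρ • u) (measurable_const_smul ρ)
    (fun u hu => (hmul u hu).trans hρ1) ((Bad_meas H y).inter hE) hE ?_ _ (by positivity) ?_
  · intro x u hx hu hxu
    have h1 : TM h k (x + ρ • u) = ‖l‖ := hxu.2
    have h2 := hsh (x + ρ • u) (-u) (hadd x u hx hu) (by rwa [norm_neg]) h1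
    have e : x + ρ • u + ρ • (-u) = x := by rw [smul_neg, add_neg_cancel_right]
    rw [e] at h2
    exact h2
  · intro x hxE hx
    have hxE' : TM h k x = ‖l‖ := hxE
    set c : K := (l * ρ ^ k)⁻¹ with hc
    have hc0 : c ≠ 0 := by rw [hc]; exact inv_ne_zero (mul_ne_zero hl (pow_ne_zero _ hρ0))
    have hcn : ‖c‖ = (‖l‖ * ‖ρ‖ ^ k)⁻¹ := by rw [hc, norm_inv, norm_mul, norm_pow]
    have hI := IH K hK P hP D (resc h x ρ c) (TS_scale H x ρ c) (by
      intro t ht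
      rw [TM_resc, hsh x t hx ht hxE', hcn]
      apply le_of_eq
      field_simp) (by
      intro t ht m hm
      rw [NM_resc, hcn]
      rcases hm.eq_or_lt with rfl | hm
      · refine le_trans ?_ (le_max_right _ _)
        have := NM_le_TM h k (x + ρ • t) hG'
        rw [hsh x t hx ht hxE'] at this
        calc (‖l‖ * ‖ρ‖ ^ k)⁻¹ * ‖ρ‖ ^ k * NM h k (x + ρ • t)
            ≤ (‖l‖ * ‖ρ‖ ^ k)⁻¹ * ‖ρ‖ ^ k * (G' * ‖l‖) := by gcongr
          _ = G' := by field_simp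
      · refine le_trans ?_ (le_max_left _ _)
        have := hN _ (hadd x t hx ht) m hm
        obtain ⟨d, rfl⟩ : ∃ d, m = k + 1 + d := ⟨m - (k + 1), by omega⟩
        calc (‖l‖ * ‖ρ‖ ^ k)⁻¹ * ‖ρ‖ ^ (k + 1 + d) * NM h (k + 1 + d) (x + ρ • t)
            ≤ (‖l‖ * ‖ρ‖ ^ k)⁻¹ * ‖ρ‖ ^ (k + 1 + d) * G := by gcongr
          _ = (G * ‖ρ‖) / ‖l‖ * ‖ρ‖ ^ d := by
              rw [pow_add, pow_add]
              field_simp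
          _ ≤ 1 * 1 := by
              refine mul_le_mul ?_ (pow_le_one₀ hρp.le hρ1) (by positivity) zero_le_one
              rw [div_le_one hlp]
              exact hρl.le
          _ = 1 := one_mul 1) hG' (y / c) (div_ne_zero hy hc0)
    have e : ‖y / c‖ = ‖y‖ * ‖l‖ * ‖ρ‖ ^ k := by
      rw [norm_div, hcn]
      field_simp
    rw [e] at hI
    refine le_trans ?_ hI
    refine measureReal_mono ?_ (measure_ne_top _ _)
    intro u hu
    exact Bad_resc h x ρ c y hρ1 hc0 u hu.2.1

theorem tame_base (n q : ℕ) (G G' : ℝ) : TameAt n q 1 G G' (max 1 G) := by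
  intro K _ _ _ _ hK P hP D h H hT hN _ y hy
  have := PP_prob hP n
  have hyp : 0 < ‖y‖ := norm_pos_iff.2 hy
  have hC : 0 < max 1 G := lt_of_lt_of_le one_pos (le_max_left _ _)
  have e : ‖y‖ ^ (-(1 : ℝ) / (1 : ℕ)) = ‖y‖⁻¹ := by
    rw [Nat.cast_one, div_one, Real.rpow_neg_one]
  rw [e]
  by_cases hy1 : ‖y‖ ≤ max 1 G
  · refine measureReal_le_one.trans ?_
    rwa [← div_eq_mul_inv, one_le_div hyp]
  · push Not at hy1
    have h0 : (PP P n).real (Bad h y) ≤ (PP P n).real (∅ : Set (Fin n → K)) := by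
      apply real_le_of_ae hP
      intro x hx hb
      exfalso
      have h1 := hT x hx
      rcases hb with hb | ⟨m, hm, hb⟩
      · have : ‖y‖ * 1 ≤ ‖y‖ * TM h 1 x := by gcongr
        have := le_max_left 1 G
        linarith
      · have h2 := hN x hx m (by omega)
        have h3 : ‖y‖ ≤ ‖y‖ ^ (m - 1) := le_self_pow₀ ((le_max_left _ _).trans hy1.le) (by omega)
        have h4 : ‖y‖ ^ (m - 1) * 1 ≤ ‖y‖ ^ (m - 1) * TM h 1 x ^ m := by
          gcongr
          exact one_le_pow₀ h1
        have := le_max_right 1 G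
        linarith
    refine h0.trans ?_
    rw [measureReal_empty]
    positivity

end
end VdC9
end

section
open MeasureTheory Filter VdC
open scoped NNReal ENNReal Classical
namespace VdC9

theorem geom_bound {θ : ℝ} (h0 : 0 ≤ θ) (h1 : θ < 1) (J : ℕ) :
    ∑ j ∈ Finset.range J, θ ^ j ≤ (1 - θ)⁻¹ := by
  rw [← tsum_geometric_of_lt_one h0 h1]
  exact (summable_geometric_of_lt_one h0 h1).sum_le_tsum _ (fun i _ => by positivity)

/-- the power inequality used in the geometric sum -/
theorem pow_ineq {Y s q L : ℝ} {k j : ℕ} (hk : 0 < k) (hY : 0 < Y) (hq : 1 < q)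
    (hs : s = Y ^ (-(1 : ℝ) / ((k + 1 : ℕ) : ℝ))) (hL : s * q ^ j ≤ L) :
    (Y * L) ^ (-(1 : ℝ) / k) ≤ s * (q ^ (-(1 : ℝ) / k)) ^ j := by
  have hs0 : 0 < s := by rw [hs]; positivity
  have hq0 : 0 < q := by linarith
  have hk' : (0 : ℝ) < k := by exact_mod_cast hk
  have hYs : Y = s ^ (-((k : ℝ) + 1)) := by
    rw [hs, ← Real.rpow_mul hY.le]
    have : (-(1 : ℝ) / ((k + 1 : ℕ) : ℝ)) * (-((k : ℝ) + 1)) = 1 := by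
      push_cast
      field_simp
    rw [this, Real.rpow_one]
  have h1 : (Y * L) ^ (-(1 : ℝ) / k) ≤ (Y * (s * q ^ j)) ^ (-(1 : ℝ) / k) := by
    apply Real.rpow_le_rpow_of_nonpos (by positivity) (by gcongr)
    rw [neg_div]
    have : (0:ℝ) < 1 / k := by positivity
    linarith
  refine h1.trans (le_of_eq ?_)
  have e1 : Y * (s * q ^ j) = s ^ (-(k : ℝ)) * q ^ j := by
    rw [hYs, ← mul_assoc]
    congr 1
    nth_rewrite 2 [← Real.rpow_one s]
    rw [← Real.rpow_add hs0]
    congr 1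
    ring
  rw [e1, Real.mul_rpow (by positivity) (by positivity), ← Real.rpow_mul hs0.le]
  congr 1
  · have : -(k : ℝ) * (-1 / k) = 1 := by field_simp
    rw [this, Real.rpow_one]
  · rw [← Real.rpow_natCast, ← Real.rpow_natCast, ← Real.rpow_mul hq0.le, ← Real.rpow_mul hq0.le, mul_comm]

theorem tame_step (n q k : ℕ) (hq : 1 < q) (hk : 0 < k) (G G' C0 : ℝ) (hC0 : 0 ≤ C0)
    (IH : TameAt n q k (max 1 G') G' C0) : ∃ C, 0 ≤ C ∧ TameAt n q (k + 1) G G' C := by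
  have hqr : (1 : ℝ) < q := by exact_mod_cast hq
  have hq0 : (0 : ℝ) < q := by linarith
  obtain ⟨N0, hN0⟩ := pow_unbounded_of_one_lt (max 1 G) hqr
  have hk' : (0 : ℝ) < k := by exact_mod_cast hk
  set θ : ℝ := (q : ℝ) ^ (-(1 : ℝ) / k) with hθ
  have hθ0 : 0 ≤ θ := by positivity
  have hθ1 : θ < 1 := Real.rpow_lt_one_of_one_lt_of_neg hqr (by
    rw [neg_div]
    have : (0:ℝ) < 1 / k := by positivity
    linarith)
  have hθi : 0 ≤ (1 - θ)⁻¹ := inv_nonneg.2 (by linarith)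
  set C1 : ℝ := ((Finset.univ : Finset (Fin n)).piAntidiag (k + 1)).card * (q : ℝ) ^ (N0 + 2) with hC1
  have hC10 : 0 ≤ C1 := by positivity
  set B : ℝ := C0 * (q : ℝ) ^ (N0 + 1) * C1 with hB
  have hB0 : 0 ≤ B := by positivity
  refine ⟨1 + C0 + (C1 + B * (1 - θ)⁻¹), by positivity, ?_⟩
  intro K _ _ _ _ hK P hP D h H hT hN hG' y hy
  have := PP_prob hP n
  have := lf_ultra hK
  have hyp : 0 < ‖y‖ := norm_pos_iff.2 hy
  have hG1 : (0:ℝ) < max 1 G := lt_of_lt_of_le one_pos (le_max_left _ _)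
  have hN' : ∀ x, ‖x‖ ≤ 1 → ∀ m, k + 1 ≤ m → NM h m x ≤ max 1 G := fun x hx m hm =>
    (hN x hx m hm).trans (le_max_right _ _)
  have hN2 : ∀ x, ‖x‖ ≤ 1 → ∀ m, k + 1 ≤ m → NM h m x < (q : ℝ) ^ N0 := fun x hx m hm =>
    (hN' x hx m hm).trans_lt hN0
  have hGk : 1 ≤ G' * ‖(k.factorial : K)‖ := by
    refine hG'.trans ?_
    have hG'0 : 0 ≤ G' := by
      by_contra hc
      push Not at hc
      have := mul_nonpos_of_nonpos_of_nonneg hc.le (norm_nonneg ((k + 1).factorial : K))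
      linarith
    exact mul_le_mul_of_nonneg_left (norm_dvd (Nat.factorial_dvd_factorial (Nat.le_succ k))) hG'0
  set s : ℝ := ‖y‖ ^ (-(1 : ℝ) / ((k + 1 : ℕ) : ℝ)) with hs
  have hs0 : 0 < s := by positivity
  by_cases hy1 : ‖y‖ ≤ 1
  · have h1 : 1 ≤ s := by
      apply Real.one_le_rpow_of_pos_of_le_one_of_nonpos hyp hy1
      rw [neg_div]
      have : (0:ℝ) < 1 / ((k + 1 : ℕ) : ℝ) := by positivity
      linarith
    refine measureReal_le_one.trans (h1.trans ?_)
    apply le_mul_of_one_le_left hs0.le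
    have : 0 ≤ B * (1 - θ)⁻¹ := by positivity
    linarith
  push Not at hy1
  have hBi : 0 ≤ B * (1 - θ)⁻¹ := by positivity
  by_cases hbig : ∃ x0, ‖x0‖ ≤ 1 ∧ (q : ℝ) ^ N0 ≤ TM h k x0
  · obtain ⟨x0, hx0, hb⟩ := hbig
    have hpos : 0 < TM h k x0 := lt_of_lt_of_le (by positivity) hb
    obtain ⟨γ, hγ, e⟩ := exists_TM h hpos
    have hl : Tf h γ x0 ≠ 0 := by
      rw [← norm_pos_iff, e]
      exact hpos
    have hp := tame_piece hK hP H k hC0 hG1 IH hN' hGk y 1 (Tf h γ x0) hy one_ne_zero (by simp) hl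
      (by rw [norm_one, mul_one, e]; exact hN0.trans_le hb)
    have h1 : (PP P n).real (Bad h y) ≤ (PP P n).real (Bad h y ∩ {x | TM h k x = ‖Tf h γ x0‖}) := by
      apply real_le_of_ae hP
      intro x hx hxb
      refine ⟨hxb, ?_⟩
      have hd : ‖x - x0‖ ≤ 1 := by
        rw [sub_eq_add_neg]
        exact (IsUltrametricDist.norm_add_le_max _ _).trans (max_le hx (by rwa [norm_neg]))
      have h2 := TM_shift H k x0 (x - x0) (max 1 G) hG1.le (hN' x0 hx0) hd
        (lt_of_le_of_lt (mul_le_of_le_one_right hG1.le hd) (hN0.trans_le hb))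
      rw [add_sub_cancel] at h2
      have : TM h k x = ‖Tf h γ x0‖ := by rw [h2, e]
      exact this
    refine h1.trans (hp.trans ?_)
    have h3 : (‖y‖ * ‖Tf h γ x0‖ * ‖(1 : K)‖ ^ k) ^ (-(1 : ℝ) / k) ≤ s := by
      rw [norm_one, one_pow, mul_one]
      have hone : 1 ≤ ‖Tf h γ x0‖ := by
        rw [e]
        exact (one_le_pow₀ hqr.le).trans hb
      have hneg : -(1 : ℝ) / k ≤ -(1 : ℝ) / ((k + 1 : ℕ) : ℝ) := by
        rw [neg_div, neg_div, neg_le_neg_iff]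
        apply one_div_le_one_div_of_le hk'
        push_cast
        linarith
      calc (‖y‖ * ‖Tf h γ x0‖) ^ (-(1 : ℝ) / k) ≤ ‖y‖ ^ (-(1 : ℝ) / k) := by
            apply Real.rpow_le_rpow_of_nonpos hyp
            · exact le_mul_of_one_le_right hyp.le hone
            · rw [neg_div]
              have : (0:ℝ) < 1 / k := by positivity
              linarith
        _ ≤ s := Real.rpow_le_rpow_of_exponent_le hy1.le hneg
    calc _ ≤ (C0 * s) * 1 := by
          gcongr
          exact measureReal_le_one
      _ ≤ _ := by
          rw [mul_one]
          gcongr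
          linarith
  · push Not at hbig
    obtain ⟨z0, hz1, hz2⟩ := exists_mem_Ico_zpow hs0 hqr
    -- the number of dyadic layers
    set J : ℕ := ((N0 : ℤ) - z0).toNat with hJ
    have hlj : ∀ j : ℕ, ∃ l : K, l ≠ 0 ∧ ‖l‖ = (q : ℝ) ^ (z0 + 1 + j) := fun j => exists_norm_zpow hK _
    choose l hl0 hl using hlj
    have hcover : (PP P n).real (Bad h y) ≤ (PP P n).real ({x | TM h k x ≤ s} ∪
        ⋃ j ∈ Finset.range J, (Bad h y ∩ {x | TM h k x = ‖l j‖})) := by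
      apply real_le_of_ae hP
      intro x hx hxb
      by_cases hxs : TM h k x ≤ s
      · exact Or.inl hxs
      · right
        push Not at hxs
        obtain ⟨γ, hγ, e⟩ := exists_TM h (hs0.trans hxs)
        have hne : Tf h γ x ≠ 0 := by
          rw [← norm_pos_iff, e]
          exact hs0.trans hxs
        obtain ⟨w, hw⟩ := hK.discrete _ hne
        rw [e] at hw
        have hw1 : z0 < w := by
          have : (q : ℝ) ^ z0 < (q : ℝ) ^ w := by rw [← hw]; exact hz1.trans_lt hxs
          exact (zpow_lt_zpow_iff_right₀ hqr).1 this
        have hw2 : w < N0 := by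
          have := hbig x hx
          rw [hw, ← zpow_natCast] at this
          exact (zpow_lt_zpow_iff_right₀ hqr).1 this
        refine Set.mem_iUnion₂.2 ⟨(w - (z0 + 1)).toNat, ?_, hxb, ?_⟩
        · rw [Finset.mem_range]
          omega
        · have : TM h k x = ‖l (w - (z0 + 1)).toNat‖ := by
            rw [hl, hw]
            congr 1
            omega
          exact this
    refine hcover.trans ((measureReal_union_le _ _).trans ?_)
    have hA := tame_dens hK hP H k N0 hT hN2 hs0
    rw [← hC1] at hA
    have hterm : ∀ j ∈ Finset.range J, (PP P n).real (Bad h y ∩ {x | TM h k x = ‖l j‖}) ≤ B * s * θ ^ j := by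
      intro j hj
      rw [Finset.mem_range] at hj
      obtain ⟨ρ, hρ0, hρ⟩ := exists_norm_zpow hK (z0 + 1 + j - (N0 + 1))
      have hlp : 0 < ‖l j‖ := norm_pos_iff.2 (hl0 j)
      have hρ' : ‖ρ‖ = ‖l j‖ * ((q : ℝ) ^ (N0 + 1))⁻¹ := by
        rw [hρ, hl, zpow_sub₀ hq0.ne', div_eq_mul_inv]
        norm_cast
      have hρ1 : ‖ρ‖ ≤ 1 := by
        rw [hρ]
        apply zpow_le_one_of_nonpos₀ hqr.le
        omega
      have hlt : max 1 G * ‖ρ‖ < ‖l j‖ := by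
        rw [hρ', mul_left_comm]
        apply mul_lt_of_lt_one_right hlp
        rw [← div_eq_mul_inv, div_lt_one (by positivity)]
        exact hN0.trans_le (pow_le_pow_right₀ hqr.le (by omega))
      have hp := tame_piece hK hP H k hC0 hG1 IH hN' hGk y ρ (l j) hy hρ0 hρ1 (hl0 j) hlt
      have hE : (PP P n).real {x | TM h k x = ‖l j‖} ≤ C1 * ‖l j‖ := by
        refine le_trans (measureReal_mono ?_ (measure_ne_top _ _)) (tame_dens hK hP H k N0 hT hN2 hlp)
        intro x hx
        exact le_of_eq hx
      have hL : s * (q : ℝ) ^ j ≤ ‖l j‖ := by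
        rw [hl, zpow_add₀ hq0.ne', zpow_natCast]
        gcongr
      have hpw := pow_ineq hk hyp hqr hs hL
      rw [← hθ] at hpw
      have hρp : 0 < ‖ρ‖ := norm_pos_iff.2 hρ0
      have e2 : (‖y‖ * ‖l j‖ * ‖ρ‖ ^ k) ^ (-(1 : ℝ) / k) = (‖y‖ * ‖l j‖) ^ (-(1 : ℝ) / k) * ‖ρ‖⁻¹ := by
        rw [Real.mul_rpow (by positivity) (by positivity), ← Real.rpow_natCast, ← Real.rpow_mul hρp.le]
        have : (k : ℝ) * (-1 / k) = -1 := by field_simp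
        rw [this, Real.rpow_neg_one]
      refine hp.trans ?_
      rw [e2]
      calc C0 * ((‖y‖ * ‖l j‖) ^ (-(1 : ℝ) / k) * ‖ρ‖⁻¹) * (PP P n).real {x | TM h k x = ‖l j‖}
          ≤ C0 * ((s * θ ^ j) * ‖ρ‖⁻¹) * (C1 * ‖l j‖) := by gcongr
        _ = B * s * θ ^ j := by
            rw [hρ', hB]
            field_simp
    have hsum := (measureReal_biUnion_finset_le (μ := PP P n) (Finset.range J)
      (fun j => Bad h y ∩ {x | TM h k x = ‖l j‖})).trans (Finset.sum_le_sum hterm)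
    rw [← Finset.mul_sum] at hsum
    have hg := geom_bound hθ0 hθ1 J
    calc _ ≤ C1 * s + B * s * (1 - θ)⁻¹ := by
          refine add_le_add hA (hsum.trans ?_)
          gcongr
      _ = (C1 + B * (1 - θ)⁻¹) * s := by ring
      _ ≤ _ := mul_le_mul_of_nonneg_right (by linarith) hs0.le

theorem tame (n q k : ℕ) (hq : 1 < q) (hk : 0 < k) (G G' : ℝ) : ∃ C, 0 ≤ C ∧ TameAt n q k G G' C := by
  induction k, hk using Nat.le_induction generalizing G with
  | base => exact ⟨max 1 G, zero_le_one.trans (le_max_left _ _), tame_base n q G G'⟩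
  | succ k hk ih =>
    obtain ⟨C0, h0, h1⟩ := ih (max 1 G')
    exact tame_step n q k hq hk G G' C0 h0 h1

end VdC9
end

section
open MeasureTheory Filter VdC
open scoped NNReal ENNReal Classical
namespace VdC9

theorem alg_rel {K : Type} [Field K] {m D d : ℕ} (hd : (m * D + 1) ^ m < d)
    (Φ : Fin m → MvPolynomial (Fin m) K) (hΦ : ∀ j, (Φ j).totalDegree ≤ D) (i : Fin m) :
    ∃ ρ : (Fin m → Fin d) × Fin d → K, ρ ≠ 0 ∧
      ∑ p, ρ p • ((∏ j, Φ j ^ (p.1 j : ℕ)) * MvPolynomial.X i ^ (p.2 : ℕ)) = 0 := by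
  set E : ℕ := (d - 1) * (m * D + 1) with hE
  set v : (Fin m → Fin d) × Fin d → MvPolynomial (Fin m) K :=
    fun p => (∏ j, Φ j ^ (p.1 j : ℕ)) * MvPolynomial.X i ^ (p.2 : ℕ) with hv
  have hdeg : ∀ p, (v p).totalDegree ≤ E := by
    intro p
    refine (MvPolynomial.totalDegree_mul _ _).trans ?_
    have h1 : (∏ j, Φ j ^ (p.1 j : ℕ)).totalDegree ≤ ∑ j : Fin m, (d - 1) * D := by
      refine (MvPolynomial.totalDegree_finsetProd _ _).trans (Finset.sum_le_sum fun j _ => ?_)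
      refine (MvPolynomial.totalDegree_pow _ _).trans ?_
      exact Nat.mul_le_mul (by have := (p.1 j).2; omega) (hΦ j)
    have h2 : (MvPolynomial.X i ^ (p.2 : ℕ) : MvPolynomial (Fin m) K).totalDegree ≤ d - 1 := by
      rw [MvPolynomial.totalDegree_X_pow]
      have := p.2.2; omega
    simp only [Finset.sum_const, Finset.card_univ, Fintype.card_fin, smul_eq_mul] at h1
    calc _ ≤ m * ((d - 1) * D) + (d - 1) := add_le_add h1 h2
      _ = E := by rw [hE]; ring
  set w : (Fin m → Fin d) × Fin d → ((Fin m → Fin (E + 1)) → K) :=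
    fun p e => (v p).coeff (Finsupp.equivFunOnFinite.symm fun j => (e j : ℕ)) with hw
  have hnl : ¬ LinearIndependent K w := by
    intro hl
    have := hl.fintype_card_le_finrank
    simp only [Fintype.card_prod, Fintype.card_pi, Fintype.card_fin, Finset.prod_const,
      Finset.card_univ, Module.finrank_fintype_fun_eq_card] at this
    have h3 : E + 1 ≤ d * (m * D + 1) := by
      have : 1 ≤ d := by omega
      have h4 : d = (d - 1) + 1 := by omega
      calc E + 1 ≤ (d - 1) * (m * D + 1) + (m * D + 1) := by rw [hE]; omega
        _ = ((d - 1) + 1) * (m * D + 1) := by ring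
        _ = _ := by rw [← h4]
    have h5 : (E + 1) ^ m ≤ d ^ m * (m * D + 1) ^ m := by
      rw [← mul_pow]; exact Nat.pow_le_pow_left h3 m
    have h6 : d ^ m * (m * D + 1) ^ m < d ^ m * d :=
      Nat.mul_lt_mul_of_pos_left hd (Nat.pow_pos (by omega))
    omega
  obtain ⟨ρ, hρ, p, hp⟩ := Fintype.not_linearIndependent_iff.1 hnl
  refine ⟨ρ, fun h => hp (by rw [h]; rfl), ?_⟩
  ext e
  rw [MvPolynomial.coeff_sum, MvPolynomial.coeff_zero]
  by_cases he : ∀ j, e j < E + 1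
  · have := congrFun hρ (fun j => ⟨e j, he j⟩)
    rw [Finset.sum_apply] at this
    rw [← Pi.zero_apply (M := fun _ => K), ← this]
    refine Finset.sum_congr rfl fun p _ => ?_
    rw [MvPolynomial.coeff_smul, Pi.smul_apply]
    congr 2
    ext j; simp
  · push Not at he
    obtain ⟨j, hj⟩ := he
    refine Finset.sum_eq_zero fun p _ => ?_
    rw [MvPolynomial.coeff_smul]
    have : MvPolynomial.coeff e (v p) = 0 := by
      by_contra h0
      have h1 := MvPolynomial.le_totalDegree (MvPolynomial.mem_support_iff.2 h0)
      have h2 : e j ≤ e.sum fun _ n => n := by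
        rw [Finsupp.sum_fintype _ _ (by simp)]
        exact Finset.single_le_sum (f := fun j => e j) (fun _ _ => Nat.zero_le _) (Finset.mem_univ j)
      have := hdeg p
      omega
    rw [show ((∏ j, Φ j ^ (p.1 j : ℕ)) * MvPolynomial.X i ^ (p.2 : ℕ)) = v p from rfl, this, smul_zero]

theorem alg_fib {K : Type} [NontriviallyNormedField K] {m D d : ℕ} (hd : (m * D + 1) ^ m < d)
    (Φ : Fin m → MvPolynomial (Fin m) K) (hΦ : ∀ j, (Φ j).totalDegree ≤ D)
    (c0 : Fin m → K) {r : ℝ} (hr : 0 < r) :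
    ∃ c : Fin m → K, ‖c - c0‖ ≤ r ∧ ∃ Fs : Finset (Fin m → K), Fs.card ≤ d ^ m ∧
      ∀ u, (∀ j, MvPolynomial.eval u (Φ j) = c j) → u ∈ Fs := by
  have hd0 : 0 < d := by omega
  choose ρ hρ0 hρ using fun i => alg_rel hd Φ hΦ i
  have hex : ∀ i, ∃ p, ρ i p ≠ 0 := by
    intro i
    by_contra h
    push Not at h
    exact hρ0 i (funext h)
  choose p hp using hex
  set R : Fin m → MvPolynomial (Fin m) K := fun i => ∑ b : Fin m → Fin d,
    MvPolynomial.monomial (Finsupp.equivFunOnFinite.symm fun j => (b j : ℕ)) (ρ i (b, (p i).2)) with hR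
  have hR0 : ∀ i, R i ≠ 0 := by
    intro i h0
    have := congrArg (MvPolynomial.coeff (Finsupp.equivFunOnFinite.symm fun j => ((p i).1 j : ℕ))) h0
    rw [hR, MvPolynomial.coeff_sum, MvPolynomial.coeff_zero, Finset.sum_eq_single (p i).1] at this
    · rw [MvPolynomial.coeff_monomial, if_pos rfl] at this
      exact hp i this
    · intro b _ hb
      rw [MvPolynomial.coeff_monomial, if_neg]
      intro h
      apply hb
      have h2 := Finsupp.equivFunOnFinite.symm.injective h
      ext j
      exact congrFun h2 j
    · simp
  have hRe : ∀ i c, MvPolynomial.eval c (R i) = ∑ b : Fin m → Fin d, ρ i (b, (p i).2) * ∏ j, c j ^ (b j : ℕ) := by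
    intro i c
    rw [hR, map_sum]
    refine Finset.sum_congr rfl fun b _ => ?_
    rw [MvPolynomial.eval_monomial, Finsupp.prod_fintype _ _ (by simp)]
    rfl
  have hP0 : ∏ i, R i ≠ 0 := Finset.prod_ne_zero_iff.2 fun i _ => hR0 i
  have hc : ∃ c : Fin m → K, ‖c - c0‖ ≤ r ∧ MvPolynomial.eval c (∏ i, R i) ≠ 0 := by
    by_contra h
    push Not at h
    apply hP0
    refine MvPolynomial.funext_set (fun i => Metric.closedBall (c0 i) r)
      (fun i => infinite_of_mem_nhds (c0 i) (Metric.closedBall_mem_nhds _ hr)) fun x hx => ?_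
    rw [map_zero]
    apply h
    rw [pi_norm_le_iff_of_nonneg hr.le]
    intro i
    have := hx i (Set.mem_univ i)
    rwa [mem_closedBall_iff_norm] at this
  obtain ⟨c, hcr, hcP⟩ := hc
  refine ⟨c, hcr, ?_⟩
  rw [map_prod] at hcP
  set Q : Fin m → Polynomial K := fun i => ∑ a : Fin d, Polynomial.monomial (a : ℕ)
    (∑ b : Fin m → Fin d, ρ i (b, a) * ∏ j, c j ^ (b j : ℕ)) with hQ
  have hQ0 : ∀ i, Q i ≠ 0 := by
    intro i h0
    have := congrArg (fun P => Polynomial.coeff P ((p i).2 : ℕ)) h0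
    simp only [hQ, Polynomial.finsetSum_coeff, Polynomial.coeff_zero, Polynomial.coeff_monomial] at this
    rw [Finset.sum_eq_single (p i).2] at this
    · rw [if_pos rfl, ← hRe] at this
      exact (Finset.prod_ne_zero_iff.1 hcP) i (Finset.mem_univ i) this
    · intro b _ hb
      rw [if_neg]
      intro h
      exact hb (Fin.ext h)
    · simp
  have hQd : ∀ i, (Q i).natDegree ≤ d := by
    intro i
    refine Polynomial.natDegree_sum_le_of_forall_le _ _ fun a _ => ?_
    exact (Polynomial.natDegree_monomial_le _).trans a.2.le
  refine ⟨Fintype.piFinset fun i => (Q i).roots.toFinset, ?_, ?_⟩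
  · rw [Fintype.card_piFinset]
    calc _ ≤ ∏ i : Fin m, d := Finset.prod_le_prod (fun _ _ => Nat.zero_le _) fun i _ =>
          ((Q i).roots.toFinset_card_le).trans (((Q i).card_roots').trans (hQd i))
      _ = d ^ m := by simp
  · intro u hu
    rw [Fintype.mem_piFinset]
    intro i
    rw [Multiset.mem_toFinset, Polynomial.mem_roots (hQ0 i), Polynomial.IsRoot.def, hQ,
      Polynomial.eval_finsetSum]
    have := congrArg (MvPolynomial.eval u) (hρ i)
    rw [map_sum, map_zero, Fintype.sum_prod_type, Finset.sum_comm] at this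
    rw [← this]
    refine Finset.sum_congr rfl fun a _ => ?_
    rw [Polynomial.eval_monomial, Finset.sum_mul]
    refine Finset.sum_congr rfl fun b _ => ?_
    rw [MvPolynomial.smul_eval, map_mul, map_prod, map_pow, MvPolynomial.eval_X, ← mul_assoc]
    simp only [map_pow, hu]

end VdC9
end

section
open MeasureTheory Filter VdC
open scoped NNReal ENNReal Classical
namespace VdC9
variable {K : Type} [NontriviallyNormedField K] {q m : ℕ}

theorem um_sub {E : Type*} [SeminormedAddCommGroup E] [IsUltrametricDist E] (a b : E) :
    ‖a - b‖ ≤ max ‖a‖ ‖b‖ := by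
  rw [sub_eq_add_neg, ← norm_neg b]
  exact IsUltrametricDist.norm_add_le_max _ _

theorem um_eq {E : Type*} [SeminormedAddCommGroup E] [IsUltrametricDist E] {a b : E}
    (h : ‖a - b‖ < ‖b‖) : ‖a‖ = ‖b‖ := by
  have e : a = (a - b) + b := by abel
  rw [e, IsUltrametricDist.norm_add_eq_max_of_norm_ne_norm h.ne, max_eq_right h.le]

theorem loc_inv (hK : IsLocalField K q) (F : (Fin m → K) → (Fin m → K)) (u c : Fin m → K)
    (L : (Fin m → K) →ₗ[K] (Fin m → K)) {Λ ε r : ℝ} (hΛ : 0 < Λ) (hr : 0 ≤ r) (hε0 : 0 ≤ ε) (hε : ε < Λ)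
    (hL : ∀ t, ‖L t‖ = Λ * ‖t‖)
    (hF : ∀ t t', ‖t‖ ≤ r → ‖t'‖ ≤ r → ‖F (u + t') - F (u + t) - L (t' - t)‖ ≤ ε * ‖t' - t‖)
    (hc : ‖c - F u‖ ≤ Λ * r) : ∃ t, ‖t‖ ≤ r ∧ F (u + t) = c := by
  have := lf_ultra hK
  have := hK.complete
  have hinj : Function.Injective L := by
    rw [injective_iff_map_eq_zero]
    intro t ht
    have := hL t
    rw [ht, norm_zero] at this
    rcases mul_eq_zero.1 this.symm with h | h
    · linarith
    · exact norm_eq_zero.1 h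
  set e := LinearEquiv.ofInjectiveEndo L hinj with he
  have hee : ∀ t, L (e.symm t) = t := fun t => by
    exact e.apply_symm_apply t
  have hen : ∀ t, ‖e.symm t‖ = Λ⁻¹ * ‖t‖ := by
    intro t
    have := hL (e.symm t)
    rw [hee] at this
    rw [this]; field_simp
  set g : (Fin m → K) → (Fin m → K) := fun t => e.symm (c - F (u + t) + L t) with hg
  have hmaps : Set.MapsTo g (Metric.closedBall 0 r) (Metric.closedBall 0 r) := by
    intro t ht
    rw [mem_closedBall_zero_iff] at ht ⊢
    rw [hg]
    simp only
    rw [hen]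
    have h1 : c - F (u + t) + L t = (c - F u) - (F (u + t) - F (u + 0) - L (t - 0)) := by
      rw [add_zero, sub_zero]; abel
    have h2 := hF 0 t (by simpa using hr) ht
    have h3 : ‖c - F (u + t) + L t‖ ≤ Λ * r := by
      rw [h1]
      refine (um_sub _ _).trans (max_le hc (h2.trans ?_))
      rw [sub_zero]
      exact mul_le_mul hε.le ht (norm_nonneg _) hΛ.le
    calc Λ⁻¹ * ‖c - F (u + t) + L t‖ ≤ Λ⁻¹ * (Λ * r) := by gcongr
      _ = r := by field_simp
  have hθ : ε / Λ < 1 := by rwa [div_lt_one hΛ]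
  have hcw : ContractingWith (⟨ε / Λ, by positivity⟩ : ℝ≥0) (hmaps.restrict g _ _) := by
    refine ⟨by exact_mod_cast hθ, LipschitzWith.of_dist_le_mul ?_⟩
    rintro ⟨t, ht⟩ ⟨t', ht'⟩
    rw [mem_closedBall_zero_iff] at ht ht'
    change dist (g t) (g t') ≤ ε / Λ * dist t t'
    rw [dist_eq_norm, dist_eq_norm, hg]
    simp only
    rw [← map_sub, hen]
    have h1 : c - F (u + t) + L t - (c - F (u + t') + L t') = F (u + t') - F (u + t) - L (t' - t) := by
      rw [map_sub]; abel
    rw [h1, norm_sub_rev t t']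
    calc _ ≤ Λ⁻¹ * (ε * ‖t' - t‖) := by gcongr; exact hF t t' ht ht'
      _ = _ := by ring
  obtain ⟨t, ht, hfix, -⟩ := hcw.exists_fixedPoint' (Metric.isClosed_closedBall.isComplete) hmaps
    (x := 0) (by simpa using hr) (edist_ne_top _ _)
  refine ⟨t, by simpa using ht, ?_⟩
  have h1 : L (g t) = L t := by rw [hfix]
  rw [hg] at h1
  simp only at h1
  rw [hee] at h1
  have h2 : c - F (u + t) = 0 := by
    have := congrArg (fun z => z - L t) h1
    simpa using this
  exact (sub_eq_zero.1 h2).symm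

theorem loc_lower (hK : IsLocalField K q) (F : (Fin m → K) → (Fin m → K)) (u : Fin m → K)
    (L : (Fin m → K) →ₗ[K] (Fin m → K)) {Λ ε r : ℝ} (hε : ε < Λ)
    (hL : ∀ t, ‖L t‖ = Λ * ‖t‖)
    (hF : ∀ t t', ‖t‖ ≤ r → ‖t'‖ ≤ r → ‖F (u + t') - F (u + t) - L (t' - t)‖ ≤ ε * ‖t' - t‖)
    (hr : 0 ≤ r) (v : Fin m → K) (hv : ‖v - u‖ ≤ r) : Λ * ‖v - u‖ ≤ ‖F v - F u‖ := by
  have := lf_ultra hK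
  by_cases h0 : v = u
  · simp [h0]
  have hpos : 0 < ‖v - u‖ := norm_pos_iff.2 (sub_ne_zero.2 h0)
  have h := hF 0 (v - u) (by simpa using hr) hv
  rw [add_zero, sub_zero, add_sub_cancel] at h
  have h2 : ‖F v - F u - L (v - u)‖ < ‖L (v - u)‖ := by
    rw [hL]; exact h.trans_lt (by gcongr)
  have := um_eq h2
  rw [this, hL]

theorem coarea (hK : IsLocalField K q) [MeasurableSpace K] [BorelSpace K] [SecondCountableTopology K]
    {P : Measure K} (hP : IsUnif q P) {D d : ℕ} (hd : (m * D + 1) ^ m < d)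
    (Φ : Fin m → MvPolynomial (Fin m) K) (hΦ : ∀ j, (Φ j).totalDegree ≤ D)
    (F : (Fin m → K) → (Fin m → K)) (hFΦ : ∀ u j, F u j = MvPolynomial.eval u (Φ j))
    (A : Set (Fin m → K)) (hA1 : ∀ u ∈ A, ‖u‖ ≤ 1) {δ Λ C : ℝ} (hδ : 0 < δ) (hΛ : 0 < Λ) (hC : 0 ≤ C)
    (hAδ : ∀ u ∈ A, ‖F u‖ ≤ δ)
    (hL : ∀ u ∈ A, ∃ L : (Fin m → K) →ₗ[K] (Fin m → K), (∀ t, ‖L t‖ = Λ * ‖t‖) ∧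
      ∀ t t', ‖t‖ ≤ 1 → ‖t'‖ ≤ 1 →
        ‖F (u + t') - F (u + t) - L (t' - t)‖ ≤ C * max ‖t‖ ‖t'‖ * ‖t' - t‖) :
    (PP P m).real A ≤ d ^ m * (q ^ 2 * δ / Λ) ^ m := by
  have := lf_ultra hK
  have hprob := PP_prob hP m
  have hq1 := lf_q1 hK
  have hq0 : (0:ℝ) < q := by linarith
  have hqi : (q:ℝ)⁻¹ < 1 := inv_lt_one_of_one_lt₀ hq1
  have hqi0 : (0:ℝ) < (q:ℝ)⁻¹ := by positivity
  obtain ⟨N, hN⟩ := exists_pow_lt_of_lt_one (show 0 < Λ / (C + 1) by positivity) hqi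
  set r : ℝ := (q:ℝ)⁻¹ ^ N with hr
  have hr0 : 0 < r := by positivity
  have hr1 : r ≤ 1 := pow_le_one₀ hqi0.le hqi.le
  have hCr : C * r < Λ := by
    rw [lt_div_iff₀ (by positivity)] at hN
    nlinarith
  have hL' : ∀ u ∈ A, ∃ L : (Fin m → K) →ₗ[K] (Fin m → K), (∀ t, ‖L t‖ = Λ * ‖t‖) ∧
      ∀ t t', ‖t‖ ≤ r → ‖t'‖ ≤ r →
        ‖F (u + t') - F (u + t) - L (t' - t)‖ ≤ (C * r) * ‖t' - t‖ := by
    intro u hu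
    obtain ⟨L, h1, h2⟩ := hL u hu
    refine ⟨L, h1, fun t t' ht ht' => (h2 t t' (ht.trans hr1) (ht'.trans hr1)).trans ?_⟩
    gcongr
    exact max_le ht ht'
  obtain ⟨e, -, he1, he2⟩ := exists_norm_between hK hδ
  have he0 : 0 < ‖e‖ := hδ.trans_le he1
  obtain ⟨N', hN'⟩ := exists_pow_lt_of_lt_one (show 0 < Λ * r / ‖e‖ by positivity) hqi
  set ε : ℝ := ‖e‖ * (q:ℝ)⁻¹ ^ N' with hε
  have hε0 : 0 < ε := by positivity
  have hεr : ε ≤ Λ * r := by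
    rw [lt_div_iff₀ he0] at hN'
    rw [hε, mul_comm]; exact hN'.le
  obtain ⟨S, hScard, hS1, hS⟩ := exists_reps hK N'
  choose c hc Fs hFcard hFs using fun τ : Fin m → K => alg_fib hd Φ hΦ (e • τ) hε0
  set B : (Fin m → K) → (Fin m → K) → Set (Fin m → K) := fun τ v =>
    {u | u ∈ A ∧ ‖u - v‖ ≤ r ∧ ‖F u - e • τ‖ ≤ ε} with hB
  set TT : Finset (Fin m → K) := Fintype.piFinset fun _ => S with hTT
  have hcov : A ⊆ ⋃ τ ∈ TT, ⋃ v ∈ Fs τ, B τ v := by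
    intro u hu
    have hex : ∀ j, ∃ s ∈ S, ‖e⁻¹ * F u j - s‖ ≤ (q:ℝ)⁻¹ ^ N' := by
      intro j
      have h1 : ‖e⁻¹ * F u j‖ ≤ 1 := by
        rw [norm_mul, norm_inv, inv_mul_le_iff₀ he0, mul_one]
        exact (norm_le_pi_norm (F u) j).trans ((hAδ u hu).trans he1)
      obtain ⟨s, ⟨hs1, hs2⟩, -⟩ := hS _ h1
      exact ⟨s, hs1, hs2⟩
    choose τ hτS hτ using hex
    have hτF : ‖F u - e • τ‖ ≤ ε := by
      rw [pi_norm_le_iff_of_nonneg hε0.le]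
      intro j
      have he : e ≠ 0 := norm_pos_iff.1 he0
      have : (F u - e • τ) j = e * (e⁻¹ * F u j - τ j) := by
        simp only [Pi.sub_apply, Pi.smul_apply, smul_eq_mul]
        field_simp
      rw [this, norm_mul]
      exact mul_le_mul_of_nonneg_left (hτ j) he0.le
    obtain ⟨L, hL1, hL2⟩ := hL' u hu
    have hcF : ‖c τ - F u‖ ≤ Λ * r := by
      have : c τ - F u = (c τ - e • τ) - (F u - e • τ) := by abel
      rw [this]
      exact (um_sub _ _).trans (max_le ((hc τ).trans hεr) (hτF.trans hεr))
    obtain ⟨t, ht, hFt⟩ := loc_inv hK F u (c τ) L hΛ hr0.le (by positivity) hCr hL1 hL2 hcF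
    refine Set.mem_iUnion₂.2 ⟨τ, ?_, Set.mem_iUnion₂.2 ⟨u + t, ?_, hu, ?_, hτF⟩⟩
    · rw [hTT, Fintype.mem_piFinset]; exact hτS
    · apply hFs τ
      intro j
      rw [← hFΦ, hFt]
    · rw [sub_add_cancel_left, norm_neg]; exact ht
  have hBm : ∀ τ v, (PP P m).real (B τ v) ≤ (q * (ε / Λ)) ^ m := by
    intro τ v
    refine PP_diam' hK hP m _ (by positivity) (fun u hu => hA1 u hu.1) ?_
    intro u hu u' hu'
    obtain ⟨L, hL1, hL2⟩ := hL' u' hu'.1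
    have h1 : ‖u - u'‖ ≤ r := by
      have : u - u' = (u - v) - (u' - v) := by abel
      rw [this]
      exact (um_sub _ _).trans (max_le hu.2.1 hu'.2.1)
    have h2 := loc_lower hK F u' L hCr hL1 hL2 hr0.le u h1
    have h3 : ‖F u - F u'‖ ≤ ε := by
      have : F u - F u' = (F u - e • τ) - (F u' - e • τ) := by abel
      rw [this]
      exact (um_sub _ _).trans (max_le hu.2.2 hu'.2.2)
    rw [le_div_iff₀ hΛ, mul_comm]
    exact h2.trans h3
  calc (PP P m).real A ≤ (PP P m).real (⋃ τ ∈ TT, ⋃ v ∈ Fs τ, B τ v) :=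
        measureReal_mono hcov (measure_ne_top _ _)
    _ ≤ ∑ τ ∈ TT, (PP P m).real (⋃ v ∈ Fs τ, B τ v) := measureReal_biUnion_finset_le _ _
    _ ≤ ∑ τ ∈ TT, ∑ v ∈ Fs τ, (PP P m).real (B τ v) :=
        Finset.sum_le_sum fun τ _ => measureReal_biUnion_finset_le _ _
    _ ≤ ∑ τ ∈ TT, ∑ v ∈ Fs τ, (q * (ε / Λ)) ^ m :=
        Finset.sum_le_sum fun τ _ => Finset.sum_le_sum fun v _ => hBm τ v
    _ ≤ ∑ τ ∈ TT, (d:ℝ) ^ m * (q * (ε / Λ)) ^ m := by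
        refine Finset.sum_le_sum fun τ _ => ?_
        rw [Finset.sum_const, nsmul_eq_mul]
        gcongr
        exact_mod_cast hFcard τ
    _ = ((q:ℝ) ^ N') ^ m * (d ^ m * (q * (ε / Λ)) ^ m) := by
        rw [Finset.sum_const, nsmul_eq_mul, hTT, Fintype.card_piFinset]
        simp [hScard]
    _ = d ^ m * (q * ‖e‖ / Λ) ^ m := by
        rw [mul_left_comm, ← mul_pow]
        congr 2
        rw [hε, inv_pow]
        field_simp
    _ ≤ d ^ m * (q ^ 2 * δ / Λ) ^ m := by
        have : (q:ℝ) * ‖e‖ ≤ q ^ 2 * δ := by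
          rw [pow_two, mul_assoc]
          gcongr
        gcongr

end VdC9
end

section
open MeasureTheory Filter VdC
open scoped NNReal ENNReal Classical
namespace VdC9
variable {K : Type} [NontriviallyNormedField K] {q m n : ℕ}

/-- embedding of a coordinate slice -/
def emb (ι : Fin m → Fin n) (u : Fin m → K) : Fin n → K := fun i => ∑ b, if ι b = i then u b else 0

theorem emb_add (ι : Fin m → Fin n) (u v : Fin m → K) : emb ι (u + v) = emb ι u + emb ι v := by
  ext i
  simp only [emb, Pi.add_apply, ← Finset.sum_add_distrib]
  refine Finset.sum_congr rfl fun b _ => ?_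
  split_ifs <;> simp

theorem emb_norm [IsUltrametricDist K] (ι : Fin m → Fin n) (u : Fin m → K) : ‖emb ι u‖ ≤ ‖u‖ := by
  rw [pi_norm_le_iff_of_nonneg (norm_nonneg _)]
  intro i
  refine IsUltrametricDist.norm_sum_le_of_forall_le_of_nonneg (norm_nonneg _) fun b _ => ?_
  split_ifs
  · exact norm_le_pi_norm u b
  · simp

theorem emb_cont (ι : Fin m → Fin n) : Continuous (emb ι : (Fin m → K) → (Fin n → K)) := by
  refine continuous_pi fun i => continuous_finsetSum _ fun b _ => ?_
  split_ifs
  · exact continuous_apply b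
  · exact continuous_const

theorem emb_sum (ι : Fin m → Fin n) (u : Fin m → K) (T : Fin n → K) :
    ∑ i, T i * emb ι u i = ∑ b, T (ι b) * u b := by
  simp only [emb, Finset.mul_sum]
  rw [Finset.sum_comm]
  refine Finset.sum_congr rfl fun b _ => ?_
  rw [Finset.sum_eq_single (ι b)]
  · simp
  · intro i _ hi
    rw [if_neg (Ne.symm hi), mul_zero]
  · simp

/-- linear forms on a slice -/
noncomputable def slf (K : Type) [NontriviallyNormedField K] (ι : Fin m → Fin n) (i : Fin n) :
    MvPolynomial (Fin m) K := ∑ b, if ι b = i then MvPolynomial.X b else 0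

theorem slf_eval (ι : Fin m → Fin n) (i : Fin n) (u : Fin m → K) :
    MvPolynomial.eval u (slf K ι i) = emb ι u i := by
  rw [slf, emb, map_sum]
  refine Finset.sum_congr rfl fun b _ => ?_
  split_ifs <;> simp

theorem slf_deg (ι : Fin m → Fin n) (i : Fin n) : (slf K ι i).totalDegree ≤ 1 := by
  refine MvPolynomial.totalDegree_finsetSum_le fun b _ => ?_
  split_ifs
  · simp [MvPolynomial.totalDegree_X]
  · simp

theorem slice_poly {D : ℕ} {h : (Fin n → ℕ) → (Fin n → K) → K} (H : TS D h) (γ : Fin n → ℕ)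
    (ι : Fin m → Fin n) (x : Fin n → K) : ∃ Φ : MvPolynomial (Fin m) K, Φ.totalDegree ≤ n * D ∧
      ∀ u, Tf h γ (x + emb ι u) = MvPolynomial.eval u Φ := by
  refine ⟨∑ δ ∈ Box n D, ((fac γ : K) * (chs δ γ : K) * h (δ + γ) x) • ∏ i, slf K ι i ^ δ i, ?_, ?_⟩
  · refine MvPolynomial.totalDegree_finsetSum_le fun δ hδ => ?_
    refine (MvPolynomial.totalDegree_smul_le _ _).trans ?_
    refine (MvPolynomial.totalDegree_finsetProd _ _).trans ?_
    calc _ ≤ ∑ i : Fin n, D := by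
          refine Finset.sum_le_sum fun i _ => (MvPolynomial.totalDegree_pow _ _).trans ?_
          calc δ i * (slf K ι i).totalDegree ≤ D * 1 := Nat.mul_le_mul (mem_Box.1 hδ i) (slf_deg ι i)
            _ = D := mul_one _
      _ = n * D := by simp
  · intro u
    rw [Tf_taylor H, map_sum]
    refine Finset.sum_congr rfl fun δ _ => ?_
    rw [MvPolynomial.smul_eval, map_prod, mon]
    congr 1
    refine Finset.prod_congr rfl fun i _ => ?_
    rw [map_pow, slf_eval]

theorem tri_iso [IsUltrametricDist K] {lam : ℝ} (hlam : 0 < lam) (J : Fin m → Fin m → K)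
    (hJd : ∀ a, ‖J a a‖ = lam) (hJ : ∀ a b, ‖J a b‖ ≤ lam) (hJl : ∀ a b, b < a → ‖J a b‖ < lam)
    (t : Fin m → K) : ‖(fun a => ∑ b, J a b * t b : Fin m → K)‖ = lam * ‖t‖ := by
  by_cases ht : t = 0
  · subst ht
    simp only [Pi.zero_apply, mul_zero, Finset.sum_const_zero, norm_zero]
    exact norm_zero
  have htpos : 0 < ‖t‖ := norm_pos_iff.2 ht
  apply le_antisymm
  · rw [pi_norm_le_iff_of_nonneg (by positivity)]
    intro a
    refine IsUltrametricDist.norm_sum_le_of_forall_le_of_nonneg (by positivity) fun b _ => ?_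
    rw [norm_mul]
    exact mul_le_mul (hJ a b) (norm_le_pi_norm t b) (norm_nonneg _) hlam.le
  · have hne : (Finset.univ.filter fun a => ‖t a‖ = ‖t‖).Nonempty := by
      by_contra hc
      rw [Finset.not_nonempty_iff_eq_empty, Finset.filter_eq_empty_iff] at hc
      have : ‖t‖ < ‖t‖ := by
        rw [pi_norm_lt_iff htpos]
        intro i
        exact lt_of_le_of_ne (norm_le_pi_norm t i) (hc (Finset.mem_univ i))
      exact lt_irrefl _ this
    set a := (Finset.univ.filter fun a => ‖t a‖ = ‖t‖).max' hne with ha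
    have ha1 : ‖t a‖ = ‖t‖ := by
      have := Finset.max'_mem _ hne
      rw [Finset.mem_filter] at this
      exact this.2
    have ha2 : ∀ b, a < b → ‖t b‖ < ‖t‖ := by
      intro b hb
      refine lt_of_le_of_ne (norm_le_pi_norm t b) fun he => ?_
      have := Finset.le_max' (Finset.univ.filter fun a => ‖t a‖ = ‖t‖) b (by simp [he])
      exact absurd hb (not_lt.2 this)
    have h1 : ‖∑ b, J a b * t b - J a a * t a‖ < ‖J a a * t a‖ := by
      rw [← Finset.sum_erase_eq_sub (Finset.mem_univ a), norm_mul, hJd, ha1]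
      refine um_sum_lt _ _ (by positivity) fun b hb => ?_
      rw [norm_mul]
      rcases lt_or_gt_of_ne (Finset.ne_of_mem_erase hb) with h | h
      · calc ‖J a b‖ * ‖t b‖ ≤ ‖J a b‖ * ‖t‖ := by gcongr; exact norm_le_pi_norm t b
          _ < lam * ‖t‖ := by gcongr; exact hJl a b h
      · calc ‖J a b‖ * ‖t b‖ ≤ lam * ‖t b‖ := by gcongr; exact hJ a b
          _ < lam * ‖t‖ := by gcongr; exact ha2 b h
    have h2 := um_eq h1
    rw [norm_mul, hJd, ha1] at h2
    rw [← h2]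
    exact norm_le_pi_norm (fun a => ∑ b, J a b * t b : Fin m → K) a

/-- the pieces of the negligible set -/
def Pc (h : (Fin n → ℕ) → (Fin n → K) → K) (M : ℕ) (lam δ : ℝ) (γ : Fin n → ℕ) (ι : Fin m → Fin n) :
    Set (Fin n → K) :=
  {x | ‖x‖ ≤ 1 ∧ ‖Tf h γ x‖ = lam ∧ TM h (M + 1) x ≤ lam ∧ TM h M x ≤ δ ∧
    ∀ a b, b < a → ‖Tf h (γ - ee (ι a) + ee (ι b)) x‖ < lam}

theorem sub_ee_add {γ : Fin n → ℕ} {i : Fin n} (hi : 1 ≤ γ i) : γ - ee i + ee i = γ := by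
  ext j
  by_cases hj : j = i
  · subst hj; simp [ee]; omega
  · simp [ee, hj]

theorem Pc_bound (hK : IsLocalField K q) [MeasurableSpace K] [BorelSpace K] [SecondCountableTopology K]
    {P : Measure K} (hP : IsUnif q P) {D : ℕ} {h : (Fin n → ℕ) → (Fin n → K) → K} (H : TS D h)
    {G : ℝ} (hG0 : 0 ≤ G) (hG : ∀ x, ‖x‖ ≤ 1 → ∀ γ, 1 ≤ deg γ → ‖h γ x‖ ≤ G)
    {d : ℕ} (hd : (m * (n * D) + 1) ^ m < d) (M : ℕ) {lam δ : ℝ} (hlam : 0 < lam) (hδ : 0 < δ)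
    (γ : Fin n → ℕ) (hγ : deg γ = M + 1) (ι : Fin m → Fin n) (hι : ∀ a, 1 ≤ γ (ι a)) :
    (PP P n).real (Pc h M lam δ γ ι) ≤ d ^ m * (q ^ 2 * δ / lam) ^ m := by
  have := lf_ultra hK
  have := PP_prob hP n
  have hq1 := lf_q1 hK
  have hdeg : ∀ a, deg (γ - ee (ι a)) = M := by
    intro a
    have := congrArg deg (sub_ee_add (hι a))
    rw [deg_add, deg_ee, hγ] at this
    omega
  have hmeas : MeasurableSet (Pc h M lam δ γ ι) := by
    refine MeasurableSet.inter (measurableSet_le continuous_norm.measurable measurable_const) ?_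
    refine MeasurableSet.inter (measurableSet_eq_fun (Tf_cont H γ).norm.measurable measurable_const) ?_
    refine MeasurableSet.inter (measurableSet_le (TM_cont H _).measurable measurable_const) ?_
    refine MeasurableSet.inter (measurableSet_le (TM_cont H _).measurable measurable_const) ?_
    have e : {x : Fin n → K | ∀ a b, b < a → ‖Tf h (γ - ee (ι a) + ee (ι b)) x‖ < lam} =
        ⋂ a, ⋂ b, ⋂ (_ : b < a), {x : Fin n → K | ‖Tf h (γ - ee (ι a) + ee (ι b)) x‖ < lam} := by
      ext x; simp
    change MeasurableSet {x : Fin n → K | ∀ a b, b < a → ‖Tf h (γ - ee (ι a) + ee (ι b)) x‖ < lam}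
    rw [e]
    exact MeasurableSet.iInter fun a => MeasurableSet.iInter fun b => MeasurableSet.iInter fun _ =>
      measurableSet_lt (Tf_cont H _).norm.measurable measurable_const
  have key := PP_slice_le' hP (emb ι) (emb_cont ι).measurable (fun u hu => (emb_norm ι u).trans hu)
    hmeas MeasurableSet.univ (fun _ _ _ _ _ => Set.mem_univ _) (d ^ m * (q ^ 2 * δ / lam) ^ m)
    (by positivity) ?_
  · refine key.trans ?_
    exact mul_le_of_le_one_right (by positivity) measureReal_le_one
  intro x _ hx
  choose Φ hΦ hΦe using fun a => slice_poly H (γ - ee (ι a)) ι x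
  refine coarea hK hP hd Φ hΦ (fun u a => Tf h (γ - ee (ι a)) (x + emb ι u)) (fun u a => hΦe a u) _
    (fun u hu => hu.1) hδ hlam hG0 ?_ ?_
  · intro u hu
    rw [pi_norm_le_iff_of_nonneg hδ.le]
    intro a
    exact (le_TM h (hdeg a) _).trans hu.2.2.2.2.1
  · rintro u ⟨hu1, hz1, hz2, hz3, hz4, hz5⟩
    set z := x + emb ι u with hz
    set J : Fin m → Fin m → K := fun a b => Tf h (γ - ee (ι a) + ee (ι b)) z with hJ
    refine ⟨Matrix.mulVecLin (Matrix.of J), ?_, ?_⟩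
    · intro t
      refine tri_iso hlam J ?_ ?_ ?_ t
      · intro a; rw [hJ]; simp only; rw [sub_ee_add (hι a)]; exact hz2
      · intro a b
        exact (le_TM h (by rw [deg_add, deg_ee, hdeg]) _).trans hz3
      · exact hz5
    · intro t t' ht ht'
      rw [pi_norm_le_iff_of_nonneg (by positivity)]
      intro a
      have htt : ‖t' - t‖ ≤ max ‖t‖ ‖t'‖ := by rw [max_comm]; exact um_sub _ _
      have htt1 : ‖t' - t‖ ≤ 1 := htt.trans (max_le ht ht')
      have e1 : x + emb ι (u + t') = (z + emb ι t) + emb ι (t' - t) := by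
        rw [hz, add_assoc, add_assoc, ← emb_add, ← emb_add]
        congr 2; abel
      have e2 : x + emb ι (u + t) = z + emb ι t := by
        rw [hz, emb_add, add_assoc]
      have hzt : ‖z + emb ι t‖ ≤ 1 :=
        (IsUltrametricDist.norm_add_le_max _ _).trans (max_le hz1 ((emb_norm ι t).trans ht))
      have l2 := Tf_lip2 H (γ - ee (ι a)) (z + emb ι t) (emb ι (t' - t)) G hG0
        (fun γ' hγ' => hG _ hzt γ' (by omega)) ((emb_norm ι _).trans htt1)
      rw [emb_sum ι (t' - t) (fun i => Tf h (γ - ee (ι a) + ee i) (z + emb ι t))] at l2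
      have l1 : ∀ b, ‖Tf h (γ - ee (ι a) + ee (ι b)) (z + emb ι t) - J a b‖ ≤ G * ‖t‖ := by
        intro b
        refine (Tf_lip H (γ - ee (ι a) + ee (ι b)) z (emb ι t) G hG0
          (fun γ' hγ' => hG _ hz1 γ' (by omega)) ((emb_norm ι _).trans ht)).trans ?_
        exact mul_le_mul_of_nonneg_left (emb_norm ι t) hG0
      have e3 : (fun u a => Tf h (γ - ee (ι a)) (x + emb ι u)) (u + t') a -
          (fun u a => Tf h (γ - ee (ι a)) (x + emb ι u)) (u + t) a -
          (Matrix.mulVecLin (Matrix.of J)) (t' - t) a =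
          (Tf h (γ - ee (ι a)) ((z + emb ι t) + emb ι (t' - t)) - Tf h (γ - ee (ι a)) (z + emb ι t)
            - ∑ b, Tf h (γ - ee (ι a) + ee (ι b)) (z + emb ι t) * (t' - t) b) +
          ∑ b, (Tf h (γ - ee (ι a) + ee (ι b)) (z + emb ι t) - J a b) * (t' - t) b := by
        simp only [e1, e2, sub_mul, Finset.sum_sub_distrib]
        rw [Matrix.mulVecLin_apply, Matrix.mulVec, dotProduct]
        simp only [Matrix.of_apply]
        ring
      have hmx : 0 ≤ max ‖t‖ ‖t'‖ := (norm_nonneg _).trans (le_max_left _ _)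
      refine (congrArg norm e3).trans_le ?_
      refine (IsUltrametricDist.norm_add_le_max _ _).trans (max_le (l2.trans ?_) ?_)
      · rw [pow_two, ← mul_assoc]
        have := (emb_norm ι (t' - t))
        gcongr
        exact this.trans htt
      · refine IsUltrametricDist.norm_sum_le_of_forall_le_of_nonneg (by positivity) fun b _ => ?_
        rw [norm_mul]
        gcongr
        · exact (l1 b).trans (by gcongr; exact le_max_left _ _)
        · exact norm_le_pi_norm (t' - t) b

theorem lex_pick (h : (Fin n → ℕ) → (Fin n → K) → K) (M : ℕ) {lam : ℝ} (hlam : 0 < lam) (x : Fin n → K)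
    (hx : TM h M x = lam) : ∃ γ, deg γ = M ∧ ‖Tf h γ x‖ = lam ∧
      ∀ i j, j < i → 1 ≤ γ i → ‖Tf h (γ - ee i + ee j) x‖ < lam := by
  set S := ((Finset.univ : Finset (Fin n)).piAntidiag M).filter fun γ => ‖Tf h γ x‖ = lam with hS
  have hne : S.Nonempty := by
    obtain ⟨γ, h1, h2⟩ := exists_TM h (hx ▸ hlam : 0 < TM h M x)
    exact ⟨γ, Finset.mem_filter.2 ⟨mem_anti.2 h1, h2.trans hx⟩⟩
  obtain ⟨γ, hγ, hmax⟩ := Finset.exists_max_image S (fun γ => toLex γ) hne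
  rw [hS, Finset.mem_filter, mem_anti] at hγ
  refine ⟨γ, hγ.1, hγ.2, ?_⟩
  intro i j hji hi
  have hdeg : deg (γ - ee i + ee j) = M := by
    have := congrArg deg (sub_ee_add hi)
    rw [deg_add, deg_ee] at this ⊢
    rw [this, hγ.1]
  have hle := le_TM h hdeg x
  rw [hx] at hle
  refine lt_of_le_of_ne hle fun heq => ?_
  have h1 := hmax _ (Finset.mem_filter.2 ⟨mem_anti.2 hdeg, heq⟩)
  have h2 : toLex γ < toLex (γ - ee i + ee j) := by
    refine ⟨j, fun l hl => ?_, ?_⟩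
    · have : l ≠ j := hl.ne
      have h' : l ≠ i := (hl.trans hji).ne
      simp [ee, this, h']
    · have : j ≠ i := hji.ne
      simp [ee, this]
  exact absurd h1 (not_le.2 h2)

theorem neg_piece (hK : IsLocalField K q) [MeasurableSpace K] [BorelSpace K] [SecondCountableTopology K]
    {P : Measure K} (hP : IsUnif q P) {D : ℕ} {h : (Fin n → ℕ) → (Fin n → K) → K} (H : TS D h)
    {G : ℝ} (hG0 : 0 ≤ G) (hG : ∀ x, ‖x‖ ≤ 1 → ∀ γ, 1 ≤ deg γ → ‖h γ x‖ ≤ G)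
    {d : ℕ} (m : ℕ) (hd : (m * (n * D) + 1) ^ m < d) (M : ℕ) {lam κ : ℝ} (hlam : 0 < lam) (hκ : 0 < κ)
    (hm : ∀ x, ‖x‖ ≤ 1 → ∀ γ, deg γ = M + 1 → ‖Tf h γ x‖ = lam →
      m ≤ (Finset.univ.filter fun i => 1 ≤ γ i).card) :
    (PP P n).real {x | ‖x‖ ≤ 1 ∧ TM h (M + 1) x = lam ∧ TM h M x ≤ κ * lam} ≤
      ((Finset.univ : Finset (Fin n)).piAntidiag (M + 1)).card * (n ^ m * (d ^ m * (q ^ 2 * κ) ^ m)) := by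
  have := lf_ultra hK
  have := PP_prob hP n
  have hcov : {x | ‖x‖ ≤ 1 ∧ TM h (M + 1) x = lam ∧ TM h M x ≤ κ * lam} ⊆
      ⋃ γ ∈ (Finset.univ : Finset (Fin n)).piAntidiag (M + 1),
        ⋃ ι ∈ (Finset.univ : Finset (Fin m → Fin n)).filter (fun ι => ∀ a, 1 ≤ γ (ι a)),
          Pc h M lam (κ * lam) γ ι := by
    rintro x ⟨hx1, hx2, hx3⟩
    obtain ⟨γ, h1, h2, h3⟩ := lex_pick h (M + 1) hlam x hx2
    have hc := hm x hx1 γ h1 h2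
    set e := (Finset.univ.filter fun i => 1 ≤ γ i).orderEmbOfCardLe hc with he
    have hmem : ∀ a, 1 ≤ γ (e a) := by
      intro a
      have := Finset.orderEmbOfCardLe_mem (Finset.univ.filter fun i => 1 ≤ γ i) hc a
      rw [Finset.mem_filter] at this
      exact this.2
    refine Set.mem_iUnion₂.2 ⟨γ, mem_anti.2 h1, Set.mem_iUnion₂.2 ⟨e, ?_, hx1, h2, hx2.le, hx3, ?_⟩⟩
    · exact Finset.mem_filter.2 ⟨Finset.mem_univ _, hmem⟩
    · intro a b hab
      exact h3 (e a) (e b) (e.strictMono hab) (hmem a)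
  have hB : ∀ γ ∈ (Finset.univ : Finset (Fin n)).piAntidiag (M + 1),
      (PP P n).real (⋃ ι ∈ (Finset.univ : Finset (Fin m → Fin n)).filter (fun ι => ∀ a, 1 ≤ γ (ι a)),
          Pc h M lam (κ * lam) γ ι) ≤ n ^ m * (d ^ m * (q ^ 2 * κ) ^ m) := by
    intro γ hγ
    refine (measureReal_biUnion_finset_le _ _).trans ?_
    calc _ ≤ ∑ ι ∈ (Finset.univ : Finset (Fin m → Fin n)).filter (fun ι => ∀ a, 1 ≤ γ (ι a)),
          ((d:ℝ) ^ m * (q ^ 2 * κ) ^ m) := by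
          refine Finset.sum_le_sum fun ι hι => ?_
          refine (Pc_bound hK hP H hG0 hG hd M hlam (by positivity) γ (mem_anti.1 hγ) ι
            (Finset.mem_filter.1 hι).2).trans (le_of_eq ?_)
          congr 2
          field_simp
      _ ≤ _ := by
          rw [Finset.sum_const, nsmul_eq_mul]
          gcongr
          have := Finset.card_filter_le (Finset.univ : Finset (Fin m → Fin n)) (fun ι => ∀ a, 1 ≤ γ (ι a))
          rw [Finset.card_univ, Fintype.card_fun, Fintype.card_fin, Fintype.card_fin] at this
          exact_mod_cast this
  refine (measureReal_mono hcov (measure_ne_top _ _)).trans ?_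
  refine (measureReal_biUnion_finset_le _ _).trans ((Finset.sum_le_sum hB).trans ?_)
  rw [Finset.sum_const, nsmul_eq_mul]

end VdC9
end

section
open MeasureTheory Filter VdC
open scoped NNReal ENNReal Classical
namespace VdC9

theorem chain_le (τ : ℕ → ℝ) (c : ℝ) (a b : ℕ) (hab : a ≤ b)
    (h : ∀ M, a ≤ M → M < b → τ (M + 1) - c ≤ τ M) : τ b - ((b : ℝ) - a) * c ≤ τ a := by
  induction b, hab using Nat.le_induction with
  | base => simp
  | succ b hb ih =>
    have h1 := ih fun M h1 h2 => h M h1 (by omega)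
    have h2 := h b hb (by omega)
    push_cast
    nlinarith

theorem real_case2 (k p : ℕ) (hpR : (2:ℝ) ≤ p) (hkR : (2:ℝ) ≤ k) (l g π u c hh τ1 : ℝ)
    (hl : 8 * g < l) (hg : 0 ≤ g) (huk : u * k = k + 1 / 8) (hu1 : 1 < u)
    (hc0 : 0 < c) (hc1 : c ≤ 1/2) (hc2 : c * p ≤ (3/4) * (p - 1)) (hh1 : 1 ≤ hh)
    (hτ1 : -(u * (k - 1 - (1 - c) * hh)) * l ≤ τ1) (hπl : - (u * c * hh * l) - g ≤ π) (hπ : π + g < 0) :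
    0 < k * l + τ1 - u * l ∧ 0 < (p - 1) * (k * l + τ1 - u * l) + π ∧ -(k - 1 - 1/4) * l ≤ τ1 := by
  have hl0 : 0 < l := by linarith
  have huh : 1 * 1 ≤ u * hh := mul_le_mul hu1.le hh1 (by norm_num) (by linarith)
  have h2 : 0 < (p - 1) * (k * l + τ1 - u * l) + π := by
    have e1 : ((p:ℝ) - 1) / 4 ≤ (p - 1) * (1 - c) - c := by linarith
    have e2 : u * hh * ((p - 1) / 4) ≤ u * hh * ((p - 1) * (1 - c) - c) :=
      mul_le_mul_of_nonneg_left e1 (by linarith)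
    have e3 : 1/8 ≤ k - u * k + u * hh / 4 := by linarith
    have e4 : 1 * (1/8) ≤ ((p:ℝ) - 1) * (k - u * k + u * hh / 4) :=
      mul_le_mul (by linarith) e3 (by norm_num) (by linarith)
    have e5 : 1/8 ≤ (p - 1) * (k - u * k) + u * hh * ((p - 1) * (1 - c) - c) := by linarith
    have e6 : 1/8 * l ≤ ((p - 1) * (k - u * k) + u * hh * ((p - 1) * (1 - c) - c)) * l :=
      mul_le_mul_of_nonneg_right e5 hl0.le
    have e7 : ((p:ℝ) - 1) * (k * l + (-(u * (k - 1 - (1 - c) * hh)) * l) - u * l) ≤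
        (p - 1) * (k * l + τ1 - u * l) := mul_le_mul_of_nonneg_left (by linarith) (by linarith)
    linarith
  have h1 : 0 < k * l + τ1 - u * l := by
    have : 0 < (p - 1) * (k * l + τ1 - u * l) := by linarith
    exact pos_of_mul_pos_right this (by linarith)
  refine ⟨h1, h2, ?_⟩
  have hcc : 1/2 * 1 ≤ (1 - c) * hh := mul_le_mul (by linarith) hh1 (by norm_num) (by linarith)
  have h4 : u * (k - 1 - (1 - c) * hh) ≤ k - 1 - 1/4 := by
    have : u * (1/2) ≤ u * ((1 - c) * hh) := mul_le_mul_of_nonneg_left (by linarith) (by linarith)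
    linarith
  have := mul_le_mul_of_nonneg_right h4 hl0.le
  linarith

set_option maxHeartbeats 1000000 in
theorem real_core (k p : ℕ) (hp : 2 ≤ p) (hpk : p ≤ k) (l g π u : ℝ) (hg : 0 ≤ g) (hl : 8 * g < l)
    (hu : u = 1 + 1 / (8 * k)) (τ : ℕ → ℝ) (hk0 : 0 ≤ τ k)
    (F1 : ∀ M, 1 ≤ M → M < k → τ (M + 1) - u * l ≤ τ M)
    (F2 : ∀ M, 1 ≤ M → M < k → p ≤ M + 1 → π + g < τ (M + 1) → τ (M + 1) - u / 2 * l ≤ τ M)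
    (F3 : p = 2 → ∀ M, 2 ≤ M → M < k → π + g < τ (M + 1) → τ (M + 1) - u / 3 * l ≤ τ M)
    (hπ : π + g < 0) (φ : ℕ → ℝ) (hφ1 : ∀ m, m < p → φ m = 0)
    (hφ2 : ∀ m : ℕ, 1 ≤ m → ((m : ℝ) - 1) * π ≤ (p - 1) * φ m) :
    0 ≤ k * l + τ 1 ∧ ∀ m : ℕ, 2 ≤ m → ∀ ν : ℝ, ν ≤ g → (m ≤ k → ν ≤ τ m - φ m) →
      ν < k * l * (m - 1) + m * τ 1 := by
  have hl0 : 0 < l := by linarith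
  have hpR : (2:ℝ) ≤ p := by exact_mod_cast hp
  have hpkR : (p:ℝ) ≤ k := by exact_mod_cast hpk
  have hkR : (2:ℝ) ≤ k := hpR.trans hpkR
  have huk : u * k = k + 1 / 8 := by
    rw [hu]; field_simp
  have hu1 : 1 < u := by
    rw [hu]
    have : (0:ℝ) < 1 / (8 * k) := by positivity
    linarith
  have hu2 : u ≤ 1 + 1/16 := by
    nlinarith
  have hdown : ∀ m, 1 ≤ m → m ≤ k → τ m - ((m:ℝ) - 1) * (u * l) ≤ τ 1 := by
    intro m hm hmk
    have := chain_le τ (u * l) 1 m hm fun M h1 h2 => F1 M h1 (by omega)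
    exact_mod_cast this
  by_cases hI : ∀ M, p ≤ M → M ≤ k → π + g < τ M
  · -- first case
    have h1 : τ k - ((k:ℝ) - (p - 1 : ℕ)) * (u / 2 * l) ≤ τ (p - 1) :=
      chain_le τ (u / 2 * l) (p - 1) k (by omega) fun M hM1 hM2 =>
        F2 M (by omega) hM2 (by omega) (hI (M + 1) (by omega) (by omega))
    have h2 := hdown (p - 1) (by omega) (by omega)
    have e : ((p - 1 : ℕ) : ℝ) = p - 1 := by
      rw [Nat.cast_sub (by omega)]; simp
    rw [e] at h1 h2
    set w : ℝ := u * (k + p - 3) / 2 with hw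
    have hτ1 : -w * l ≤ τ 1 := by
      have : -w * l = - ((k:ℝ) - (p - 1)) * (u / 2 * l) - ((p:ℝ) - 1 - 1) * (u * l) := by rw [hw]; ring
      rw [this]; linarith
    have hwk : w + u ≤ k - 1/4 := by
      rw [hw]
      nlinarith
    have hpos : 0 < k * l + τ 1 - u * l := by nlinarith
    have hul : 0 < u * l := by positivity
    refine ⟨by linarith, ?_⟩
    intro m hm ν hν1 hν2
    have hmR : (2:ℝ) ≤ m := by exact_mod_cast hm
    by_cases hmp : m < p
    · have h3 := hν2 (by omega)
      rw [hφ1 m hmp] at h3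
      have h4 := hdown m (by omega) (by omega)
      nlinarith
    · push Not at hmp
      have hmpR : (p:ℝ) ≤ m := by exact_mod_cast hmp
      have h5 : 1/4 ≤ (k:ℝ) * (p - 1) - p * w := by
        rw [hw]
        have e5 : (p:ℝ) * (u * (k + p - 3) / 2) = (p * (k + p - 3) + p * (k + p - 3) * (1 / (8 * k))) / 2 := by
          rw [hu]; ring
        have e6 : (p:ℝ) * (k + p - 3) * (1 / (8 * k)) ≤ p / 4 := by
          rw [mul_one_div, div_le_div_iff₀ (by positivity) (by positivity)]
          nlinarith
        rw [e5]
        have e7 : (p:ℝ) / 2 ≤ k * (p - 1) - p * (k + p - 3) / 2 := by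
          have hp3 : (0:ℝ) ≤ (p - 2) * (k - p) := mul_nonneg (by linarith) (by linarith)
          nlinarith
        linarith
      have h6 : k * (p - 1) - p * w ≤ (k:ℝ) * (m - 1) - m * w := by nlinarith
      have h7 : 1/4 * l ≤ ((k:ℝ) * (m - 1) - m * w) * l :=
        mul_le_mul_of_nonneg_right (h5.trans h6) hl0.le
      have h8 : (m:ℝ) * (-w * l) ≤ m * τ 1 := mul_le_mul_of_nonneg_left hτ1 (by linarith)
      nlinarith
  · -- second case
    push Not at hI
    set S := (Finset.Icc p k).filter fun M => τ M ≤ π + g with hS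
    have hne : S.Nonempty := by
      obtain ⟨M, h1, h2, h3⟩ := hI
      exact ⟨M, Finset.mem_filter.2 ⟨Finset.mem_Icc.2 ⟨h1, h2⟩, h3⟩⟩
    set M0 := S.max' hne with hM0
    have hM0S := Finset.max'_mem S hne
    rw [← hM0, hS, Finset.mem_filter, Finset.mem_Icc] at hM0S
    obtain ⟨⟨hM1, hM2⟩, hM3⟩ := hM0S
    have hgood : ∀ M, M0 < M → M ≤ k → π + g < τ M := by
      intro M h1 h2
      by_contra hc
      push Not at hc
      have := Finset.le_max' S M (Finset.mem_filter.2 ⟨Finset.mem_Icc.2 ⟨by omega, h2⟩, hc⟩)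
      omega
    have hM4 : M0 < k := by
      rcases lt_or_eq_of_le hM2 with h | h
      · exact h
      · rw [h] at hM3; linarith
    have hM1R : (p:ℝ) ≤ M0 := by exact_mod_cast hM1
    have hM4R : (M0:ℝ) + 1 ≤ k := by exact_mod_cast hM4
    obtain ⟨c, hc0, hc1, hc2, hc3⟩ : ∃ c : ℝ, 0 < c ∧ c ≤ 1/2 ∧ c * p ≤ (3/4) * (p - 1) ∧
        τ k - ((k:ℝ) - M0) * (u * c * l) ≤ τ M0 := by
      by_cases hp2 : p = 2
      · refine ⟨1/3, by norm_num, by norm_num, by rw [hp2]; norm_num, ?_⟩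
        refine chain_le τ (u * (1/3) * l) M0 k hM2 fun M h1 h2 => ?_
        have := F3 hp2 M (by omega) h2 (hgood _ (by omega) (by omega))
        linarith
      · have : (3:ℝ) ≤ p := by exact_mod_cast (show 3 ≤ p by omega)
        refine ⟨1/2, by norm_num, by norm_num, by linarith, ?_⟩
        refine chain_le τ (u * (1/2) * l) M0 k hM2 fun M h1 h2 => ?_
        have := F2 M (by omega) h2 (by omega) (hgood _ (by omega) (by omega))
        linarith
    have h2 := hdown M0 (by omega) hM2
    set hh : ℝ := k - M0 with hhh
    have hh1 : 1 ≤ hh := by linarith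
    have hul : 0 < u * l := by positivity
    have hτ1 : -(u * (k - 1 - (1 - c) * hh)) * l ≤ τ 1 := by
      have : -(u * (k - 1 - (1 - c) * hh)) * l = - hh * (u * c * l) - ((M0:ℝ) - 1) * (u * l) := by
        rw [hhh]; ring
      rw [this]; linarith
    have hπl : - (u * c * hh * l) - g ≤ π := by linarith
    obtain ⟨hX, hpos, hτ2⟩ := real_case2 k p hpR hkR l g π u c hh (τ 1) hl hg huk hu1 hc0 hc1 hc2 hh1 hτ1 hπl hπ
    refine ⟨by linarith, ?_⟩
    intro m hm ν hν1 hν2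
    have hmR : (2:ℝ) ≤ m := by exact_mod_cast hm
    by_cases hmk : m ≤ k
    · have h3 := hν2 hmk
      have h4 := hdown m (by omega) hmk
      have h5 := hφ2 m (by omega)
      have h6 : 0 < ((m:ℝ) - 1) * ((p - 1) * (k * l + τ 1 - u * l) + π) := mul_pos (by linarith) hpos
      have h7 : 0 < ((p:ℝ) - 1) * ((m - 1) * (k * l + τ 1 - u * l) + φ m) := by linarith
      have h8 : 0 < ((m:ℝ) - 1) * (k * l + τ 1 - u * l) + φ m :=
        pos_of_mul_pos_right h7 (by linarith)
      linarith
    · push Not at hmk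
      have hmkR : (k:ℝ) + 1 ≤ m := by exact_mod_cast hmk
      have h6 : 1/4 ≤ (k:ℝ) * (m - 1) - m * (k - 1 - 1/4) := by linarith
      have h8 : (m:ℝ) * (-(k - 1 - 1/4) * l) ≤ m * τ 1 :=
        mul_le_mul_of_nonneg_left hτ2 (by linarith)
      have h9 := mul_le_mul_of_nonneg_right h6 hl0.le
      linarith

end VdC9
end

section
open MeasureTheory Filter VdC
open scoped NNReal ENNReal Classical
namespace VdC9
variable {K : Type} [NontriviallyNormedField K] {q n : ℕ}

theorem exists_resp (hK : IsLocalField K q) : ∃ p : ℕ, p.Prime ∧ ‖(p : K)‖ < 1 ∧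
    ∀ m : ℕ, ¬ p ∣ m → ‖(m : K)‖ = 1 := by
  have := lf_ultra hK
  obtain ⟨T, hTc, hT1, hT⟩ := hK.residue
  have hex : ∃ p : ℕ, 0 < p ∧ ‖(p : K)‖ < 1 := by
    choose! f hf using fun x (hx : ‖x‖ ≤ 1) => (hT x hx).exists
    have hmaps : ∀ i ∈ Finset.range (q + 1), f (i : K) ∈ T := fun i _ => (hf _ (nat_norm_le i)).1
    obtain ⟨i, hi, j, hj, hij, he⟩ := Finset.exists_ne_map_eq_of_card_lt_of_maps_to
      (s := Finset.range (q + 1)) (t := T) (by rw [hTc, Finset.card_range]; omega) hmaps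
    wlog hlt : i < j generalizing i j
    · exact this j hj i hi hij.symm he.symm (by omega)
    refine ⟨j - i, by omega, ?_⟩
    rw [Nat.cast_sub hlt.le]
    have h1 := (hf _ (nat_norm_le i)).2
    have h2 := (hf _ (nat_norm_le j)).2
    rw [he] at h1
    have : (j : K) - i = (j - f j) - (i - f j) := by ring
    rw [this]
    exact (um_sub _ _).trans_lt (max_lt h2 h1)
  set p := Nat.find hex with hp
  have hp0 : 0 < p := (Nat.find_spec hex).1
  have hp1 : ‖(p : K)‖ < 1 := (Nat.find_spec hex).2
  have hmin : ∀ m, 0 < m → m < p → ‖(m : K)‖ = 1 := by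
    intro m h0 hm
    have := Nat.find_min hex hm
    push Not at this
    exact le_antisymm (nat_norm_le m) (this h0)
  refine ⟨p, ?_, hp1, ?_⟩
  · rw [Nat.prime_def]
    refine ⟨?_, ?_⟩
    · rcases Nat.lt_or_ge 1 p with h | h
      · exact h
      · have : p = 1 := by omega
        rw [this] at hp1
        simp at hp1
    · rintro a ⟨b, hab⟩
      by_contra hc
      push Not at hc
      have ha0 : 0 < a := Nat.pos_of_ne_zero fun h => by simp [h] at hab; omega
      have hb0 : 0 < b := Nat.pos_of_ne_zero fun h => by simp [h] at hab; omega
      have ha : a < p := lt_of_le_of_ne (Nat.le_of_dvd hp0 ⟨b, hab⟩) hc.2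
      have hb : b < p := by
        have : 2 ≤ a := by omega
        nlinarith
      have := hmin a ha0 ha
      have h2 := hmin b hb0 hb
      rw [hab, Nat.cast_mul, norm_mul, this, h2] at hp1
      simp at hp1
  · intro m hm
    have h1 : ‖((m % p : ℕ) : K)‖ = 1 :=
      hmin _ (Nat.pos_of_ne_zero fun h => hm (Nat.dvd_of_mod_eq_zero h)) (Nat.mod_lt _ hp0)
    have h2 : ‖(m : K) - ((m % p : ℕ) : K)‖ < ‖((m % p : ℕ) : K)‖ := by
      rw [h1]
      have : (m : K) - ((m % p : ℕ) : K) = p * ((m / p : ℕ) : K) := by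
        conv_lhs => rw [← Nat.div_add_mod m p]
        push_cast
        rw [Nat.mul_add_mod, Nat.mod_mod]
        ring
      rw [this, norm_mul]
      calc _ ≤ ‖(p : K)‖ * 1 := by gcongr; exact nat_norm_le _
        _ < 1 := by rwa [mul_one]
    rw [um_eq h2, h1]

theorem norm_nat_val {p : ℕ} (hp : p.Prime) (h1 : ∀ m : ℕ, ¬ p ∣ m → ‖(m : K)‖ = 1) (N : ℕ) (hN : N ≠ 0) :
    ‖(N : K)‖ = ‖(p : K)‖ ^ padicValNat p N := by
  have := Fact.mk hp
  obtain ⟨c, hc⟩ := pow_padicValNat_dvd (p := p) (n := N)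
  have hnd : ¬ p ∣ c := by
    rintro ⟨d, hd⟩
    refine pow_succ_padicValNat_not_dvd (p := p) hN ⟨d, ?_⟩
    rw [pow_succ, mul_assoc, ← hd]
    exact hc
  conv_lhs => rw [hc]
  rw [Nat.cast_mul, norm_mul, h1 c hnd, mul_one, Nat.cast_pow, norm_pow]

theorem fact_norm [IsUltrametricDist K] {p : ℕ} (hp : p.Prime) (h1 : ∀ m : ℕ, ¬ p ∣ m → ‖(m : K)‖ = 1) (m : ℕ) (hm : 1 ≤ m) :
    ‖(p : K)‖ ^ (m - 1) ≤ ‖(m.factorial : K)‖ ^ (p - 1) := by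
  have := Fact.mk hp
  rw [norm_nat_val hp h1 _ (Nat.factorial_ne_zero m), ← pow_mul]
  refine pow_le_pow_of_le_one (norm_nonneg _) (nat_norm_le p) ?_
  have h2 := sub_one_mul_padicValNat_factorial_lt_of_ne_zero p (n := m) (by omega)
  rw [mul_comm]
  omega

theorem fact_norm_lt {p : ℕ} (hp : p.Prime) (h1 : ∀ m : ℕ, ¬ p ∣ m → ‖(m : K)‖ = 1) (m : ℕ) (hm : m < p) :
    ‖(m.factorial : K)‖ = 1 := by
  apply h1
  rw [hp.dvd_factorial]
  omega

theorem fact_norm_ge [IsUltrametricDist K] {p : ℕ} (hp : p.Prime) (h1 : ∀ m : ℕ, ¬ p ∣ m → ‖(m : K)‖ = 1) (m : ℕ) (hm : 1 ≤ m)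
     : ‖(p : K)‖ ^ m ≤ ‖(m.factorial : K)‖ := by
  have h2 := fact_norm hp h1 m hm
  have h3 := hp.two_le
  calc ‖(p : K)‖ ^ m ≤ ‖(p : K)‖ ^ (m - 1) := pow_le_pow_of_le_one (norm_nonneg _) (nat_norm_le p) (by omega)
    _ ≤ _ := h2
    _ ≤ ‖(m.factorial : K)‖ ^ 1 := pow_le_pow_of_le_one (norm_nonneg _) (nat_norm_le _) (by omega)
    _ = _ := pow_one _

/-- multi-indices with a large derivative have small entries -/
theorem small_entries [IsUltrametricDist K] {p : ℕ} (h : (Fin n → ℕ) → (Fin n → K) → K) {G : ℝ} (γ : Fin n → ℕ)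
    (x : Fin n → K) (hG : ‖h γ x‖ ≤ G) (hlt : ‖(p : K)‖ * G < ‖Tf h γ x‖) (hp : p.Prime) : ∀ i, γ i < p := by
  intro i
  by_contra hc
  push Not at hc
  have hd : p ∣ fac γ := by
    refine Dvd.dvd.trans ?_ (Finset.dvd_prod_of_mem _ (Finset.mem_univ i))
    exact hp.dvd_factorial.2 hc
  obtain ⟨c, hc⟩ := hd
  have : ‖Tf h γ x‖ ≤ ‖(p : K)‖ * G := by
    rw [Tf, hc, Nat.cast_mul, norm_mul, norm_mul]
    have := nat_norm_le (K := K) c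
    calc ‖(p : K)‖ * ‖(c : K)‖ * ‖h γ x‖ ≤ ‖(p : K)‖ * 1 * G := by gcongr
      _ = _ := by ring
  linarith

theorem supp_card {p : ℕ} (γ : Fin n → ℕ) (hγ : ∀ i, γ i < p) :
    deg γ ≤ (p - 1) * (Finset.univ.filter fun i => 1 ≤ γ i).card := by
  rw [deg, mul_comm, ← smul_eq_mul, ← Finset.sum_const, Finset.sum_filter]
  refine Finset.sum_le_sum fun i _ => ?_
  have := hγ i
  split_ifs <;> omega

end VdC9
end

section
open MeasureTheory Filter VdC
open scoped NNReal ENNReal Classical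
namespace VdC9
variable {K : Type} [NontriviallyNormedField K] {q n : ℕ}

def Epc (h : (Fin n → ℕ) → (Fin n → K) → K) (M : ℕ) (lam κ : ℝ) : Set (Fin n → K) :=
  {x | ‖x‖ ≤ 1 ∧ TM h (M + 1) x = lam ∧ TM h M x ≤ κ * lam}

theorem TM_zpow (hK : IsLocalField K q) (h : (Fin n → ℕ) → (Fin n → K) → K) {M : ℕ} {x : Fin n → K}
    (hpos : 0 < TM h M x) : ∃ i : ℤ, TM h M x = (q : ℝ) ^ i := by
  obtain ⟨γ, _, h2⟩ := exists_TM h hpos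
  obtain ⟨i, hi⟩ := hK.discrete (Tf h γ x) (by rw [← norm_pos_iff, h2]; exact hpos)
  exact ⟨i, by rw [← h2, hi]⟩

theorem TM_lev (hK : IsLocalField K q) (h : (Fin n → ℕ) → (Fin n → K) → K) {M : ℕ} {x : Fin n → K} {Q : ℕ}
    {G w : ℝ} (hGQ : G ≤ (q : ℝ) ^ Q) (hwQ : ((q : ℝ) ^ Q)⁻¹ ≤ w) (h1 : w ≤ TM h M x)
    (h2 : TM h M x ≤ G) : ∃ i ∈ Finset.Icc (-(Q : ℤ)) Q, TM h M x = (q : ℝ) ^ i := by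
  have hq := lf_q1 hK
  have hQ : 0 < ((q : ℝ) ^ Q)⁻¹ := by positivity
  obtain ⟨i, hi⟩ := TM_zpow hK h (lt_of_lt_of_le hQ (hwQ.trans h1))
  refine ⟨i, Finset.mem_Icc.2 ⟨?_, ?_⟩, hi⟩
  · rw [← zpow_le_zpow_iff_right₀ hq, ← hi, zpow_neg, zpow_natCast]
    exact hwQ.trans h1
  · rw [← zpow_le_zpow_iff_right₀ hq, ← hi, zpow_natCast]
    exact h2.trans hGQ

/-- admissible exponents -/
def Adm (p : ℕ) (c : ℝ) (M : ℕ) (lam : ℝ) (j : ℕ) : Prop :=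
  j = 1 ∨ (j = 2 ∧ p ≤ M + 1 ∧ c < lam) ∨ (j = 3 ∧ p = 2 ∧ 2 ≤ M ∧ c < lam)

theorem good_pt (hK : IsLocalField K q) {p k Q : ℕ} (hp : p.Prime) (hpk : p ≤ k)
    (hres : ∀ m : ℕ, ¬ p ∣ m → ‖(m : K)‖ = 1) (hp0 : 0 < ‖(p : K)‖)
    (h : (Fin n → ℕ) → (Fin n → K) → K) {G : ℝ} (hG1 : 1 ≤ G) (hpG : ‖(p : K)‖ * G < 1)
    (hfac : ∀ m, m ≤ k → 0 < ‖(m.factorial : K)‖)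
    {x : Fin n → K} (hx : ‖x‖ ≤ 1) (hG : ∀ m, 1 ≤ m → NM h m x ≤ G) (hT : 1 ≤ TM h k x) {y : K} {l u : ℝ}
    (hu : u = 1 + 1 / (8 * k)) (hy : ‖y‖ = Real.exp (k * l)) (hl : 8 * Real.log G < l)
    (hGQ : G ≤ (q : ℝ) ^ Q) (hwQ : ((q : ℝ) ^ Q)⁻¹ ≤ Real.exp (- (u * l * k)))
    (hE : ∀ M, 1 ≤ M → M < k → ∀ i ∈ Finset.Icc (-(Q : ℤ)) Q, ∀ j, Adm p (‖(p : K)‖ * G) M ((q:ℝ) ^ i) j →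
      x ∉ Epc h M ((q : ℝ) ^ i) (Real.exp (-(u / j * l)))) : x ∉ Bad h y := by
  have := lf_ultra hK
  have hg : 0 ≤ Real.log G := Real.log_nonneg hG1
  have hl0 : 0 < l := by linarith
  have hk2 : 2 ≤ k := hp.two_le.trans hpk
  have hu1 : 0 ≤ u := by rw [hu]; positivity
  have hTG : ∀ m, 1 ≤ m → TM h m x ≤ G := fun m hm => (TM_le_NM h m x).trans (hG m hm)
  have hE' : ∀ M, 1 ≤ M → M < k → ∀ j, Real.exp (-(u * l * k)) ≤ TM h (M + 1) x →
      Adm p (‖(p : K)‖ * G) M (TM h (M + 1) x) j → Real.exp (-(u / j * l)) * TM h (M + 1) x ≤ TM h M x := by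
    intro M h1 h2 j hw ha
    obtain ⟨i, hi, e⟩ := TM_lev hK h hGQ hwQ hw (hTG _ (by omega))
    rw [e] at ha
    have := hE M h1 h2 i hi j ha
    by_contra hc
    push Not at hc
    exact this ⟨hx, e, by rw [← e]; exact hc.le⟩
  have hlow : ∀ d, d < k → Real.exp (-(u * l * d)) ≤ TM h (k - d) x := by
    intro d
    induction d with
    | zero => intro _; simpa using hT
    | succ d ih =>
      intro hd
      have h1 := ih (by omega)
      have h2 := hE' (k - (d + 1)) (by omega) (by omega) 1
      have e : k - (d + 1) + 1 = k - d := by omega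
      rw [e] at h2
      have hdk : (d : ℝ) ≤ k := by exact_mod_cast (by omega : d ≤ k)
      have h3 := h2 (le_trans (Real.exp_le_exp.2 (by
        have : 0 ≤ u * l := by positivity
        nlinarith)) h1) (Or.inl rfl)
      refine le_trans ?_ h3
      refine le_trans (le_of_eq ?_) (mul_le_mul_of_nonneg_left h1 (Real.exp_nonneg _))
      rw [← Real.exp_add]
      congr 1
      push_cast
      ring
  have hlow' : ∀ M, 1 ≤ M → M ≤ k → Real.exp (-(u * l * k)) ≤ TM h M x := by
    intro M h1 h2
    have h3 := hlow (k - M) (by omega)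
    rw [Nat.sub_sub_self h2] at h3
    refine le_trans (Real.exp_le_exp.2 ?_) h3
    have hdk : ((k - M : ℕ) : ℝ) ≤ k := by exact_mod_cast (by omega : k - M ≤ k)
    have : 0 ≤ u * l := by positivity
    nlinarith
  have hpos : ∀ M, 1 ≤ M → M ≤ k → 0 < TM h M x := fun M h1 h2 =>
    (Real.exp_pos _).trans_le (hlow' M h1 h2)
  have hlog : ∀ M, 1 ≤ M → M < k → ∀ j : ℕ, Adm p (‖(p : K)‖ * G) M (TM h (M + 1) x) j →
      Real.log (TM h (M + 1) x) - u / j * l ≤ Real.log (TM h M x) := by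
    intro M h1 h2 j ha
    have h3 := hE' M h1 h2 j (hlow' _ (by omega) (by omega)) ha
    have hp1 := hpos (M + 1) (by omega) (by omega)
    have h4 := Real.log_le_log (by positivity) h3
    rw [Real.log_mul (Real.exp_pos _).ne' hp1.ne', Real.log_exp] at h4
    linarith
  have hπg : ∀ T, 0 < T → Real.log ‖(p : K)‖ + Real.log G < Real.log T → ‖(p : K)‖ * G < T := by
    intro T hT h2
    rw [← Real.log_mul hp0.ne' (by positivity)] at h2
    exact (Real.log_lt_log_iff (by positivity) hT).1 h2
  have hneg : Real.log ‖(p : K)‖ + Real.log G < 0 := by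
    rw [← Real.log_mul hp0.ne' (by positivity)]
    exact Real.log_neg (by positivity) hpG
  have hφ2 : ∀ m : ℕ, 1 ≤ m → ((m : ℝ) - 1) * Real.log ‖(p : K)‖ ≤
      ((p : ℝ) - 1) * (fun m : ℕ => if m ≤ k then Real.log ‖(m.factorial : K)‖ else
        ((m : ℝ) - 1) * Real.log ‖(p : K)‖ / (p - 1)) m := by
    intro m hm
    have hp2 : (2:ℝ) ≤ p := by exact_mod_cast hp.two_le
    by_cases hmk : m ≤ k
    · simp only [hmk, if_true]
      have h1 := Real.log_le_log (by positivity) (fact_norm (K := K) hp hres m hm)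
      rw [Real.log_pow, Real.log_pow, Nat.cast_sub hm, Nat.cast_sub hp.one_le] at h1
      exact_mod_cast h1
    · simp only [hmk, if_false]
      rw [mul_div_cancel₀]
      linarith
  have core := real_core k p hp.two_le hpk l (Real.log G) (Real.log ‖(p : K)‖) u hg hl hu
    (fun M => Real.log (TM h M x)) (Real.log_nonneg hT)
    (fun M h1 h2 => by simpa using hlog M h1 h2 1 (Or.inl rfl))
    (fun M h1 h2 h3 h4 => by
      simpa using hlog M h1 h2 2 (Or.inr (Or.inl ⟨rfl, h3, hπg _ (hpos _ (by omega) (by omega)) h4⟩)))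
    (fun hp2 M h1 h2 h4 => by
      simpa using hlog M (by omega) h2 3 (Or.inr (Or.inr ⟨rfl, hp2, h1, hπg _ (hpos _ (by omega) (by omega)) h4⟩)))
    hneg (fun m : ℕ => if m ≤ k then Real.log ‖(m.factorial : K)‖ else
        ((m : ℝ) - 1) * Real.log ‖(p : K)‖ / (p - 1))
    (fun m hm => by
      simp only [hm.le.trans hpk, if_true]
      rw [fact_norm_lt hp hres m hm, Real.log_one]) hφ2
  obtain ⟨c1, c2⟩ := core
  have hT1 := hpos 1 le_rfl (by omega)
  rintro (hb | ⟨m, hm, hb⟩)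
  · rw [hy, ← Real.exp_log hT1, ← Real.exp_add, Real.exp_lt_one_iff] at hb
    linarith
  · have hNpos : 0 < NM h m x := lt_of_lt_of_le (by rw [hy]; positivity) hb
    have h1 := c2 m hm (Real.log (NM h m x)) (Real.log_le_log hNpos (hG m (by omega))) (by
      intro hmk
      simp only [hmk, if_true]
      have hf := hfac m hmk
      have h2 := NM_le_TM h m x (G := ‖(m.factorial : K)‖⁻¹) (by rw [inv_mul_cancel₀ hf.ne'])
      have h3 := Real.log_le_log hNpos h2
      rw [Real.log_mul (inv_ne_zero hf.ne') (hpos m (by omega) hmk).ne', Real.log_inv] at h3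
      linarith)
    have h4 := Real.log_le_log (by rw [hy]; positivity) hb
    rw [Real.log_mul (by rw [hy]; positivity) (by positivity), Real.log_pow, Real.log_pow, hy, Real.log_exp,
      Nat.cast_sub (by omega)] at h4
    push_cast at h4
    nlinarith

end VdC9
end

section
open MeasureTheory Filter VdC
open scoped NNReal ENNReal Classical
namespace VdC9
variable {K : Type} [NontriviallyNormedField K] {q n : ℕ}

theorem one_le_supp (γ : Fin n → ℕ) (h : 1 ≤ deg γ) : 1 ≤ (Finset.univ.filter fun i => 1 ≤ γ i).card := by
  rw [Finset.one_le_card]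
  by_contra hc
  rw [Finset.not_nonempty_iff_eq_empty, Finset.filter_eq_empty_iff] at hc
  have : deg γ = 0 := by
    rw [deg]
    exact Finset.sum_eq_zero fun i hi => by have := hc hi; omega
  omega

theorem adm_supp [IsUltrametricDist K] {p : ℕ} (hp : p.Prime) (h : (Fin n → ℕ) → (Fin n → K) → K) {G : ℝ}
    {x : Fin n → K} (hG : ∀ γ, 1 ≤ deg γ → ‖h γ x‖ ≤ G) {M j : ℕ} {lam : ℝ}
    (ha : Adm p (‖(p : K)‖ * G) M lam j) (γ : Fin n → ℕ) (hγ : deg γ = M + 1) (hl : ‖Tf h γ x‖ = lam) :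
    j ≤ (Finset.univ.filter fun i => 1 ≤ γ i).card := by
  rcases ha with rfl | ⟨rfl, h1, h2⟩ | ⟨rfl, rfl, h1, h2⟩
  · exact one_le_supp γ (by omega)
  · have := supp_card γ (small_entries h γ x (hG γ (by omega)) (by rw [hl]; exact h2) hp)
    have hp2 := hp.two_le
    by_contra hc
    push Not at hc
    have : deg γ ≤ (p - 1) * 1 := this.trans (Nat.mul_le_mul_left _ (by omega))
    omega
  · have := supp_card γ (small_entries h γ x (hG γ (by omega)) (by rw [hl]; exact h2) hp)
    omega

theorem piece_le (hK : IsLocalField K q) [MeasurableSpace K] [BorelSpace K] [SecondCountableTopology K]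
    {P : Measure K} (hP : IsUnif q P) {D : ℕ} {h : (Fin n → ℕ) → (Fin n → K) → K} (H : TS D h) (hn : 0 < n)
    {p : ℕ} (hp : p.Prime)
    {G : ℝ} (hG1 : 1 ≤ G) (hG : ∀ x, ‖x‖ ≤ 1 → ∀ γ, 1 ≤ deg γ → ‖h γ x‖ ≤ G) {Q : ℕ} (hDQ : D ≤ Q)
    (M : ℕ) (i : ℤ) {j : ℕ} (ha : Adm p (‖(p : K)‖ * G) M ((q:ℝ) ^ i) j) (u l : ℝ) :
    (PP P n).real (Epc h M ((q : ℝ) ^ i) (Real.exp (-(u / j * l)))) ≤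
      ((Finset.univ : Finset (Fin n)).piAntidiag (M + 1)).card *
        (((n ^ 3 * (((3 * (n * Q) + 1) ^ 3 + 1) ^ 3) * q ^ 6 : ℕ) : ℝ) * Real.exp (-(u * l))) := by
  have := lf_ultra hK
  have hq := lf_q1 hK
  have hq1 : 1 ≤ q := hK.one_lt.le
  have hj : 1 ≤ j ∧ j ≤ 3 := by
    rcases ha with rfl | ⟨rfl, h1, h2⟩ | ⟨rfl, rfl, h1, h2⟩ <;> omega
  have hd : (j * (n * D) + 1) ^ j < (3 * (n * Q) + 1) ^ 3 + 1 := by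
    refine Nat.lt_succ_of_le ?_
    calc (j * (n * D) + 1) ^ j ≤ (3 * (n * Q) + 1) ^ j := by gcongr; exact hj.2
      _ ≤ _ := Nat.pow_le_pow_right (by omega) hj.2
  refine (neg_piece hK hP H (by linarith) hG j hd M (by positivity) (Real.exp_pos _)
    fun x hx γ h1 h2 => adm_supp hp h (hG x hx) ha γ h1 h2).trans ?_
  have e : (Real.exp (-(u / j * l))) ^ j = Real.exp (-(u * l)) := by
    rw [← Real.exp_nat_mul]
    congr 1
    have : (j : ℝ) ≠ 0 := by exact_mod_cast (by omega : j ≠ 0)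
    field_simp
  rw [mul_pow, e]
  refine mul_le_mul_of_nonneg_left ?_ (Nat.cast_nonneg _)
  push_cast
  have h1 : (n : ℝ) ^ j ≤ n ^ 3 := pow_le_pow_right₀ (by exact_mod_cast hn) hj.2
  have h2 : ((3 * (n * (Q:ℝ)) + 1) ^ 3 + 1) ^ j ≤ ((3 * (n * (Q:ℝ)) + 1) ^ 3 + 1) ^ 3 :=
    pow_le_pow_right₀ (by simp; positivity) hj.2
  have h3 : ((q:ℝ) ^ 2) ^ j ≤ q ^ 6 := by
    rw [← pow_mul]
    exact pow_le_pow_right₀ hq.le (by omega)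
  calc (n:ℝ) ^ j * (((3 * (n * (Q:ℝ)) + 1) ^ 3 + 1) ^ j * (((q:ℝ) ^ 2) ^ j * Real.exp (-(u * l))))
      ≤ n ^ 3 * (((3 * (n * (Q:ℝ)) + 1) ^ 3 + 1) ^ 3 * (q ^ 6 * Real.exp (-(u * l)))) := by gcongr
    _ = _ := by ring

/-- the negligible set -/
def Ng (h : (Fin n → ℕ) → (Fin n → K) → K) (q p k Q : ℕ) (c u l : ℝ) : Set (Fin n → K) :=
  ⋃ M ∈ Finset.range k, ⋃ i ∈ Finset.Icc (-(Q : ℤ)) Q,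
    ⋃ j ∈ (Finset.Icc 1 3).filter (fun j => Adm p c M ((q:ℝ) ^ i) j),
      Epc h M ((q : ℝ) ^ i) (Real.exp (-(u / j * l)))

theorem Ng_le (hK : IsLocalField K q) [MeasurableSpace K] [BorelSpace K] [SecondCountableTopology K]
    {P : Measure K} (hP : IsUnif q P) {D : ℕ} {h : (Fin n → ℕ) → (Fin n → K) → K} (H : TS D h) (hn : 0 < n)
    {p : ℕ} (hp : p.Prime)
    {G : ℝ} (hG1 : 1 ≤ G) (hG : ∀ x, ‖x‖ ≤ 1 → ∀ γ, 1 ≤ deg γ → ‖h γ x‖ ≤ G) {Q : ℕ} (hDQ : D ≤ Q)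
    (k : ℕ) (u l : ℝ) :
    (PP P n).real (Ng h q p k Q (‖(p : K)‖ * G) u l) ≤
      (∑ M ∈ Finset.range k, (((Finset.univ : Finset (Fin n)).piAntidiag (M + 1)).card : ℝ)) * ((2 * Q + 1) *
        (3 * (((n ^ 3 * (((3 * (n * Q) + 1) ^ 3 + 1) ^ 3) * q ^ 6 : ℕ) : ℝ) * Real.exp (-(u * l))))) := by
  have := PP_prob hP n
  set W := (((n ^ 3 * (((3 * (n * Q) + 1) ^ 3 + 1) ^ 3) * q ^ 6 : ℕ) : ℝ) * Real.exp (-(u * l))) with hW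
  have hW0 : 0 ≤ W := by positivity
  rw [Ng, Finset.sum_mul]
  refine (measureReal_biUnion_finset_le _ _).trans (Finset.sum_le_sum fun M _ => ?_)
  refine (measureReal_biUnion_finset_le _ _).trans ?_
  set c := (((Finset.univ : Finset (Fin n)).piAntidiag (M + 1)).card : ℝ) with hc
  have hc0 : 0 ≤ c := Nat.cast_nonneg _
  calc _ ≤ ∑ i ∈ Finset.Icc (-(Q : ℤ)) Q, 3 * (c * W) := by
        refine Finset.sum_le_sum fun i _ => ?_
        refine (measureReal_biUnion_finset_le _ _).trans ?_
        calc _ ≤ ∑ j ∈ (Finset.Icc 1 3).filter (fun j => Adm p (‖(p : K)‖ * G) M ((q:ℝ) ^ i) j), c * W :=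
              Finset.sum_le_sum fun j hj => piece_le hK hP H hn hp hG1 hG hDQ M i (Finset.mem_filter.1 hj).2 u l
          _ ≤ 3 * (c * W) := by
              rw [Finset.sum_const, nsmul_eq_mul]
              gcongr
              have := Finset.card_filter_le (Finset.Icc 1 3) (fun j => Adm p (‖(p : K)‖ * G) M ((q:ℝ) ^ i) j)
              rw [Nat.card_Icc] at this
              exact_mod_cast this
    _ = _ := by
        rw [Finset.sum_const, nsmul_eq_mul, Int.card_Icc]
        have : (((Q : ℤ) + 1 - -(Q:ℤ)).toNat : ℝ) = 2 * Q + 1 := by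
          have : ((Q : ℤ) + 1 - -(Q:ℤ)).toNat = 2 * Q + 1 := by omega
          rw [this]; push_cast; ring
        rw [this]
        ring

theorem poly_exp (k : ℕ) (hk : 0 < k) : ∃ C : ℝ, 0 ≤ C ∧ ∀ L, 0 ≤ L → (1 + L) ^ 10 * Real.exp (-(L / (8 * k ^ 2))) ≤ C := by
  have hkR : (0:ℝ) < k := by exact_mod_cast hk
  set ε : ℝ := 1 / (8 * k ^ 2) with hε
  have hε0 : 0 < ε := by positivity
  refine ⟨(Nat.factorial 10) / ε ^ 10 * Real.exp ε, by positivity, fun L hL => ?_⟩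
  have h1 := Real.pow_div_factorial_le_exp (ε * (1 + L)) (by positivity) 10
  have e : L / (8 * k ^ 2) = ε * L := by rw [hε]; ring
  rw [e, Real.exp_neg, ← div_eq_mul_inv, div_le_iff₀ (Real.exp_pos _), mul_assoc, ← Real.exp_add]
  rw [show ε + ε * L = ε * (1 + L) by ring, div_mul_eq_mul_div, le_div_iff₀ (by positivity)]
  rw [div_le_iff₀ (by positivity), mul_pow] at h1
  nlinarith

theorem W_le (n Q : ℕ) (q : ℕ) (A E : ℝ) (hA : 0 ≤ A) (hE : 0 ≤ E) : A * ((2 * (Q:ℝ) + 1) *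
        (3 * (((n ^ 3 * (((3 * (n * Q) + 1) ^ 3 + 1) ^ 3) * q ^ 6 : ℕ) : ℝ) * E))) ≤
      (A * 6 * n ^ 3 * q ^ 6 * (8 * (3 * n + 1) ^ 9)) * ((Q:ℝ) + 1) ^ 10 * E := by
  push_cast
  set X := (3 * (n:ℝ) + 1) * (Q + 1) with hX
  have h1 : 3 * ((n:ℝ) * Q) + 1 ≤ X := by
    have : (0:ℝ) ≤ n := by positivity
    have : (0:ℝ) ≤ Q := by positivity
    rw [hX]; nlinarith
  have hX1 : 1 ≤ X := by
    have : 0 ≤ 3 * ((n:ℝ) * Q) := by positivity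
    linarith
  have h2 : ((3 * ((n:ℝ) * Q) + 1) ^ 3 + 1) ^ 3 ≤ 8 * X ^ 9 := by
    calc ((3 * ((n:ℝ) * Q) + 1) ^ 3 + 1) ^ 3 ≤ (X ^ 3 + X ^ 3) ^ 3 := by
          gcongr; exact one_le_pow₀ hX1
      _ = 8 * X ^ 9 := by ring
  have h3 : 2 * (Q:ℝ) + 1 ≤ 2 * (Q + 1) := by linarith
  calc A * ((2 * (Q:ℝ) + 1) * (3 * ((n:ℝ) ^ 3 * ((3 * ((n:ℝ) * Q) + 1) ^ 3 + 1) ^ 3 * q ^ 6 * E)))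
      ≤ A * ((2 * (Q + 1)) * (3 * ((n:ℝ) ^ 3 * (8 * X ^ 9) * q ^ 6 * E))) := by gcongr
    _ = _ := by rw [hX]; ring

def WildAt (n q k : ℕ) (G B C : ℝ) : Prop :=
  ∀ (K : Type) [NontriviallyNormedField K] [MeasurableSpace K] [BorelSpace K] [SecondCountableTopology K]
    (_ : IsLocalField K q) (P : Measure K) (_ : IsUnif q P) (D : ℕ) (h : (Fin n → ℕ) → (Fin n → K) → K)
    (_ : TS D h) (p : ℕ) (_ : p.Prime) (_ : p ≤ k) (_ : ∀ m : ℕ, ¬ p ∣ m → ‖(m : K)‖ = 1)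
    (_ : 0 < ‖(p : K)‖) (_ : ‖(p : K)‖ * G < 1)
    (_ : ∀ x, ‖x‖ ≤ 1 → 1 ≤ TM h k x)
    (_ : ∀ x, ‖x‖ ≤ 1 → ∀ γ, 1 ≤ deg γ → ‖h γ x‖ ≤ G) (y : K) (_ : 1 ≤ ‖y‖)
    (_ : (D : ℝ) ≤ B * (1 + Real.log ‖y‖)),
    (PP P n).real (Bad h y) ≤ C * ‖y‖ ^ (-(1 : ℝ) / k)

theorem wild (n q k : ℕ) (hn : 0 < n) (hk : 0 < k) (G B : ℝ) (hG1 : 1 ≤ G) (hB : 0 ≤ B) :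
    ∃ C, 0 ≤ C ∧ WildAt n q k G B C := by
  obtain ⟨C0, hC0, hpe⟩ := poly_exp k hk
  have hkR : (0:ℝ) < k := by exact_mod_cast hk
  obtain ⟨A, hA⟩ : ∃ A, A = (∑ M ∈ Finset.range k, (((Finset.univ : Finset (Fin n)).piAntidiag (M + 1)).card : ℝ)) :=
    ⟨_, rfl⟩
  have hA0 : 0 ≤ A := by rw [hA]; exact Finset.sum_nonneg fun _ _ => Nat.cast_nonneg _
  have hg : 0 ≤ Real.log G := Real.log_nonneg hG1
  obtain ⟨B1, hB1⟩ : ∃ B1, B1 = B + 2 * Real.log G + 4 := ⟨_, rfl⟩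
  obtain ⟨W, hW⟩ : ∃ W : ℝ, W = A * 6 * n ^ 3 * q ^ 6 * (8 * (3 * n + 1) ^ 9) := ⟨_, rfl⟩
  have hW0 : 0 ≤ W := by rw [hW]; positivity
  have hB1' : 0 ≤ B1 := by rw [hB1]; positivity
  refine ⟨Real.exp (8 * Real.log G) + W * (B1 + 2) ^ 10 * C0, by positivity, ?_⟩
  intro K _ _ _ _ hK P hP D h H p hp hpk hres hp0 hpG hT hG y hy hD
  have := PP_prob hP n
  have := lf_ultra hK
  have hq := lf_q1 hK
  set L := Real.log ‖y‖ with hL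
  have hL0 : 0 ≤ L := Real.log_nonneg hy
  set l := L / k with hl
  have hkl : k * l = L := by rw [hl]; field_simp
  have hyE : ‖y‖ = Real.exp (k * l) := by rw [hkl, hL, Real.exp_log (by linarith)]
  have hyp : ‖y‖ ^ (-(1:ℝ) / k) = Real.exp (-l) := by
    rw [hyE, ← Real.exp_mul]
    congr 1
    field_simp
  rw [hyp, add_mul]
  rcases le_or_gt l (8 * Real.log G) with hc | hc
  · have h1 : (PP P n).real (Bad h y) ≤ 1 := measureReal_le_one
    have h2 : 1 ≤ Real.exp (8 * Real.log G) * Real.exp (-l) := by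
      rw [← Real.exp_add]
      exact Real.one_le_exp (by linarith)
    have h3 : 0 ≤ W * (B1 + 2) ^ 10 * C0 * Real.exp (-l) := by positivity
    linarith
  set Q := ⌈B1 * (1 + L)⌉₊ with hQ
  have hQ1 : B1 * (1 + L) ≤ Q := Nat.le_ceil _
  have hQ2 : (Q : ℝ) ≤ B1 * (1 + L) + 1 := (Nat.ceil_lt_add_one (by positivity)).le
  have hDQ : D ≤ Q := by
    have : (D : ℝ) ≤ Q := by
      refine hD.trans (le_trans ?_ hQ1)
      gcongr
      rw [hB1]; linarith
    exact_mod_cast this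
  set u : ℝ := 1 + 1 / (8 * k) with hu
  have hul : u * l * k ≤ 2 * L := by
    have : u ≤ 2 := by
      rw [hu]
      have : (1:ℝ) ≤ k := by exact_mod_cast hk
      have : 1 / (8 * (k:ℝ)) ≤ 1 := by rw [div_le_one (by positivity)]; linarith
      linarith
    calc u * l * k = u * L := by rw [mul_assoc, mul_comm l, hkl]
      _ ≤ _ := by gcongr
  have hqe : ∀ t : ℝ, 2 * t ≤ Q → Real.exp t ≤ (q:ℝ) ^ Q := by
    intro t ht
    have h2q : (2:ℝ) ≤ q := by exact_mod_cast hK.one_lt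
    have : Real.exp (1/2) ≤ q := by
      refine le_trans ?_ h2q
      rw [← Real.le_log_iff_exp_le (by norm_num)]
      linarith [Real.log_two_gt_d9]
    calc Real.exp t ≤ Real.exp (Q * (1/2)) := Real.exp_le_exp.2 (by linarith)
      _ = Real.exp (1/2) ^ Q := Real.exp_nat_mul _ _
      _ ≤ _ := by gcongr
  have hBL : 2 * Real.log G + 4 * L ≤ Q := by
    refine le_trans ?_ hQ1
    rw [hB1]
    nlinarith [mul_nonneg hB hL0, mul_nonneg hg hL0]
  have hGQ : G ≤ (q:ℝ) ^ Q := by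
    have := hqe (Real.log G) (by linarith)
    rwa [Real.exp_log (by linarith)] at this
  have hwQ : ((q:ℝ) ^ Q)⁻¹ ≤ Real.exp (-(u * l * k)) := by
    rw [Real.exp_neg]
    exact inv_anti₀ (Real.exp_pos _) (hqe _ (by linarith))
  have hfac : ∀ m, m ≤ k → 0 < ‖(m.factorial : K)‖ := by
    intro m _
    rcases Nat.eq_zero_or_pos m with rfl | hm
    · simp
    · exact lt_of_lt_of_le (by positivity) (fact_norm_ge hp hres m hm)
  have hsub : (PP P n).real (Bad h y) ≤ (PP P n).real (Ng h q p k Q (‖(p : K)‖ * G) u l) := by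
    refine real_le_of_ae hP fun x hx hb => ?_
    by_contra hng
    refine good_pt hK hp hpk hres hp0 h hG1 hpG hfac hx
      (fun m hm => (NM_le h (by linarith)).2 fun γ hγ => hG x hx γ (by omega)) (hT x hx) hu hyE hc hGQ hwQ ?_ hb
    intro M h1 h2 i hi j ha hE
    apply hng
    have hj : j ∈ Finset.Icc 1 3 := by
      rw [Finset.mem_Icc]
      rcases ha with rfl | ⟨rfl, h1, h2⟩ | ⟨rfl, rfl, h1, h2⟩ <;> omega
    exact Set.mem_iUnion₂.2 ⟨M, Finset.mem_range.2 h2, Set.mem_iUnion₂.2 ⟨i, hi,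
      Set.mem_iUnion₂.2 ⟨j, Finset.mem_filter.2 ⟨hj, ha⟩, hE⟩⟩⟩
  refine hsub.trans ((Ng_le hK hP H hn hp hG1 hG hDQ k u l).trans ?_)
  rw [← hA]
  refine (W_le n Q q A (Real.exp (-(u * l))) hA0 (Real.exp_nonneg _)).trans ?_
  rw [← hW]
  have hQ3 : (Q:ℝ) + 1 ≤ (B1 + 2) * (1 + L) := by nlinarith
  have hexp : Real.exp (-(u * l)) = Real.exp (-(L / (8 * k ^ 2))) * Real.exp (-l) := by
    rw [← Real.exp_add]
    congr 1
    rw [hu, hl]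
    field_simp
    ring
  have h9 : 0 ≤ Real.exp (8 * Real.log G) * Real.exp (-l) := by positivity
  have hfin : W * ((Q:ℝ) + 1) ^ 10 * Real.exp (-(u * l)) ≤ W * (B1 + 2) ^ 10 * C0 * Real.exp (-l) := by
    calc W * ((Q:ℝ) + 1) ^ 10 * Real.exp (-(u * l))
        ≤ W * ((B1 + 2) * (1 + L)) ^ 10 * Real.exp (-(u * l)) := by gcongr
      _ = W * (B1 + 2) ^ 10 * ((1 + L) ^ 10 * Real.exp (-(L / (8 * k ^ 2)))) * Real.exp (-l) := by
          rw [hexp]; ring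
      _ ≤ _ := by gcongr; exact hpe L hL0
  linarith

end VdC9
end

section
open MeasureTheory Filter VdC
open scoped NNReal ENNReal Classical
namespace VdC9
variable {K : Type} [NontriviallyNormedField K] {q n : ℕ}

theorem q_exp (hq : 1 < q) {t : ℝ} {Q : ℕ} (ht : 2 * t ≤ Q) : Real.exp t ≤ (q:ℝ) ^ Q := by
  have h2q : (2:ℝ) ≤ q := by exact_mod_cast hq
  have : Real.exp (1/2) ≤ q := by
    refine le_trans ?_ h2q
    rw [← Real.le_log_iff_exp_le (by norm_num)]
    linarith [Real.log_two_gt_d9]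
  calc Real.exp t ≤ Real.exp (Q * (1/2)) := Real.exp_le_exp.2 (by linarith)
    _ = Real.exp (1/2) ^ Q := Real.exp_nat_mul _ _
    _ ≤ _ := by gcongr

theorem um_sum_le [IsUltrametricDist K] {ι : Type*} (s : Finset ι) (f : ι → K) {B : ℝ} (hB : 0 ≤ B)
    (h : ∀ i ∈ s, ‖f i‖ ≤ B) : ‖∑ i ∈ s, f i‖ ≤ B := by
  by_contra hc
  push Not at hc
  exact lt_irrefl _ (um_sum_lt s f (lt_of_le_of_lt hB hc) fun i hi => (h i hi).trans_lt hc)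

theorem TM_close [IsUltrametricDist K] (h h' : (Fin n → ℕ) → (Fin n → K) → K) {M : ℕ} {x : Fin n → K} {e : ℝ}
    (hd : ∀ γ, deg γ = M → ‖h γ x - h' γ x‖ < e) (hT : e ≤ TM h M x) (he : 0 < e) : TM h M x ≤ TM h' M x := by
  obtain ⟨γ, h1, h2⟩ := exists_TM h (he.trans_le hT)
  have h3 : ‖Tf h γ x - Tf h' γ x‖ < e := by
    rw [Tf, Tf, ← mul_sub, norm_mul]
    exact lt_of_le_of_lt (mul_le_of_le_one_left (norm_nonneg _) (nat_norm_le _)) (hd γ h1)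
  have h4 : ‖Tf h' γ x‖ = ‖Tf h γ x‖ := um_eq (by rw [norm_sub_rev, h2]; exact h3.trans_le hT)
  rw [← h2, ← h4]
  exact le_TM h' h1 x

theorem NM_close [IsUltrametricDist K] (h h' : (Fin n → ℕ) → (Fin n → K) → K) {M : ℕ} {x : Fin n → K} {e : ℝ}
    (hd : ∀ γ, deg γ = M → ‖h γ x - h' γ x‖ < e) (hT : e ≤ NM h M x) (he : 0 < e) : NM h M x ≤ NM h' M x := by
  obtain ⟨γ, h1, h2⟩ := exists_NM h (he.trans_le hT)
  have h3 := hd γ h1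
  have h4 : ‖h' γ x‖ = ‖h γ x‖ := um_eq (by rw [norm_sub_rev, h2]; exact h3.trans_le hT)
  rw [← h2, ← h4]
  exact le_NM h' h1 x

theorem trunc_bad [IsUltrametricDist K] (h h' : (Fin n → ℕ) → (Fin n → K) → K) {x : Fin n → K} {y : K} (hy : y ≠ 0)
    (hd : ∀ γ, 1 ≤ deg γ → ‖h γ x - h' γ x‖ < ‖y‖⁻¹) (hb : x ∈ Bad h y) : x ∈ Bad h' y := by
  have hyp : 0 < ‖y‖ := norm_pos_iff.2 hy
  have he : 0 < ‖y‖⁻¹ := inv_pos.2 hyp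
  by_contra hc
  rw [Bad, Set.mem_ofPred_eq] at hc
  push Not at hc
  obtain ⟨c1, c2⟩ := hc
  have c1' : ‖y‖⁻¹ ≤ TM h' 1 x := by
    rwa [inv_le_iff_one_le_mul₀' hyp]
  have t1 : TM h' 1 x ≤ TM h 1 x := TM_close h' h (fun γ hγ => by rw [norm_sub_rev]; exact hd γ hγ.ge) c1' he
  rcases hb with hb | ⟨m, hm, hb⟩
  · have : ‖y‖ * TM h' 1 x ≤ ‖y‖ * TM h 1 x := by gcongr
    linarith
  · have t2 : ‖y‖ ^ (m - 1) * TM h' 1 x ^ m ≤ ‖y‖ ^ (m - 1) * TM h 1 x ^ m := by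
      gcongr
      exact TM_nonneg _ _ _
    have t3 : ‖y‖⁻¹ ≤ ‖y‖ ^ (m - 1) * TM h' 1 x ^ m := by
      calc ‖y‖⁻¹ = ‖y‖ ^ (m - 1) * ‖y‖⁻¹ ^ m := by
            obtain ⟨d, rfl⟩ : ∃ d, m = d + 1 := ⟨m - 1, by omega⟩
            rw [Nat.add_sub_cancel, pow_succ, ← mul_assoc, ← mul_pow, mul_inv_cancel₀ hyp.ne', one_pow, one_mul]
        _ ≤ _ := by gcongr
    have t4 := NM_close h h' (fun γ hγ => hd γ (by omega)) (t3.trans (t2.trans hb)) he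
    have := c2 m hm
    linarith

/-- truncation of a system to small degrees -/
theorem trunc_sys [IsUltrametricDist K] {D D' : ℕ} {h : (Fin n → ℕ) → (Fin n → K) → K} (H : TS D h) (hD' : 1 ≤ D') (hDD : D' < D)
    {G e : ℝ} (he : 0 < e) (hG : ∀ γ, 1 ≤ deg γ → ‖h γ 0‖ ≤ G) (hG0 : 0 ≤ G) (hs : ∀ γ, γ ∉ Box n D' → ‖h γ 0‖ < e) :
    ∃ h' : (Fin n → ℕ) → (Fin n → K) → K, TS D' h' ∧ (∀ x, ‖x‖ ≤ 1 → ∀ γ, 1 ≤ deg γ → ‖h' γ x‖ ≤ G) ∧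
      ∀ x, ‖x‖ ≤ 1 → ∀ γ, ‖h γ x - h' γ x‖ < e := by
  set a : (Fin n → ℕ) → K := fun γ => if γ ∈ Box n D' then h γ 0 else 0 with ha
  have hterm : ∀ (m : ℕ) (z : K) (x : Fin n → K), ‖x‖ ≤ 1 → ∀ δ, ‖(m : K) * z * mon x δ‖ ≤ ‖z‖ := by
    intro m z x hx δ
    rw [norm_mul, norm_mul]
    have h1 := nat_norm_le (K := K) m
    have h2 : ‖mon x δ‖ ≤ 1 := (mon_norm_le x δ).trans (pow_le_one₀ (norm_nonneg _) hx)
    calc ‖(m:K)‖ * ‖z‖ * ‖mon x δ‖ ≤ 1 * ‖z‖ * 1 := by gcongr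
      _ = ‖z‖ := by ring
  refine ⟨hsys D' a, TS_hsys hD' a fun γ hγ => by simp [ha, hγ], ?_, ?_⟩
  · intro x hx γ hγ
    refine um_sum_le _ _ hG0 fun δ _ => (hterm _ _ x hx δ).trans ?_
    simp only [ha]
    split_ifs
    · exact hG _ (by rw [deg_add]; omega)
    · simpa using hG0
  · intro x hx γ
    have e1 : hsys D' a γ x = ∑ δ ∈ Box n D, (chs δ γ : K) * a (δ + γ) * mon x δ := by
      rw [hsys]
      refine Finset.sum_subset ?_ ?_
      · intro δ hδ
        rw [mem_Box] at hδ ⊢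
        exact fun i => (hδ i).trans hDD.le
      · intro δ _ hδ
        have : δ + γ ∉ Box n D' := fun hc => hδ (by
          rw [mem_Box] at hc ⊢
          intro i
          exact le_trans (Nat.le_add_right _ _) (hc i))
        simp [ha, this]
    have e2 := H.taylor γ 0 x
    rw [zero_add] at e2
    rw [e2, e1, ← Finset.sum_sub_distrib]
    refine um_sum_lt _ _ he fun δ _ => ?_
    rw [← sub_mul, ← mul_sub]
    refine (hterm _ _ x hx δ).trans_lt ?_
    simp only [ha]
    split_ifs with hc
    · simpa using he
    · rw [sub_zero]
      exact hs _ hc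

theorem wild_local (n q k : ℕ) (hn : 0 < n) (hk : 0 < k) (G : ℝ) (hG1 : 1 ≤ G) :
    ∃ C, 0 ≤ C ∧ ∀ (K : Type) [NontriviallyNormedField K] [MeasurableSpace K] [BorelSpace K] [SecondCountableTopology K]
    (_ : IsLocalField K q) (P : Measure K) (_ : IsUnif q P) (D : ℕ) (h : (Fin n → ℕ) → (Fin n → K) → K)
    (_ : TS D h) (p : ℕ) (_ : p.Prime) (_ : p ≤ k) (_ : ∀ m : ℕ, ¬ p ∣ m → ‖(m : K)‖ = 1)
    (_ : 0 < ‖(p : K)‖) (_ : ‖(p : K)‖ * G < 1)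
    (_ : ∀ x, ‖x‖ ≤ 1 → 1 ≤ TM h k x)
    (_ : ∀ x, ‖x‖ ≤ 1 → ∀ γ, 1 ≤ deg γ → ‖h γ x‖ ≤ G * (q:ℝ)⁻¹ ^ deg γ) (y : K) (_ : 1 ≤ ‖y‖),
    (PP P n).real (Bad h y) ≤ C * ‖y‖ ^ (-(1 : ℝ) / k) := by
  have hg : 0 ≤ Real.log G := Real.log_nonneg hG1
  obtain ⟨C, hC, hW⟩ := wild n q k hn hk G (2 * Real.log G + 2) hG1 (by positivity)
  refine ⟨C, hC, ?_⟩
  intro K _ _ _ _ hK P hP D h H p hp hpk hres hp0 hpG hT hG y hy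
  have := lf_ultra hK
  have := PP_prob hP n
  have hq := lf_q1 hK
  have hyp : 0 < ‖y‖ := by linarith
  have hy0 : y ≠ 0 := norm_pos_iff.1 hyp
  have hL0 : 0 ≤ Real.log ‖y‖ := Real.log_nonneg hy
  have hqi : (q:ℝ)⁻¹ ≤ 1 := inv_le_one_of_one_le₀ hq.le
  have hqi0 : 0 < (q:ℝ)⁻¹ := by positivity
  have hG' : ∀ x, ‖x‖ ≤ 1 → ∀ γ, 1 ≤ deg γ → ‖h γ x‖ ≤ G := fun x hx γ hγ =>
    (hG x hx γ hγ).trans (mul_le_of_le_one_right (by linarith) (pow_le_one₀ hqi0.le hqi))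
  set t := Real.log G + Real.log ‖y‖ with ht
  set D' := ⌈2 * t⌉₊ + 1 with hD'
  have hb1 : 2 * t ≤ ⌈2 * t⌉₊ := Nat.le_ceil _
  have hb2 : ((⌈2 * t⌉₊ : ℕ) : ℝ) ≤ 2 * t + 1 := (Nat.ceil_lt_add_one (by positivity)).le
  have hb3 : (D' : ℝ) ≤ (2 * Real.log G + 2) * (1 + Real.log ‖y‖) := by
    rw [hD']
    push_cast
    nlinarith [mul_nonneg hg hL0]
  have hGy : G * ‖y‖ ≤ (q:ℝ) ^ ⌈2 * t⌉₊ := by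
    have := q_exp hK.one_lt hb1
    rwa [ht, Real.exp_add, Real.exp_log (by linarith), Real.exp_log hyp] at this
  rcases le_or_gt D D' with hc | hc
  · exact hW K hK P hP D h H p hp hpk hres hp0 hpG hT hG' y hy
      (le_trans (by exact_mod_cast hc) hb3)
  · obtain ⟨h', H', hb, hcl⟩ := trunc_sys H (by omega : 1 ≤ D') hc (G := G) (e := ‖y‖⁻¹) (inv_pos.2 hyp)
      (hG' 0 (by simp)) (by linarith) (by
        intro γ hγ
        rw [mem_Box] at hγ
        push Not at hγ
        obtain ⟨i, hi⟩ := hγ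
        have hdeg : D' < deg γ := lt_of_lt_of_le hi (Finset.single_le_sum (f := γ) (fun _ _ => Nat.zero_le _) (Finset.mem_univ i))
        refine (hG 0 (by simp) γ (by omega)).trans_lt ?_
        rw [lt_inv_comm₀ (mul_pos (by linarith) (by positivity)) hyp, mul_inv, ← inv_pow, inv_inv,
          lt_inv_mul_iff₀ (by linarith)]
        exact hGy.trans_lt (pow_lt_pow_right₀ hq (by omega)))
    have hyi : ‖y‖⁻¹ ≤ 1 := inv_le_one_of_one_le₀ hy
    have h1 := hW K hK P hP D' h' H' p hp hpk hres hp0 hpG (by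
      intro x hx
      exact (hT x hx).trans (TM_close h h' (fun γ _ => hcl x hx γ) (hyi.trans (hT x hx)) (inv_pos.2 hyp))) hb y hy hb3
    refine le_trans (real_le_of_ae hP fun x hx hxb => ?_) h1
    exact trunc_bad h h' hy0 (fun γ _ => hcl x hx γ) hxb

end VdC9
end

section
open MeasureTheory Filter VdC
open scoped NNReal ENNReal Classical
namespace VdC9

theorem bad_bound (n q k : ℕ) (hn : 0 < n) (hk : 0 < k) (hq1 : 1 < q) (G : ℝ) (hG1 : 1 ≤ G) :
    ∃ C, 0 ≤ C ∧ ∀ (K : Type) [NontriviallyNormedField K] [MeasurableSpace K] [BorelSpace K] [SecondCountableTopology K]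
    (_ : IsLocalField K q) (_ : CharCond K k) (P : Measure K) (_ : IsUnif q P) (D : ℕ)
    (h : (Fin n → ℕ) → (Fin n → K) → K) (_ : TS D h)
    (_ : ∀ x, ‖x‖ ≤ 1 → 1 ≤ TM h k x)
    (_ : ∀ x, ‖x‖ ≤ 1 → ∀ γ, 1 ≤ deg γ → ‖h γ x‖ ≤ G) (y : K) (_ : y ≠ 0),
    (PP P n).real (Bad h y) ≤ C * ‖y‖ ^ (-(1 : ℝ) / k) := by
  have hqR : (1:ℝ) < q := by exact_mod_cast hq1
  have hkR : (0:ℝ) < k := by exact_mod_cast hk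
  obtain ⟨G2, hG2⟩ : ∃ G2, G2 = G * (q:ℝ) ^ k := ⟨_, rfl⟩
  have hG21 : 1 ≤ G2 := by
    rw [hG2]
    exact one_le_mul_of_one_le_of_one_le hG1 (one_le_pow₀ hqR.le)
  obtain ⟨C1, hC1, hTame⟩ := tame n q k hq1 hk G (G2 ^ k)
  obtain ⟨C2, hC2, hWild⟩ := wild_local n q k hn hk G2 hG21
  refine ⟨C1 + (C2 * q + q), by positivity, ?_⟩
  intro K _ _ _ _ hK hch P hP D h H hT hG y hy
  have := lf_ultra hK
  have := PP_prob hP n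
  have hyp : 0 < ‖y‖ := norm_pos_iff.2 hy
  obtain ⟨p, hp, hp1, hres⟩ := exists_resp hK
  have hs0 : 0 < ‖y‖ ^ (-(1 : ℝ) / k) := by positivity
  by_cases hcase : 1 ≤ G2 ^ k * ‖(k.factorial : K)‖
  · refine (hTame K hK P hP D h H hT (fun x hx m hm => (NM_le h (by linarith)).2 fun γ hγ => hG x hx γ (by omega))
      hcase y hy).trans ?_
    gcongr
    have : 0 ≤ C2 * q + q := by positivity
    linarith
  have hpk : p ≤ k := by
    by_contra hc
    push Not at hc
    apply hcase
    rw [fact_norm_lt hp hres k hc, mul_one]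
    exact one_le_pow₀ hG21
  have hpG : ‖(p : K)‖ * G2 < 1 := by
    by_contra hc
    push Not at hc
    apply hcase
    have h1 := fact_norm_ge (K := K) hp hres k hk
    calc (1:ℝ) ≤ (‖(p : K)‖ * G2) ^ k := one_le_pow₀ hc
      _ = G2 ^ k * ‖(p : K)‖ ^ k := by rw [mul_pow]; ring
      _ ≤ _ := by gcongr
  have hp0 : 0 < ‖(p : K)‖ := by
    rw [norm_pos_iff]
    intro h0
    exact hp.ne_zero (hch p hpk h0)
  have hqk : ((q:ℝ) ^ k) ^ (-(1 : ℝ) / k) = (q:ℝ)⁻¹ := by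
    rw [← Real.rpow_natCast, ← Real.rpow_mul (by linarith)]
    rw [show (k:ℝ) * (-1 / k) = -1 by field_simp, Real.rpow_neg_one]
  have hneg : -(1:ℝ) / k ≤ 0 := div_nonpos_of_nonpos_of_nonneg (by norm_num) hkR.le
  rcases lt_or_ge ‖y‖ ((q:ℝ) ^ k) with hsm | hbig
  · have h1 : (PP P n).real (Bad h y) ≤ 1 := measureReal_le_one
    have h2 : (q:ℝ)⁻¹ ≤ ‖y‖ ^ (-(1 : ℝ) / k) := by
      rw [← hqk]
      exact Real.rpow_le_rpow_of_nonpos hyp hsm.le hneg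
    have h3 : 1 ≤ q * ‖y‖ ^ (-(1 : ℝ) / k) := by
      rwa [← inv_le_iff_one_le_mul₀' (by linarith)]
    have h4 : 0 ≤ C1 * ‖y‖ ^ (-(1 : ℝ) / k) := by positivity
    have h5 : 0 ≤ C2 * q * ‖y‖ ^ (-(1 : ℝ) / k) := by positivity
    nlinarith
  obtain ⟨π, hπ⟩ := hK.exists_unif
  have hπ0 : π ≠ 0 := by
    rw [← norm_pos_iff, hπ]; positivity
  have hπ1 : ‖π‖ ≤ 1 := by rw [hπ]; exact inv_le_one_of_one_le₀ hqR.le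
  have hmul : ∀ u : Fin n → K, ‖u‖ ≤ 1 → ‖π • u‖ ≤ 1 := fun u hu => by
    rw [norm_smul]
    exact mul_le_one₀ hπ1 (norm_nonneg _) hu
  have key : (PP P n).real (Bad h y) ≤ (C2 * (q * ‖y‖ ^ (-(1 : ℝ) / k))) * (PP P n).real Set.univ := by
    refine PP_slice_le' hP (fun u : Fin n → K => π • u) (measurable_const_smul π) hmul (Bad_meas H y)
      MeasurableSet.univ (fun _ _ _ _ _ => Set.mem_univ _) _ (by positivity) ?_
    intro x _ hx
    have hadd : ∀ u : Fin n → K, ‖u‖ ≤ 1 → ‖x + π • u‖ ≤ 1 := fun u hu =>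
      (IsUltrametricDist.norm_add_le_max _ _).trans (max_le hx (hmul u hu))
    set c : K := (π ^ k)⁻¹ with hc
    have hc0 : c ≠ 0 := inv_ne_zero (pow_ne_zero _ hπ0)
    have hcn : ‖c‖ = (q:ℝ) ^ k := by rw [hc, norm_inv, norm_pow, hπ, inv_pow, inv_inv]
    have hyc : ‖y / c‖ = ‖y‖ / (q:ℝ) ^ k := by rw [norm_div, hcn]
    have h1 := hWild K hK P hP D (resc h x π c) (TS_scale H x π c) p hp hpk hres hp0 hpG (by
      intro t ht
      rw [TM_resc, hcn, hπ, ← mul_pow, mul_inv_cancel₀ (by positivity), one_pow, one_mul]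
      exact hT _ (hadd t ht)) (by
      intro t ht γ hγ
      rw [resc, norm_mul, norm_mul, norm_pow, hcn, hπ, hG2]
      have := hG _ (hadd t ht) γ hγ
      calc (q:ℝ) ^ k * (q:ℝ)⁻¹ ^ deg γ * ‖h γ (x + π • t)‖ ≤ (q:ℝ) ^ k * (q:ℝ)⁻¹ ^ deg γ * G := by gcongr
        _ = _ := by ring) (y / c) (by rw [hyc, one_le_div (by positivity)]; exact hbig)
    rw [hyc, Real.div_rpow hyp.le (by positivity), hqk, div_inv_eq_mul (‖y‖ ^ (-(1 : ℝ) / k)) (q:ℝ), mul_comm (‖y‖ ^ _)] at h1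
    refine le_trans ?_ h1
    refine measureReal_mono ?_ (measure_ne_top _ _)
    intro u hu
    exact Bad_resc h x π c y hπ1 hc0 u hu.2
  rw [probReal_univ, mul_one] at key
  have h4 : 0 ≤ C1 * ‖y‖ ^ (-(1 : ℝ) / k) := by positivity
  have h5 : 0 ≤ q * ‖y‖ ^ (-(1 : ℝ) / k) := by positivity
  nlinarith

/-- finite averages -/
theorem avg_bound (n q k : ℕ) (hn : 0 < n) (hk : 0 < k) (hq1 : 1 < q) (G : ℝ) (hG1 : 1 ≤ G) :
    ∃ C, 0 ≤ C ∧ ∀ (K : Type) [NontriviallyNormedField K]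
    (_ : IsLocalField K q) (_ : CharCond K k) (ψ : K → ℂ) (_ : IsAddChar ψ) (D : ℕ)
    (h : (Fin n → ℕ) → (Fin n → K) → K) (_ : TS D h)
    (_ : ∀ x, ‖x‖ ≤ 1 → 1 ≤ TM h k x)
    (_ : ∀ x, ‖x‖ ≤ 1 → ∀ γ, 1 ≤ deg γ → ‖h γ x‖ ≤ G) (y : K) (_ : y ≠ 0)
    (S : Finset (Fin n → K)) (_ : S.Nonempty) (_ : ∀ s ∈ S, ‖s‖ ≤ 1)
    (_ : ∀ x, ‖x‖ ≤ 1 → ∑ s ∈ S, ψ (y * h 0 (s + x)) = ∑ s ∈ S, ψ (y * h 0 s)),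
    ‖(S.card : ℂ)⁻¹ * ∑ s ∈ S, ψ (y * h 0 s)‖ ≤ C * ‖y‖ ^ (-(1 : ℝ) / k) := by
  obtain ⟨C, hC, hB⟩ := bad_bound n q k hn hk hq1 G hG1
  refine ⟨C, hC, ?_⟩
  intro K _ hK hch ψ hψ D h H hT hG y hy S hS hS1 hSum
  let _ : MeasurableSpace K := borel K
  have : BorelSpace K := ⟨rfl⟩
  have := lf_proper hK
  have : SecondCountableTopology K := secondCountable_of_proper
  obtain ⟨P, hP⟩ := exists_unifP hK
  have := PP_prob hP n
  refine le_trans (le_of_eq ?_) ((osc_bound hK hP hψ H y hy).trans (hB K hK hch P hP D h H hT hG y hy))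
  congr 1
  have hcont : Continuous fun x => ψ (y * h 0 x) := by
    have := TS_cont H 0
    exact hψ.cont.comp (continuous_const.mul this)
  have hintS : ∀ s ∈ S, ∫ x, ψ (y * h 0 (s + x)) ∂(PP P n) = ∫ x, ψ (y * h 0 x) ∂(PP P n) := by
    intro s hs
    exact (PP_inv hP n s (hS1 s hs)).integral_comp (measurableEmbedding_addLeft s) (fun x => ψ (y * h 0 x))
  have hI : ∀ s ∈ S, Integrable (fun x => ψ (y * h 0 (s + x))) (PP P n) := by
    intro s _
    refine (integrable_const (1:ℝ)).mono' (hcont.comp (continuous_const.add continuous_id)).aestronglyMeasurable ?_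
    exact Eventually.of_forall fun x => (hψ.norm_eq _).le
  have h1 : ∫ x, ∑ s ∈ S, ψ (y * h 0 (s + x)) ∂(PP P n) = S.card * ∫ x, ψ (y * h 0 x) ∂(PP P n) := by
    rw [integral_finsetSum _ hI, Finset.sum_congr rfl hintS, Finset.sum_const, nsmul_eq_mul]
  have h2 : ∫ x, ∑ s ∈ S, ψ (y * h 0 (s + x)) ∂(PP P n) = ∑ s ∈ S, ψ (y * h 0 s) := by
    have : ∀ᵐ x ∂(PP P n), ∑ s ∈ S, ψ (y * h 0 (s + x)) = ∑ s ∈ S, ψ (y * h 0 s) := by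
      filter_upwards [PP_supp hP n] with x hx using hSum x hx
    rw [integral_congr_ae this, integral_const, probReal_univ, one_smul]
  rw [← h2, h1, ← mul_assoc, inv_mul_cancel₀, one_mul]
  exact_mod_cast hS.card_pos.ne'

end VdC9
end

section
open MeasureTheory Filter VdC
open scoped NNReal ENNReal Classical
namespace VdC9
variable {n : ℕ}

section
variable {K : Type} [NontriviallyNormedField K] {q : ℕ}

theorem mem_polydisc (x : Fin n → K) : x ∈ polydisc K n ↔ ‖x‖ ≤ 1 := by
  rw [pi_norm_le_iff_of_nonneg zero_le_one]
  rfl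

theorem mon_norm_one {x : Fin n → K} (hx : ‖x‖ ≤ 1) (δ : Fin n → ℕ) : ‖mon x δ‖ ≤ 1 :=
  (mon_norm_le x δ).trans (pow_le_one₀ (norm_nonneg _) hx)

theorem mps_approx (hK : IsLocalField K q) {b b' : (Fin n → ℕ) → K} (hb : MIsConvergent b) {D : ℕ} {e : ℝ}
    (he : 0 ≤ e) (h1 : ∀ δ ∈ Box n D, ‖b δ - b' δ‖ ≤ e) (h2 : ∀ δ, δ ∉ Box n D → ‖b δ‖ ≤ e)
    {x : Fin n → K} (hx : ‖x‖ ≤ 1) :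
    ‖mpseval b x - ∑ δ ∈ Box n D, b' δ * mon x δ‖ ≤ e := by
  have := lf_ultra hK
  have := hK.complete
  have hS : Summable fun i : Fin n → ℕ => b i * mon x i := by
    apply NonarchimedeanAddGroup.summable_of_tendsto_cofinite_zero
    rw [tendsto_zero_iff_norm_tendsto_zero]
    refine squeeze_zero (fun _ => norm_nonneg _) (fun i => ?_) hb
    rw [norm_mul]
    exact mul_le_of_le_one_right (norm_nonneg _) (mon_norm_one hx i)
  have hT : Tendsto (fun s : Finset (Fin n → ℕ) => ∑ i ∈ s, b i * mon x i) atTop (nhds (mpseval b x)) :=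
    hS.hasSum
  have hT2 := (hT.sub_const (∑ δ ∈ Box n D, b' δ * mon x δ)).norm
  refine le_of_tendsto hT2 ?_
  filter_upwards [eventually_ge_atTop (Box n D)] with s hs
  rw [← Finset.sum_sdiff hs, add_sub_assoc, ← Finset.sum_sub_distrib]
  refine (IsUltrametricDist.norm_add_le_max _ _).trans (max_le ?_ ?_)
  · refine um_sum_le _ _ he fun i hi => ?_
    rw [norm_mul]
    exact (mul_le_of_le_one_right (norm_nonneg _) (mon_norm_one hx i)).trans (h2 i (Finset.mem_sdiff.1 hi).2)
  · refine um_sum_le _ _ he fun i hi => ?_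
    rw [← sub_mul, norm_mul]
    exact (mul_le_of_le_one_right (norm_nonneg _) (mon_norm_one hx i)).trans (h1 i hi)

theorem mpderiv_norm_le [IsUltrametricDist K] (a : (Fin n → ℕ) → K) (α i : Fin n → ℕ) :
    ‖mpderiv a α i‖ ≤ ‖a (i + α)‖ := by
  rw [mpderiv, norm_mul]
  exact mul_le_of_le_one_left (norm_nonneg _) (nat_norm_le _)

theorem mpderiv_conv [IsUltrametricDist K] {a : (Fin n → ℕ) → K} (ha : MIsConvergent a) (α : Fin n → ℕ) :
    MIsConvergent (mpderiv a α) :=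
  squeeze_zero (fun _ => norm_nonneg _) (fun i => mpderiv_norm_le a α i)
    (Tendsto.comp (g := fun i => ‖a i‖) ha (add_left_injective α).tendsto_cofinite)

theorem conv_box {a : (Fin n → ℕ) → K} (ha : MIsConvergent a) {e : ℝ} (he : 0 < e) :
    ∃ D, 1 ≤ D ∧ ∀ δ, δ ∉ Box n D → ‖a δ‖ ≤ e := by
  have h : ∀ᶠ i in cofinite, ‖a i‖ < e := ha.eventually (gt_mem_nhds he)
  rw [eventually_cofinite] at h
  refine ⟨1 + ∑ δ ∈ h.toFinset, deg δ, by omega, fun δ hδ => ?_⟩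
  by_contra hc
  apply hδ
  have hm : δ ∈ h.toFinset := by
    rw [Set.Finite.mem_toFinset]
    intro h2
    exact hc h2.le
  rw [mem_Box]
  intro i
  have h1 : δ i ≤ deg δ := Finset.single_le_sum (f := δ) (fun _ _ => Nat.zero_le _) (Finset.mem_univ i)
  have h2 : deg δ ≤ ∑ δ ∈ h.toFinset, deg δ := Finset.single_le_sum (f := deg) (fun _ _ => Nat.zero_le _) hm
  omega

theorem le_mgauss {a : (Fin n → ℕ) → K} (ha : MIsConvergent a) {i : Fin n → ℕ} (hi : i ≠ 0) :
    ‖a i‖ ≤ mgauss (mtail a) := by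
  obtain ⟨D, -, hD⟩ := conv_box ha one_pos
  have hB : BddAbove (Set.range fun i => ‖mtail a i‖) := by
    refine ⟨1 + ∑ δ ∈ Box n D, ‖a δ‖, ?_⟩
    rintro _ ⟨j, rfl⟩
    have h0 : 0 ≤ ∑ δ ∈ Box n D, ‖a δ‖ := Finset.sum_nonneg fun _ _ => norm_nonneg _
    simp only [mtail]
    split_ifs with h
    · rw [norm_zero]; linarith
    · by_cases hj : j ∈ Box n D
      · have := Finset.single_le_sum (f := fun δ => ‖a δ‖) (fun _ _ => norm_nonneg _) hj
        linarith
      · have := hD j hj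
        linarith
  have := le_ciSup hB i
  have e : mtail a i = a i := by simp [mtail, hi]
  rw [← e]
  exact this

theorem gauss_ge_one (hK : IsLocalField K q) {a : (Fin n → ℕ) → K} (ha : MIsConvergent a) {α : Fin n → ℕ}
    (hα : α ≠ 0) (h : 1 ≤ ‖mpseval (mpderiv a α) 0‖) : 1 ≤ mgauss (mtail a) := by
  have := lf_ultra hK
  have hb : ∀ i, ‖mpderiv a α i‖ ≤ mgauss (mtail a) := by
    intro i
    refine (mpderiv_norm_le a α i).trans (le_mgauss ha ?_)
    intro h0
    apply hα
    ext j
    have := congrFun h0 j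
    simp at this
    simp [this.2]
  have := mps_approx hK (b' := fun _ => 0) (D := 0) (mpderiv_conv ha α)
    ((norm_nonneg _).trans (hb 0)) (fun δ _ => by simpa using hb δ) (fun δ _ => hb δ) (x := 0) (by simp)
  simp only [zero_mul, Finset.sum_const_zero, sub_zero] at this
  exact h.trans this

theorem fac_mul_chs (δ α : Fin n → ℕ) : fac α * chs δ α = ∏ j, (δ j + α j).descFactorial (α j) := by
  rw [fac, chs, ← Finset.prod_mul_distrib]
  exact Finset.prod_congr rfl fun j _ => (Nat.descFactorial_eq_factorial_mul_choose _ _).symm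

theorem trunc (hK : IsLocalField K q) {a : (Fin n → ℕ) → K} (ha : MIsConvergent a) {α : Fin n → ℕ} {k : ℕ}
    (hk : 0 < k) (hα : deg α = k) (h : ∀ x : Fin n → K, ‖x‖ ≤ 1 → 1 ≤ ‖mpseval (mpderiv a α) x‖)
    {e : ℝ} (he : 0 < e) (he1 : e < 1) :
    ∃ D h, TS D h ∧ (∀ x : Fin n → K, ‖x‖ ≤ 1 → 1 ≤ TM h k x) ∧
      (∀ x : Fin n → K, ‖x‖ ≤ 1 → ∀ γ, 1 ≤ deg γ → ‖h γ x‖ ≤ mgauss (mtail a)) ∧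
      ∀ x : Fin n → K, ‖x‖ ≤ 1 → ‖mpseval a x - h 0 x‖ ≤ e := by
  have := lf_ultra hK
  obtain ⟨D, hD1, hD⟩ := conv_box ha he
  obtain ⟨a', ha'⟩ : ∃ a' : (Fin n → ℕ) → K, a' = fun i => if i ∈ Box n D then a i else 0 := ⟨_, rfl⟩
  have haa : ∀ i, ‖a i - a' i‖ ≤ e := by
    intro i
    rw [ha']
    simp only
    split_ifs with hi
    · simpa using he.le
    · simpa using hD i hi
  have hal : ∀ i, ‖a' i‖ ≤ ‖a i‖ := by
    intro i
    rw [ha']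
    simp only
    split_ifs with hi
    · exact le_rfl
    · simp
  have hα0 : α ≠ 0 := by
    rintro rfl
    simp [deg] at hα
    omega
  have hG0 : 0 ≤ mgauss (mtail a) := (norm_nonneg _).trans (le_mgauss ha hα0)
  refine ⟨D, hsys D a', TS_hsys hD1 a' (fun γ hγ => by simp [ha', hγ]), ?_, ?_, ?_⟩
  · intro x hx
    refine le_trans ?_ (le_TM _ hα x)
    have h1 : Tf (hsys D a') α x = ∑ δ ∈ Box n D, mpderiv a' α δ * mon x δ := by
      rw [Tf, hsys, Finset.mul_sum]
      refine Finset.sum_congr rfl fun δ _ => ?_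
      rw [mpderiv, ← fac_mul_chs]
      push_cast
      have : (δ + α) = fun j => δ j + α j := rfl
      rw [this]
      ring
    have h2 := mps_approx hK (b' := mpderiv a' α) (D := D) (mpderiv_conv ha α) he.le (fun δ _ => ?_) (fun δ hδ => ?_) hx
    · rw [← h1] at h2
      have h3 := h x hx
      have h4 : ‖Tf (hsys D a') α x‖ = ‖mpseval (mpderiv a α) x‖ := by
        apply um_eq
        rw [norm_sub_rev]
        linarith
      rw [h4]
      exact h3
    · rw [mpderiv, mpderiv, ← mul_sub, norm_mul]
      exact (mul_le_of_le_one_left (norm_nonneg _) (nat_norm_le _)).trans (haa _)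
    · refine (mpderiv_norm_le a α δ).trans (hD _ ?_)
      intro hc
      apply hδ
      rw [mem_Box] at hc ⊢
      intro i
      have := hc i
      simp at this
      omega
  · intro x hx γ hγ
    refine um_sum_le _ _ hG0 fun δ _ => ?_
    rw [norm_mul, norm_mul]
    have h1 : ‖a' (δ + γ)‖ ≤ mgauss (mtail a) := by
      refine (hal _).trans (le_mgauss ha ?_)
      intro h0
      have : γ = 0 := by
        ext j
        have := congrFun h0 j
        simp at this
        simp [this.2]
      rw [this] at hγ
      simp [deg] at hγ
    calc _ ≤ 1 * ‖a' (δ + γ)‖ * 1 := by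
          gcongr
          · exact nat_norm_le _
          · exact mon_norm_one hx δ
      _ ≤ _ := by linarith
  · intro x hx
    have h1 := mps_approx hK (b' := a') (D := D) ha he.le (fun δ _ => haa δ) hD hx
    have h2 : hsys D a' 0 x = ∑ δ ∈ Box n D, a' δ * mon x δ := by
      rw [hsys]
      refine Finset.sum_congr rfl fun δ _ => ?_
      simp [chs]
    rwa [h2]

theorem psi_eq {ψ : K → ℂ} (hψ : IsAddChar ψ) {u v : K} (h : ‖u - v‖ < 1) : ψ u = ψ v := by
  have : u = (u - v) + v := by ring
  rw [this, hψ.map_add, hψ.triv _ h, one_mul]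

theorem exists_repsn (hK : IsLocalField K q) (N n : ℕ) : ∃ S : Finset (Fin n → K), S.Nonempty ∧
    (∀ s ∈ S, ‖s‖ ≤ 1) ∧
    ∀ x : Fin n → K, ‖x‖ ≤ 1 → ∃! s, s ∈ S ∧ ‖x - s‖ ≤ (q : ℝ)⁻¹ ^ N := by
  obtain ⟨S, -, hS1, hS⟩ := exists_reps hK N
  have hr : (0:ℝ) ≤ (q : ℝ)⁻¹ ^ N := by positivity
  have h3 : ∀ x : Fin n → K, ‖x‖ ≤ 1 → ∃! s, s ∈ Fintype.piFinset (fun _ : Fin n => S) ∧ ‖x - s‖ ≤ (q : ℝ)⁻¹ ^ N := by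
    intro x hx
    choose s hs hu using fun i => hS (x i) ((norm_le_pi_norm x i).trans hx)
    refine ⟨s, ⟨Fintype.mem_piFinset.2 fun i => (hs i).1, ?_⟩, ?_⟩
    · rw [pi_norm_le_iff_of_nonneg hr]
      exact fun i => (hs i).2
    · rintro t ⟨ht1, ht2⟩
      ext i
      refine hu i (t i) ⟨Fintype.mem_piFinset.1 ht1 i, ?_⟩
      exact (norm_le_pi_norm (x - t) i).trans ht2
  refine ⟨_, ?_, ?_, h3⟩
  · obtain ⟨s, hs, -⟩ := h3 0 (by simp)
    exact ⟨s, hs.1⟩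
  · intro s hs
    rw [pi_norm_le_iff_of_nonneg zero_le_one]
    exact fun i => hS1 _ (Fintype.mem_piFinset.1 hs i)

theorem map_restrict_eq [MeasurableSpace K] [IsUltrametricDist K] (μ : Measure (Fin n → K)) (hμ : μ.IsAddHaarMeasure)
    (h1 : μ (polydisc K n) = 1) {p : Fin n → K} (hp : ‖p‖ ≤ 1) :
    AEMeasurable (fun x => p + x) (μ.restrict (polydisc K n)) ∧
    (μ.restrict (polydisc K n)).map (fun x => p + x) = μ.restrict (polydisc K n) := by
  have hm : ∀ g : Fin n → K, μ.map (fun x => g + x) = μ := fun g => map_add_left_eq_self μ g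
  have hμ0 : μ ≠ 0 := by
    rintro rfl
    simp at h1
  have hae : ∀ g : Fin n → K, AEMeasurable (fun x => g + x) μ := by
    intro g
    by_contra hc
    have := hm g
    rw [Measure.map_of_not_aemeasurable hc] at this
    exact hμ0 this.symm
  have hle : ∀ (g : Fin n → K) (t : Set (Fin n → K)), μ ((fun x => g + x) ⁻¹' t) ≤ μ t := by
    intro g t
    have := Measure.le_map_apply (hae g) t
    rwa [hm g] at this
  have heq : ∀ (g : Fin n → K) (t : Set (Fin n → K)), μ ((fun x => g + x) ⁻¹' t) = μ t := by
    intro g t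
    refine le_antisymm (hle g t) ?_
    have := hle (-g) ((fun x => g + x) ⁻¹' t)
    rw [← Set.preimage_comp] at this
    have e : (fun x => g + x) ∘ (fun x => -g + x) = id := by
      ext x
      simp
    rwa [e, Set.preimage_id] at this
  refine ⟨(hae p).restrict, ?_⟩
  ext t ht
  rw [Measure.map_apply_of_aemeasurable (hae p).restrict ht,
    Measure.restrict_apply₀ ((hae p).restrict.nullMeasurable ht), Measure.restrict_apply ht,
    ← heq p (t ∩ polydisc K n)]
  congr 1
  ext x
  simp only [Set.mem_inter_iff, Set.mem_preimage, mem_polydisc, and_congr_right_iff]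
  intro _
  constructor
  · intro hx
    exact (IsUltrametricDist.norm_add_le_max _ _).trans (max_le hp hx)
  · intro hx
    have : x = (p + x) - p := by abel
    rw [this]
    exact (um_sub _ _).trans (max_le hx hp)

theorem int_eq_avg [MeasurableSpace K] [IsUltrametricDist K] (μ : Measure (Fin n → K)) (hμ : μ.IsAddHaarMeasure)
    (h1 : μ (polydisc K n) = 1) (F : (Fin n → K) → ℂ) (hF : ∀ x, ‖F x‖ = 1) (S : Finset (Fin n → K))
    (hS : S.Nonempty) (hS1 : ∀ s ∈ S, ‖s‖ ≤ 1) (hsum : ∀ x, ‖x‖ ≤ 1 → ∑ s ∈ S, F (s + x) = ∑ s ∈ S, F s) :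
    ‖∫ x in polydisc K n, F x ∂μ‖ ≤ ‖(S.card : ℂ)⁻¹ * ∑ s ∈ S, F s‖ := by
  by_cases hFm : AEStronglyMeasurable F (μ.restrict (polydisc K n))
  swap
  · rw [integral_undef fun hc => hFm hc.1, norm_zero]
    exact norm_nonneg _
  apply le_of_eq
  congr 1
  obtain ⟨ν, hν⟩ : ∃ ν, ν = μ.restrict (polydisc K n) := ⟨_, rfl⟩
  have hmap : ∀ s ∈ S, AEMeasurable (fun x => s + x) ν ∧ ν.map (fun x => s + x) = ν := by
    intro s hs
    rw [hν]
    exact map_restrict_eq μ hμ h1 (hS1 s hs)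
  have hprob : IsProbabilityMeasure ν := ⟨by rw [hν, Measure.restrict_apply_univ, h1]⟩
  rw [← hν] at hFm ⊢
  have hFs : ∀ s ∈ S, AEStronglyMeasurable (fun x => F (s + x)) ν := by
    intro s hs
    obtain ⟨ha, hb⟩ := hmap s hs
    have : AEStronglyMeasurable F (ν.map (fun x => s + x)) := by rwa [hb]
    exact this.comp_aemeasurable ha
  have hI : ∀ s ∈ S, Integrable (fun x => F (s + x)) ν := fun s hs =>
    (integrable_const (1:ℝ)).mono' (hFs s hs) (Eventually.of_forall fun x => (hF _).le)
  have hintS : ∀ s ∈ S, ∫ x, F (s + x) ∂ν = ∫ x, F x ∂ν := by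
    intro s hs
    obtain ⟨ha, hb⟩ := hmap s hs
    have : AEStronglyMeasurable F (ν.map (fun x => s + x)) := by rwa [hb]
    rw [← integral_map ha this, hb]
  have e1 : ∫ x, ∑ s ∈ S, F (s + x) ∂ν = S.card * ∫ x, F x ∂ν := by
    rw [integral_finsetSum _ hI, Finset.sum_congr rfl hintS, Finset.sum_const, nsmul_eq_mul]
  have e2 : ∫ x, ∑ s ∈ S, F (s + x) ∂ν = ∑ s ∈ S, F s := by
    have hn : NullMeasurableSet {x | ∑ s ∈ S, F (s + x) = ∑ s ∈ S, F s} ν :=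
      (Finset.aestronglyMeasurable_fun_sum S hFs).nullMeasurableSet_eq_fun aestronglyMeasurable_const
    have : ∀ᵐ x ∂ν, ∑ s ∈ S, F (s + x) = ∑ s ∈ S, F s := by
      rw [hν] at hn ⊢
      rw [ae_restrict_iff₀ hn]
      exact Eventually.of_forall fun x hx => hsum x ((mem_polydisc x).1 hx)
    rw [integral_congr_ae this, integral_const, probReal_univ, one_smul]
  rw [← e2, e1, ← mul_assoc, inv_mul_cancel₀, one_mul]
  exact_mod_cast hS.card_pos.ne'

end

theorem final (n k q : ℕ) (hn : 0 < n) (hk : 0 < k) (hq : 1 < q) :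
    ∃ d : ℝ → ℝ,
      ∀ (K : Type) [NontriviallyNormedField K] [MeasurableSpace K]
        (μ : Measure (Fin n → K)), μ.IsAddHaarMeasure → μ (polydisc K n) = 1 →
        IsLocalField K q → CharCond K k → ∀ ψ : K → ℂ, IsAddChar ψ →
        ∀ (a : (Fin n → ℕ) → K) (α : Fin n → ℕ), MIsConvergent a →
          (∑ j, α j) = k →
          (∀ x : Fin n → K, x ∈ polydisc K n → 1 ≤ ‖mpseval (mpderiv a α) x‖) →
          ∀ y : K, y ≠ 0 →
            ‖∫ x in polydisc K n, ψ (y * mpseval a x) ∂μ‖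
              ≤ d (mgauss (mtail a)) * ‖y‖ ^ (-(1 : ℝ) / k) := by
  refine ⟨fun G => if hG : 1 ≤ G then Classical.choose (avg_bound n q k hn hk hq G hG) else 0, ?_⟩
  intro K _ _ μ hμ hμ1 hK hch ψ hψ a α ha hα hder y hy
  have hU := lf_ultra hK
  have hq1 := lf_q1 hK
  have hα0 : α ≠ 0 := by
    rintro rfl
    simp at hα
    omega
  have hder' : ∀ x : Fin n → K, ‖x‖ ≤ 1 → 1 ≤ ‖mpseval (mpderiv a α) x‖ := fun x hx =>
    hder x ((mem_polydisc x).2 hx)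
  have hG := gauss_ge_one hK ha hα0 (hder' 0 (by simp))
  simp only [dif_pos hG]
  have hC := (Classical.choose_spec (avg_bound n q k hn hk hq _ hG)).2
  obtain ⟨G, hGdef⟩ : ∃ G, G = mgauss (mtail a) := ⟨_, rfl⟩
  have hG1 : 1 ≤ G := by rw [hGdef]; exact hG
  have hy0 : 0 < ‖y‖ := norm_pos_iff.2 hy
  obtain ⟨e, he0, he1⟩ : ∃ e : ℝ, 0 < e ∧ e < min 1 ‖y‖⁻¹ := exists_between (by positivity)
  obtain ⟨D, h, H, hT, hB, hap⟩ := trunc hK ha hk hα hder' he0 (he1.trans_le (min_le_left _ _))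
  have hFh : ∀ x : Fin n → K, ‖x‖ ≤ 1 → ψ (y * mpseval a x) = ψ (y * h 0 x) := by
    intro x hx
    apply psi_eq hψ
    rw [← mul_sub, norm_mul]
    calc ‖y‖ * _ ≤ ‖y‖ * e := by gcongr; exact hap x hx
      _ < ‖y‖ * ‖y‖⁻¹ := by gcongr; exact he1.trans_le (min_le_right _ _)
      _ = 1 := mul_inv_cancel₀ hy0.ne'
  obtain ⟨N, hN⟩ := exists_pow_lt_of_lt_one (show 0 < (‖y‖ * G)⁻¹ by positivity) (inv_lt_one_of_one_lt₀ hq1)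
  obtain ⟨S, hS, hS1, hSr⟩ := exists_repsn hK N n
  have hloc : ∀ x x' : Fin n → K, ‖x‖ ≤ 1 → ‖x'‖ ≤ 1 → ‖x - x'‖ ≤ (q : ℝ)⁻¹ ^ N →
      ψ (y * h 0 x) = ψ (y * h 0 x') := by
    intro x x' hx hx' hxx
    apply psi_eq hψ
    rw [← mul_sub, norm_mul]
    have hl := Tf_lip H 0 x' (x - x') G (by linarith)
      (fun γ' hγ' => by rw [hGdef]; exact hB x' hx' γ' (by omega))
      ((um_sub _ _).trans (max_le hx hx'))
    have e1 : ∀ z, Tf h 0 z = h 0 z := by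
      intro z
      simp [Tf, fac]
    rw [e1, e1, add_sub_cancel] at hl
    calc ‖y‖ * _ ≤ ‖y‖ * (G * ‖x - x'‖) := by gcongr
      _ ≤ (‖y‖ * G) * (q : ℝ)⁻¹ ^ N := by rw [mul_assoc]; gcongr
      _ < (‖y‖ * G) * (‖y‖ * G)⁻¹ := by gcongr
      _ = 1 := mul_inv_cancel₀ (by positivity)
  have hsum : ∀ x : Fin n → K, ‖x‖ ≤ 1 → ∑ s ∈ S, ψ (y * h 0 (s + x)) = ∑ s ∈ S, ψ (y * h 0 s) := by
    intro x hx
    have := reps_sum S hS1 hSr (fun x => ψ (y * h 0 x)) hloc x hx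
    simpa only [add_comm x] using this
  have hFS : ∑ s ∈ S, ψ (y * mpseval a s) = ∑ s ∈ S, ψ (y * h 0 s) :=
    Finset.sum_congr rfl fun s hs => hFh s (hS1 s hs)
  refine (int_eq_avg μ hμ hμ1 (fun x => ψ (y * mpseval a x)) (fun x => hψ.norm_eq _) S hS hS1 ?_).trans ?_
  · intro x hx
    rw [hFS, ← hsum x hx]
    refine Finset.sum_congr rfl fun s hs => hFh _ ?_
    exact (IsUltrametricDist.norm_add_le_max _ _).trans (max_le (hS1 s hs) hx)
  · rw [hFS]
    exact hC K hK hch ψ hψ D h H hT hB y hy S hS hS1 hsum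

end VdC9
end

open VdC in
/-- Proposition 3.5.  Let `f ∈ K⦃x₁,…,xₙ⦄` with `|∂^α f(x)| ≥ 1` on
`O_K^n` for some multi-index `α` with `|α| = k > 0`, and suppose the characteristic of
`K` is zero or `> k`.  Then `|∫_{O_K^n} ψ(y f(x)) dx| ≤ d_k |y|^{-1/k}` for all nonzero
`y ∈ K`, where `d_k` depends only on `K`, `n`, `k` and `‖f - f(0)‖`. -/
theorem statement9 (n k q : ℕ) (hn : 0 < n) (hk : 0 < k) (hq : 1 < q) :
    ∃ d : ℝ → ℝ,
      ∀ (K : Type) [NontriviallyNormedField K] [MeasurableSpace K]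
        (μ : Measure (Fin n → K)), μ.IsAddHaarMeasure → μ (polydisc K n) = 1 →
        IsLocalField K q → CharCond K k → ∀ ψ : K → ℂ, IsAddChar ψ →
        ∀ (a : (Fin n → ℕ) → K) (α : Fin n → ℕ), MIsConvergent a →
          (∑ j, α j) = k →
          (∀ x : Fin n → K, x ∈ polydisc K n → 1 ≤ ‖mpseval (mpderiv a α) x‖) →
          ∀ y : K, y ≠ 0 →
            ‖∫ x in polydisc K n, ψ (y * mpseval a x) ∂μ‖
              ≤ d (mgauss (mtail a)) * ‖y‖ ^ (-(1 : ℝ) / k) := by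
  exact VdC9.final n k q hn hk hq
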